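/- arXiv:1404.7738 — 4 statements merged into one kernel-verified Lean document; each statement's English description precedes it below -/
import Mathlib

section
/- Let $(A,B) \in \mathbb{Z}^2$ with $4A^3 + 27B^2 \neq 0$. Let $d \geq 1$ be a squarefree integer and let $(x,y,z) \in \mathbb{Z} \times \mathbb{Z}_{\geq 1} \times \mathbb{Z}_{\geq 1}$ satisfy $\gcd(x,y,z) = 1$ and $d y^2 z = x^3 + A x z^2 + B z^3$. Then there exists a unique quadruple $(d_0, d_1, b_1, x_1) \in \mathbb{Z}_{\geq 1}^3 \times \mathbb{Z}$ such that $x = d_1 b_1 x_1$, $z = d_1^2 b_1^3$, $d = d_0 d_1$, the product $d_0 d_1$ is squarefree, $\gcd(x_1, d_1 b_1) = 1$, and $d_0 y^2 = x_1^3 + A x_1 d_1^2 b_1^4 + B d_1^3 b_1^6$. -/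
theorem gcd_aux (x z d b w : ℤ) (hd : 1 ≤ d) (hb : 1 ≤ b) (hx : x = d * b * w)
    (hz : z = d ^ 2 * b ^ 3) (h : Int.gcd w (d * b) = 1) : (Int.gcd x z : ℤ) = d * b := by
  have h0 : IsCoprime w (d * b) := Int.isCoprime_iff_gcd_eq_one.mpr h
  have h1 : IsCoprime w (d * b * b) := h0.mul_right (h0.of_mul_right_right)
  have h2 : Int.gcd w (d * b * b) = 1 := Int.isCoprime_iff_gcd_eq_one.mp h1
  have hz' : z = d * b * (d * b * b) := by rw [hz]; ring
  rw [hx, hz', Int.gcd_mul_left, h2, mul_one]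
  exact Int.natAbs_of_nonneg (by positivity)

/-- Descent parametrization of integral points on the homogenized quadratic
twist `d y² z = x³ + A x z² + B z³` (Lemma 1 of the paper). -/
theorem stmt_0 (A B : ℤ) (hAB : 4 * A ^ 3 + 27 * B ^ 2 ≠ 0)
    (d : ℤ) (hd : 1 ≤ d) (hdsf : Squarefree d)
    (x y z : ℤ) (hy : 1 ≤ y) (hz : 1 ≤ z)
    (hgcd : Int.gcd (Int.gcd x y) z = 1)
    (heq : d * y ^ 2 * z = x ^ 3 + A * x * z ^ 2 + B * z ^ 3) :
    ∃! t : ℤ × ℤ × ℤ × ℤ,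
      match t with
      | (d₀, d₁, b₁, x₁) =>
        1 ≤ d₀ ∧ 1 ≤ d₁ ∧ 1 ≤ b₁ ∧
        x = d₁ * b₁ * x₁ ∧
        z = d₁ ^ 2 * b₁ ^ 3 ∧
        d = d₀ * d₁ ∧
        Squarefree (d₀ * d₁) ∧
        Int.gcd x₁ (d₁ * b₁) = 1 ∧
        d₀ * y ^ 2 = x₁ ^ 3 + A * x₁ * d₁ ^ 2 * b₁ ^ 4 + B * d₁ ^ 3 * b₁ ^ 6 := by
  have hg0 : 0 < Int.gcd x z := Int.gcd_pos_of_ne_zero_right _ (by lia)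
  obtain ⟨x₁, hx₁⟩ : (Int.gcd x z : ℤ) ∣ x := Int.gcd_dvd_left ..
  obtain ⟨z₁, hz₁⟩ : (Int.gcd x z : ℤ) ∣ z := Int.gcd_dvd_right ..
  have hcop : IsCoprime x₁ z₁ := by
    rw [Int.isCoprime_iff_gcd_eq_one]
    have h := Int.gcd_mul_left (Int.gcd x z : ℤ) x₁ z₁
    rw [← hx₁, ← hz₁, Int.natAbs_natCast] at h
    exact Nat.eq_of_mul_eq_mul_left hg0 (by lia)
  have hgy : IsCoprime (Int.gcd x z : ℤ) y := by
    rw [Int.isCoprime_iff_gcd_eq_one]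
    have h1 : ((Int.gcd (Int.gcd x z : ℤ) y : ℕ) : ℤ) ∣ Int.gcd (Int.gcd x y) z := by
      apply Int.dvd_coe_gcd
      · apply Int.dvd_coe_gcd
        · exact (Int.gcd_dvd_left ..).trans (Int.gcd_dvd_left ..)
        · exact Int.gcd_dvd_right ..
      · exact (Int.gcd_dvd_left ..).trans (Int.gcd_dvd_right ..)
    rw [hgcd] at h1
    exact Nat.dvd_one.mp (by exact_mod_cast h1)
  obtain ⟨g, hg⟩ : ∃ g : ℤ, g = (Int.gcd x z : ℤ) := ⟨_, rfl⟩
  have hgpos : 0 < g := by rw [hg]; exact_mod_cast hg0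
  rw [← hg] at hx₁ hz₁ hgy
  have hz₁pos : 0 < z₁ := by
    by_contra hn
    nlinarith
  have e1 : d * y ^ 2 * z₁ = g ^ 2 * (x₁ ^ 3 + A * x₁ * z₁ ^ 2 + B * z₁ ^ 3) := by
    apply mul_left_cancel₀ hgpos.ne'
    rw [hx₁, hz₁] at heq
    linear_combination heq
  have hF : IsCoprime z₁ (x₁ ^ 3 + A * x₁ * z₁ ^ 2 + B * z₁ ^ 3) := by
    have h : IsCoprime z₁ (x₁ ^ 3 + z₁ * (A * x₁ * z₁ + B * z₁ ^ 2)) :=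
      (hcop.symm.pow_right (n := 3)).add_mul_left_right _
    convert h using 1
    ring
  obtain ⟨k, hk⟩ : z₁ ∣ g ^ 2 := hF.dvd_of_dvd_mul_right ⟨d * y ^ 2, by rw [← e1]; ring⟩
  have hgd : g ^ 2 ∣ d * z₁ := (hgy.pow (m := 2) (n := 2)).dvd_of_dvd_mul_right
    ⟨x₁ ^ 3 + A * x₁ * z₁ ^ 2 + B * z₁ ^ 3, by rw [← e1]; ring⟩
  obtain ⟨m, hm⟩ := hgd
  have hdk : d = m * k := by
    apply mul_left_cancel₀ hz₁pos.ne'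
    rw [hk] at hm
    linear_combination hm
  have hkpos : 0 < k := by
    by_contra hn
    nlinarith [pow_pos hgpos 2]
  have hmpos : 0 < m := by
    by_contra hn
    nlinarith
  have hksf : Squarefree k := hdsf.squarefree_of_dvd ⟨m, by rw [hdk]; ring⟩
  obtain ⟨b, hb⟩ : k ∣ g := (hksf.dvd_pow_iff_dvd two_ne_zero).mp ⟨z₁, by rw [hk]; ring⟩
  have hbpos : 0 < b := by
    by_contra hn
    nlinarith
  have hzb : z₁ = k * b ^ 2 := by
    apply mul_left_cancel₀ hkpos.ne'
    rw [hb] at hk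
    linear_combination -hk
  have hc2 : IsCoprime x₁ (k * b) := by
    rw [hzb] at hcop
    exact hcop.of_isCoprime_of_dvd_right ⟨b, by ring⟩
  refine ⟨(m, k, b, x₁), ⟨by lia, by lia, by lia, ?_, ?_, hdk, hdk ▸ hdsf,
    Int.isCoprime_iff_gcd_eq_one.mp hc2, ?_⟩, ?_⟩
  · rw [hx₁, hb]
  · rw [hz₁, hb, hzb]; ring
  · have h3 : g ^ 2 * (m * y ^ 2) = g ^ 2 * (x₁ ^ 3 + A * x₁ * z₁ ^ 2 + B * z₁ ^ 3) := by
      rw [← e1]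
      linear_combination (-y ^ 2) * hm
    have h4 := mul_left_cancel₀ (pow_pos hgpos 2).ne' h3
    rw [hzb] at h4
    linear_combination h4
  · rintro ⟨d0, d1, b1, w⟩ ⟨_, p1, p2, q1, q2, q3, _, q5, _⟩
    have hgg : g = d1 * b1 := hg.trans (gcd_aux x z d1 b1 w p1 p2 q1 q2 q5)
    have hb1 : b1 = b := by
      apply mul_left_cancel₀ (pow_pos hgpos 2).ne'
      have r1 : g ^ 2 * b1 = z := by rw [hgg, q2]; ring
      have r2 : g ^ 2 * b = z := by rw [hz₁, hzb, hb]; ring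
      rw [r1, r2]
    subst hb1
    have hd1 : d1 = k := mul_right_cancel₀ hbpos.ne' (hgg.symm.trans hb)
    subst hd1
    have hd0 : d0 = m := mul_right_cancel₀ hkpos.ne' (q3.symm.trans hdk)
    have hw : w = x₁ := by
      apply mul_left_cancel₀ hgpos.ne'
      rw [← hx₁, q1, hgg]
    rw [hd0, hw]
end

section
/- Let $\mathbf{f} = (f_1, f_2, f_3) \in \mathbb{Z}_{\neq 0}^3$ be a vector of pairwise coprime nonzero integers, and let $U_1, U_2, U_3, V_1, V_2, V_3 \geq 1$ be real numbers. Let $N_{\mathbf{f}}(U_1,U_2,U_3,V_1,V_2,V_3)$ denote the number of pairs of vectors $(u_1,u_2,u_3) \in \mathbb{Z}_{\neq 0}^3$ and $(v_1,v_2,v_3) \in \mathbb{Z}_{\neq 0}^3$ satisfying $|u_i| \leq U_i$ and $|v_i| \leq V_i$ for $i \in \{1,2,3\}$, the equation $f_1 u_1 v_1^2 + f_2 u_2 v_2^2 + f_3 u_3 v_3^2 = 0$, and $\gcd(u_i v_i, u_j v_j) = 1$ for all $i \neq j$ in $\{1,2,3\}$. Then for every fixed $\varepsilon > 0$ there exists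 a constant $C$ depending only on $\mathbf{f}$ and $\varepsilon$ such that $N_{\mathbf{f}}(U_1,U_2,U_3,V_1,V_2,V_3) \leq C \, (U_1 U_2 U_3)^{2/3 + \varepsilon} (V_1 V_2 V_3)^{1/3}$. -/
/-- Counting points on a line with pairwise gaps. -/
lemma gap_count {ι : Type*} (S : Finset ι) (g : ι → ℝ) (b δ : ℝ) (hδ : 0 < δ) (hb : 0 ≤ b)
    (h0 : ∀ i ∈ S, 0 ≤ g i) (h1 : ∀ i ∈ S, g i ≤ b)
    (hg : ∀ i ∈ S, ∀ j ∈ S, i ≠ j → δ ≤ |g i - g j|) : (S.card : ℝ) ≤ 1 + b / δ := by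
  have hinj : Set.InjOn (fun i => ⌊g i / δ⌋₊) (S : Set ι) := by
    intro i hi j hj hij
    by_contra hne
    have h := hg i hi j hj hne
    have e1 := Nat.floor_le (div_nonneg (h0 i hi) hδ.le)
    have e2 := Nat.lt_floor_add_one (g i / δ)
    have e3 := Nat.floor_le (div_nonneg (h0 j hj) hδ.le)
    have e4 := Nat.lt_floor_add_one (g j / δ)
    simp only at hij
    rw [hij] at e1 e2
    have : |g i / δ - g j / δ| < 1 := by
      rw [abs_lt]; constructor <;> linarith
    rw [← sub_div, abs_div, abs_of_pos hδ, div_lt_one hδ] at this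
    linarith
  have hmap : ∀ i ∈ S, ⌊g i / δ⌋₊ ∈ Finset.range (⌊b / δ⌋₊ + 1) := by
    intro i hi
    rw [Finset.mem_range, Nat.lt_succ_iff]
    exact Nat.floor_le_floor (div_le_div_of_nonneg_right (h1 i hi) hδ.le)
  have := Finset.card_le_card_of_injOn _ hmap hinj
  rw [Finset.card_range] at this
  have h2 := Nat.floor_le (div_nonneg hb hδ.le)
  have h3 : (S.card : ℝ) ≤ (⌊b / δ⌋₊ : ℝ) + 1 := by exact_mod_cast this
  linarith

lemma cube_gap (x y R : ℝ) (hR : 0 < R) (hy : 1 ≤ y * R) (hxy : y < x)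
    (h : x * y ≤ (x ^ 3 - y ^ 3) * R) : 1 / (4 * R) ≤ x - y := by
  have hy0 : 0 < y := by
    by_contra hc
    push Not at hc
    nlinarith
  rw [div_le_iff₀ (by positivity)]
  by_cases hc : x ≤ 2 * y
  · have h1 : x ^ 3 - y ^ 3 ≤ (x - y) * (4 * (x * y)) := by
      have : x ^ 3 - y ^ 3 = (x - y) * (x ^ 2 + x * y + y ^ 2) := by ring
      rw [this]
      apply mul_le_mul_of_nonneg_left _ (by linarith)
      nlinarith
    have hp : 0 < x * y := by nlinarith
    have h2 : x * y * 1 ≤ x * y * ((x - y) * (4 * R)) := by nlinarith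
    exact le_of_mul_le_mul_left h2 hp
  · push Not at hc
    nlinarith

lemma slope_count {ι : Type*} (S : Finset ι) (t q : ι → ℝ) (Q W R : ℝ)
    (hW : 0 < W) (hR : 0 < R) (hQW : Q * W ^ 2 ≤ R ^ 3)
    (ht0 : ∀ i ∈ S, 0 < t i) (ht1 : ∀ i ∈ S, t i ≤ 1)
    (hq0 : ∀ i ∈ S, 0 < q i) (hq1 : ∀ i ∈ S, q i ≤ Q) (hqt : ∀ i ∈ S, q i * t i ≤ W)
    (hsep : ∀ i ∈ S, ∀ j ∈ S, i ≠ j → 1 ≤ (t i - t j) ^ 2 * (q i * q j)) :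
    (S.card : ℝ) ≤ 3 + 4 * R := by
  classical
  -- cube roots
  let x : ι → ℝ := fun i => (t i) ^ ((1 : ℝ) / 3)
  have hx3 : ∀ i ∈ S, x i ^ 3 = t i := by
    intro i hi
    simp only [x]
    rw [← Real.rpow_natCast, ← Real.rpow_mul (ht0 i hi).le]
    norm_num
  have hx0 : ∀ i ∈ S, 0 < x i := fun i hi => Real.rpow_pos_of_pos (ht0 i hi) _
  have hx1 : ∀ i ∈ S, x i ≤ 1 := fun i hi =>
    Real.rpow_le_one (ht0 i hi).le (ht1 i hi) (by norm_num)
  have hqx : ∀ i ∈ S, q i * x i ^ 2 ≤ R := by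
    intro i hi
    have h1 : (q i * x i ^ 2) ^ 3 ≤ R ^ 3 := by
      calc (q i * x i ^ 2) ^ 3 = q i * (q i * x i ^ 3) ^ 2 := by ring
        _ = q i * (q i * t i) ^ 2 := by rw [hx3 i hi]
        _ ≤ Q * W ^ 2 := by
          have := hq0 i hi
          have := ht0 i hi
          have := hq1 i hi
          have := hqt i hi
          have : 0 ≤ Q := by linarith
          gcongr
        _ ≤ R ^ 3 := hQW
    exact le_of_pow_le_pow_left₀ (by norm_num) hR.le h1
  have hcub : ∀ i ∈ S, ∀ j ∈ S, i ≠ j → x j ≤ x i → x i * x j ≤ (x i ^ 3 - x j ^ 3) * R := by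
    intro i hi j hj hij hle
    have h := hsep i hi j hj hij
    rw [← hx3 i hi, ← hx3 j hj] at h
    have hd : 0 ≤ x i ^ 3 - x j ^ 3 := by
      have := pow_le_pow_left₀ (hx0 j hj).le hle 3
      linarith
    apply le_of_pow_le_pow_left₀ (n := 2) (by norm_num) (by positivity)
    have hqi := hq0 i hi
    have hqj := hq0 j hj
    calc (x i * x j) ^ 2 = (x i * x j) ^ 2 * 1 := by ring
      _ ≤ (x i * x j) ^ 2 * ((x i ^ 3 - x j ^ 3) ^ 2 * (q i * q j)) := by gcongr
      _ = (x i ^ 3 - x j ^ 3) ^ 2 * ((q i * x i ^ 2) * (q j * x j ^ 2)) := by ring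
      _ ≤ (x i ^ 3 - x j ^ 3) ^ 2 * (R * R) := by
        have := hqx i hi
        have := hqx j hj
        gcongr
      _ = _ := by ring
  have hbig : (((S.filter (fun i => 1 ≤ x i * R)).card : ℕ) : ℝ) ≤ 1 + 1 / (1 / (4 * R)) := by
    apply gap_count _ x 1 (1 / (4 * R)) (by positivity) (by norm_num)
    · intro i hi; exact (hx0 i (Finset.mem_filter.1 hi).1).le
    · intro i hi; exact (hx1 i (Finset.mem_filter.1 hi).1)
    · have key : ∀ i ∈ S, ∀ j ∈ S, i ≠ j → 1 ≤ x j * R → x j ≤ x i → 1 / (4 * R) ≤ x i - x j := by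
        intro i hi j hj hij hj1 hle
        have h := hcub i hi j hj hij hle
        apply cube_gap _ _ R hR hj1 _ h
        rcases hle.lt_or_eq with h' | h'
        · exact h'
        · exfalso
          rw [h'] at h
          have := hx0 i hi
          nlinarith
      intro i hi j hj hij
      rw [Finset.mem_filter] at hi hj
      rcases le_total (x j) (x i) with h | h
      · exact (key i hi.1 j hj.1 hij hj.2 h).trans (le_abs_self _)
      · rw [abs_sub_comm]
        exact (key j hj.1 i hi.1 hij.symm hi.2 h).trans (le_abs_self _)
  have hsmall : (S.filter (fun i => ¬ 1 ≤ x i * R)).card ≤ 2 := by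
    set T := S.filter (fun i => ¬ 1 ≤ x i * R) with hT
    have hTS : ∀ i ∈ T, i ∈ S := fun i hi => (Finset.mem_filter.1 hi).1
    have hTs : ∀ i ∈ T, t i * (Q * W ^ 2) < 1 := by
      intro i hi
      have h1 := (Finset.mem_filter.1 hi).2
      push Not at h1
      have h2 : (x i * R) ^ 3 < 1 :=
        pow_lt_one₀ (mul_nonneg (hx0 i (hTS i hi)).le hR.le) h1 (by norm_num)
      rw [mul_pow, hx3 i (hTS i hi)] at h2
      have := ht0 i (hTS i hi)
      nlinarith
    by_cases hne : T.Nonempty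
    · obtain ⟨m, hm, hmin⟩ := T.exists_min_image t hne
      by_contra hcard
      push Not at hcard
      have : 1 < (T.erase m).card := by rw [Finset.card_erase_of_mem hm]; omega
      obtain ⟨a, ha, b, hb, hab⟩ := Finset.one_lt_card.1 this
      have main : ∀ a ∈ T, ∀ b ∈ T, a ≠ m → b ≠ a → t a ≤ t b → False := by
        intro a ha b hb ham hba hle
        have ha' := hTS a ha
        have hb' := hTS b hb
        have hm' := hTS m hm
        have s1 := hsep a ha' m hm' ham
        have s2 := hsep b hb' a ha' hba
        have hQ : 0 < Q := (hq0 a ha').trans_le (hq1 a ha')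
        have e1 : 1 ≤ t a * Q := by
          apply le_of_pow_le_pow_left₀ (n := 2) (by norm_num) (by have := ht0 a ha'; positivity)
          have : (t a - t m) ^ 2 ≤ t a ^ 2 := by
            have := hmin a ha
            have := ht0 m hm'
            nlinarith
          calc (1 : ℝ) ^ 2 = 1 := by norm_num
            _ ≤ _ := s1
            _ ≤ t a ^ 2 * (Q * Q) := by
              have := hq0 a ha'
              have := hq0 m hm'
              have := hq1 a ha'
              have := hq1 m hm'
              gcongr
            _ = _ := by ring
        have e2 : t a * t b ≤ t b ^ 2 * W ^ 2 := by
          have hta := ht0 a ha'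
          have htb := ht0 b hb'
          have : (t b - t a) ^ 2 ≤ t b ^ 2 := by nlinarith
          calc t a * t b = (t a * t b) * 1 := by ring
            _ ≤ (t a * t b) * ((t b - t a) ^ 2 * (q b * q a)) := by gcongr
            _ = (t b - t a) ^ 2 * ((q b * t b) * (q a * t a)) := by ring
            _ ≤ t b ^ 2 * (W * W) := by
              have := hq0 a ha'
              have := hq0 b hb'
              have := hqt a ha'
              have := hqt b hb'
              gcongr
            _ = _ := by ring
        have e3 : t a ≤ t b * W ^ 2 := by
          apply le_of_mul_le_mul_left _ (ht0 b hb')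
          nlinarith
        have e4 := hTs b hb
        nlinarith
      rw [Finset.mem_erase] at ha hb
      rcases le_total (t a) (t b) with h | h
      · exact main a ha.2 b hb.2 ha.1 hab.symm h
      · exact main b hb.2 a ha.2 hb.1 hab h
    · rw [Finset.not_nonempty_iff_eq_empty] at hne
      rw [hne]; simp
  have hsum := Finset.card_filter_add_card_filter_not (s := S) (fun i => 1 ≤ x i * R)
  rw [← hsum]
  push_cast
  have : ((S.filter (fun i => ¬ 1 ≤ x i * R)).card : ℝ) ≤ 2 := by exact_mod_cast hsmall
  rw [one_div_one_div] at hbig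
  linarith

/-- Points on the cone `X² + Y² = Z²` with pairwise separation. -/
lemma cone_count_aux {ι : Type*} (S : Finset ι) (X Y Z : ι → ℝ) (W₁ W₂ W₃ B ρ : ℝ)
    (hW₁ : 0 < W₁) (hW₃ : 0 < W₃) (hB : 0 < B) (hρ : 0 < ρ) (hle : W₁ ≤ W₂)
    (hbd : (W₁ * W₂ * W₃) ^ 2 ≤ ρ ^ 6 * B ^ 3)
    (hX : ∀ i ∈ S, 0 < X i) (hY : ∀ i ∈ S, 0 < Y i) (hZ : ∀ i ∈ S, 0 < Z i)
    (hX' : ∀ i ∈ S, X i ≤ W₁) (hZ' : ∀ i ∈ S, Z i ≤ W₃)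
    (heq : ∀ i ∈ S, X i ^ 2 + Y i ^ 2 = Z i ^ 2)
    (hsep : ∀ i ∈ S, ∀ j ∈ S, i ≠ j → B ≤ Z i * Z j - X i * X j - Y i * Y j) :
    (S.card : ℝ) ≤ 3 + 8 * ρ := by
  set E := Real.sqrt B with hE
  have hE0 : 0 < E := Real.sqrt_pos.2 hB
  have hEB : E ^ 2 = B := Real.sq_sqrt hB.le
  have h := slope_count S (fun i => X i / (Z i + Y i)) (fun i => (Z i + Y i) / E)
    (2 * W₃ / E) (W₁ / E) (2 * ρ) (by positivity) (by positivity) ?_ ?_ ?_ ?_ ?_ ?_ ?_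
  · linarith
  · have h1 : W₁ * W₂ * W₃ ≤ (ρ * E) ^ 3 := by
      apply le_of_pow_le_pow_left₀ (n := 2) (by norm_num) (by positivity)
      calc _ ≤ _ := hbd
        _ = _ := by rw [← hEB]; ring
    have h2 : W₁ * W₁ * W₃ ≤ W₁ * W₂ * W₃ := by gcongr
    have h3 : 2 * W₃ / E * (W₁ / E) ^ 2 = 2 * (W₁ * W₁ * W₃) / E ^ 3 := by
      field_simp
    rw [h3, div_le_iff₀ (by positivity)]
    have : 0 < (ρ * E) ^ 3 := by positivity
    nlinarith
  · intro i hi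
    have := hX i hi
    have := hY i hi
    have := hZ i hi
    positivity
  · intro i hi
    have := hX i hi
    have := hY i hi
    have := hZ i hi
    have := heq i hi
    rw [div_le_one (by positivity)]
    nlinarith
  · intro i hi
    have := hY i hi
    have := hZ i hi
    positivity
  · intro i hi
    have := hX i hi
    have := hY i hi
    have := hZ i hi
    have := hZ' i hi
    have := heq i hi
    gcongr
    nlinarith
  · intro i hi
    have := hX i hi
    have := hY i hi
    have := hZ i hi
    have := hX' i hi
    have : (Z i + Y i) / E * (X i / (Z i + Y i)) = X i / E := by field_simp
    rw [this]
    gcongr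
  · intro i hi j hj hij
    have a1 := hX i hi
    have a2 := hY i hi
    have a3 := hZ i hi
    have b1 := hX j hj
    have b2 := hY j hj
    have b3 := hZ j hj
    have a4 := heq i hi
    have b4 := heq j hj
    have hs := hsep i hi j hj hij
    have e : (X i / (Z i + Y i) - X j / (Z j + Y j)) ^ 2 * ((Z i + Y i) / E * ((Z j + Y j) / E))
        = 2 * (Z i * Z j - X i * X j - Y i * Y j) / B := by
      rw [← hEB]
      have p1 : Z i + Y i ≠ 0 := by positivity
      have p2 : Z j + Y j ≠ 0 := by positivity
      have q1 : X i ^ 2 = (Z i + Y i) * (Z i - Y i) := by linear_combination a4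
      have q2 : X j ^ 2 = (Z j + Y j) * (Z j - Y j) := by linear_combination b4
      field_simp
      linear_combination (Z j + Y j) ^ 2 * q1 + (Z i + Y i) ^ 2 * q2
    rw [e, le_div_iff₀ hB]
    linarith

lemma cone_count {ι : Type*} (S : Finset ι) (X Y Z : ι → ℝ) (W₁ W₂ W₃ B ρ : ℝ)
    (hW₁ : 0 < W₁) (hW₂ : 0 < W₂) (hW₃ : 0 < W₃) (hB : 0 < B) (hρ : 0 < ρ)
    (hbd : (W₁ * W₂ * W₃) ^ 2 ≤ ρ ^ 6 * B ^ 3)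
    (hX : ∀ i ∈ S, 0 < X i) (hY : ∀ i ∈ S, 0 < Y i) (hZ : ∀ i ∈ S, 0 < Z i)
    (hX' : ∀ i ∈ S, X i ≤ W₁) (hY' : ∀ i ∈ S, Y i ≤ W₂) (hZ' : ∀ i ∈ S, Z i ≤ W₃)
    (heq : ∀ i ∈ S, X i ^ 2 + Y i ^ 2 = Z i ^ 2)
    (hsep : ∀ i ∈ S, ∀ j ∈ S, i ≠ j → B ≤ |Z i * Z j - X i * X j - Y i * Y j|) :
    (S.card : ℝ) ≤ 3 + 8 * ρ := by
  have hsep' : ∀ i ∈ S, ∀ j ∈ S, i ≠ j → B ≤ Z i * Z j - X i * X j - Y i * Y j := by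
    intro i hi j hj hij
    have h := hsep i hi j hj hij
    rwa [abs_of_nonneg] at h
    have a3 := hZ i hi
    have b3 := hZ j hj
    have a4 := heq i hi
    have b4 := heq j hj
    have : X i * X j + Y i * Y j ≤ Z i * Z j := by
      apply le_of_sq_le_sq _ (by positivity) 
      rw [mul_pow, ← a4, ← b4]
      nlinarith [sq_nonneg (X i * Y j - X j * Y i)]
    linarith
  rcases le_total W₁ W₂ with h | h
  · exact cone_count_aux S X Y Z W₁ W₂ W₃ B ρ hW₁ hW₃ hB hρ h hbd hX hY hZ hX' hZ' heq hsep'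
  · refine cone_count_aux S Y X Z W₂ W₁ W₃ B ρ hW₂ hW₃ hB hρ h ?_ hY hX hZ hY' hZ' ?_ ?_
    · rw [mul_comm W₂ W₁]; exact hbd
    · intro i hi; rw [add_comm]; exact heq i hi
    · intro i hi j hj hij
      have := hsep' i hi j hj hij
      linarith

lemma conic_count_pos {ι : Type*} (S : Finset ι) (x y z : ι → ℝ) (a b c V₁ V₂ V₃ B ρ : ℝ)
    (ha : 0 < a) (hb : 0 < b) (hc : 0 < c)
    (hV₁ : 0 < V₁) (hV₂ : 0 < V₂) (hV₃ : 0 < V₃) (hB : 0 < B) (hρ : 0 < ρ)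
    (hbd : a * b * c * (V₁ * V₂ * V₃) ^ 2 ≤ ρ ^ 6 * B ^ 3)
    (hx : ∀ i ∈ S, 0 < x i) (hy : ∀ i ∈ S, 0 < y i) (hz : ∀ i ∈ S, 0 < z i)
    (hx' : ∀ i ∈ S, x i ≤ V₁) (hy' : ∀ i ∈ S, y i ≤ V₂) (hz' : ∀ i ∈ S, z i ≤ V₃)
    (heq : ∀ i ∈ S, a * x i ^ 2 + b * y i ^ 2 = c * z i ^ 2)
    (hsep : ∀ i ∈ S, ∀ j ∈ S, i ≠ j → B ≤ |c * (z i * z j) - a * (x i * x j) - b * (y i * y j)|) :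
    (S.card : ℝ) ≤ 3 + 8 * ρ := by
  have sa := Real.sq_sqrt ha.le
  have sb := Real.sq_sqrt hb.le
  have sc := Real.sq_sqrt hc.le
  have pa := Real.sqrt_pos.2 ha
  have pb := Real.sqrt_pos.2 hb
  have pc := Real.sqrt_pos.2 hc
  set α := Real.sqrt a
  set β := Real.sqrt b
  set γ := Real.sqrt c
  refine cone_count S (fun i => α * x i) (fun i => β * y i) (fun i => γ * z i)
    (α * V₁) (β * V₂) (γ * V₃) B ρ (by positivity) (by positivity) (by positivity) hB hρ ?_
    (fun i hi => mul_pos pa (hx i hi)) (fun i hi => mul_pos pb (hy i hi))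
    (fun i hi => mul_pos pc (hz i hi))
    (fun i hi => mul_le_mul_of_nonneg_left (hx' i hi) pa.le)
    (fun i hi => mul_le_mul_of_nonneg_left (hy' i hi) pb.le)
    (fun i hi => mul_le_mul_of_nonneg_left (hz' i hi) pc.le) ?_ ?_
  · convert hbd using 1
    rw [← sa, ← sb, ← sc]; ring
  · intro i hi
    have := heq i hi
    rw [← sa, ← sb, ← sc] at this
    linear_combination this
  · intro i hi j hj hij
    have := hsep i hi j hj hij
    convert this using 2
    rw [← sa, ← sb, ← sc]; ring

lemma conic_count {ι : Type*} (S : Finset ι) (x y z : ι → ℝ) (a b c V₁ V₂ V₃ B ρ : ℝ)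
    (ha : a ≠ 0) (hb : b ≠ 0) (hc : c ≠ 0)
    (hV₁ : 0 < V₁) (hV₂ : 0 < V₂) (hV₃ : 0 < V₃) (hB : 0 < B) (hρ : 0 < ρ)
    (hbd : |a| * |b| * |c| * (V₁ * V₂ * V₃) ^ 2 ≤ ρ ^ 6 * B ^ 3)
    (hx : ∀ i ∈ S, 0 < x i) (hy : ∀ i ∈ S, 0 < y i) (hz : ∀ i ∈ S, 0 < z i)
    (hx' : ∀ i ∈ S, x i ≤ V₁) (hy' : ∀ i ∈ S, y i ≤ V₂) (hz' : ∀ i ∈ S, z i ≤ V₃)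
    (heq : ∀ i ∈ S, a * x i ^ 2 + b * y i ^ 2 + c * z i ^ 2 = 0)
    (hsep : ∀ i ∈ S, ∀ j ∈ S, i ≠ j → B ≤ |a * (x i * x j) + b * (y i * y j) + c * (z i * z j)|) :
    (S.card : ℝ) ≤ 3 + 8 * ρ := by
  -- normalise so that at most one coefficient is negative
  have base : ∀ a b c : ℝ, a ≠ 0 → b ≠ 0 → c ≠ 0 → 
      |a| * |b| * |c| * (V₁ * V₂ * V₃) ^ 2 ≤ ρ ^ 6 * B ^ 3 →
      (∀ i ∈ S, a * x i ^ 2 + b * y i ^ 2 + c * z i ^ 2 = 0) →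
      (∀ i ∈ S, ∀ j ∈ S, i ≠ j → B ≤ |a * (x i * x j) + b * (y i * y j) + c * (z i * z j)|) →
      0 < a → 0 < b → (S.card : ℝ) ≤ 3 + 8 * ρ := by
    intro a b c _ _ hc hbd heq hsep ha hb
    rcases hc.lt_or_gt with hc | hc
    · rw [abs_of_pos ha, abs_of_pos hb, abs_of_neg hc] at hbd
      refine conic_count_pos S x y z a b (-c) V₁ V₂ V₃ B ρ ha hb (by linarith) hV₁ hV₂ hV₃ hB hρ
        hbd hx hy hz hx' hy' hz' (fun i hi => by linarith [heq i hi]) ?_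
      intro i hi j hj hij
      rw [← abs_neg]
      convert hsep i hi j hj hij using 2
      ring
    · rcases S.eq_empty_or_nonempty with h | ⟨i, hi⟩
      · rw [h]; simp; positivity
      · exfalso
        have := heq i hi
        have := hx i hi
        have := hy i hi
        have := hz i hi
        have : 0 < a * x i ^ 2 + b * y i ^ 2 + c * z i ^ 2 := by positivity
        linarith
  have base2 : ∀ a b c : ℝ, a ≠ 0 → b ≠ 0 → c ≠ 0 → 
      |a| * |b| * |c| * (V₁ * V₂ * V₃) ^ 2 ≤ ρ ^ 6 * B ^ 3 →
      (∀ i ∈ S, a * x i ^ 2 + b * y i ^ 2 + c * z i ^ 2 = 0) →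
      (∀ i ∈ S, ∀ j ∈ S, i ≠ j → B ≤ |a * (x i * x j) + b * (y i * y j) + c * (z i * z j)|) →
      0 < a → (S.card : ℝ) ≤ 3 + 8 * ρ := by
    intro a b c ha0 hb hc hbd heq hsep ha
    rcases hb.lt_or_gt with hb' | hb'
    · rcases hc.lt_or_gt with hc' | hc'
      · rw [abs_of_pos ha, abs_of_neg hb', abs_of_neg hc'] at hbd
        refine conic_count_pos S y z x (-b) (-c) a V₂ V₃ V₁ B ρ (by linarith) (by linarith) ha
          hV₂ hV₃ hV₁ hB hρ ?_ hy hz hx hy' hz' hx' (fun i hi => by linarith [heq i hi]) ?_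
        · convert hbd using 1; ring
        · intro i hi j hj hij
          convert hsep i hi j hj hij using 2
          ring
      · rw [abs_of_pos ha, abs_of_neg hb', abs_of_pos hc'] at hbd
        refine conic_count_pos S x z y a c (-b) V₁ V₃ V₂ B ρ ha hc' (by linarith)
          hV₁ hV₃ hV₂ hB hρ ?_ hx hz hy hx' hz' hy' (fun i hi => by linarith [heq i hi]) ?_
        · convert hbd using 1; ring
        · intro i hi j hj hij
          rw [← abs_neg]
          convert hsep i hi j hj hij using 2
          ring
    · exact base a b c ha0 hb hc hbd heq hsep ha hb'
  rcases ha.lt_or_gt with ha' | ha'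
  · refine base2 (-a) (-b) (-c) (by simpa) (by simpa) (by simpa) (by simpa using hbd)
      (fun i hi => by linarith [heq i hi]) ?_ (by linarith)
    intro i hi j hj hij
    rw [← abs_neg]
    convert hsep i hi j hj hij using 2
    ring
  · exact base2 a b c ha hb hc hbd heq hsep ha'

/-- Two solutions with the same label are orthogonal modulo `n` (up to a bounded factor). -/
lemma class_dvd (n b c e y z y' z' y₀ z₀ : ℤ) (hc : IsCoprime c n)
    (hz : IsCoprime z n) (hy : IsCoprime y n) (hz₀ : IsCoprime z₀ n)
    (hv : n ∣ b * c * y ^ 2 + e * z ^ 2) (hv' : n ∣ b * c * y' ^ 2 + e * z' ^ 2)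
    (hv₀ : n ∣ b * c * y₀ ^ 2 + e * z₀ ^ 2) (hn : n ≠ 0)
    (hd : Int.gcd n (b * (y * z₀ - y₀ * z)) = Int.gcd n (b * (y' * z₀ - y₀ * z'))) :
    n ∣ 2 * b * (b * c * (y * y') + e * (z * z')) := by
  -- the complementary divisor
  have aux : ∀ y z : ℤ, n ∣ b * c * y ^ 2 + e * z ^ 2 →
      ∀ k : ℤ, n = (Int.gcd n (b * (y * z₀ - y₀ * z)) : ℤ) * k → k ∣ y * z₀ + y₀ * z := by
    intro y z hv k hk
    have h1 : n ∣ b * (y * z₀ - y₀ * z) * (y * z₀ + y₀ * z) := by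
      have h : n ∣ c * (b * (y * z₀ - y₀ * z) * (y * z₀ + y₀ * z)) := by
        have := dvd_sub (hv.mul_left (z₀ ^ 2)) (hv₀.mul_left (z ^ 2))
        have e1 : c * (b * (y * z₀ - y₀ * z) * (y * z₀ + y₀ * z)) =
          z₀ ^ 2 * (b * c * y ^ 2 + e * z ^ 2) - z ^ 2 * (b * c * y₀ ^ 2 + e * z₀ ^ 2) := by ring
        rw [e1]; exact this
      exact hc.symm.dvd_of_dvd_mul_left h
    set A := b * (y * z₀ - y₀ * z)
    set d : ℤ := (Int.gcd n A : ℤ) with hdd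
    have hd0 : d ≠ 0 := by
      intro h; rw [h] at hk; simp at hk; exact hn hk
    obtain ⟨m, hm⟩ : d ∣ A := Int.gcd_dvd_right _ _
    have hcop : IsCoprime k m := by
      have hb : d = n * Int.gcdA n A + A * Int.gcdB n A := Int.gcd_eq_gcd_ab n A
      refine ⟨Int.gcdA n A, Int.gcdB n A, ?_⟩
      apply mul_left_cancel₀ hd0
      have : d * (Int.gcdA n A * k + Int.gcdB n A * m) =
        (d * k) * Int.gcdA n A + (d * m) * Int.gcdB n A := by ring
      rw [this, ← hk, ← hm, ← hb, mul_one]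
    have h2 : k ∣ m * (y * z₀ + y₀ * z) := by
      apply (mul_dvd_mul_iff_left hd0).1
      rw [← hk, ← mul_assoc, ← hm]
      exact h1
    exact hcop.dvd_of_dvd_mul_left h2
  set d : ℤ := (Int.gcd n (b * (y * z₀ - y₀ * z)) : ℤ) with hdd
  obtain ⟨k, hk⟩ : d ∣ n := Int.gcd_dvd_left _ _
  have k1 := aux y z hv k hk
  have k2 := aux y' z' hv' k (by rw [← hd]; exact hk)
  have d1 : d ∣ b * (y * z₀ - y₀ * z) := Int.gcd_dvd_right _ _
  have d2 : d ∣ b * (y' * z₀ - y₀ * z') := by rw [hdd, hd]; exact Int.gcd_dvd_right _ _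
  have hdn : d ∣ n := ⟨k, hk⟩
  have hkn : k ∣ n := ⟨d, by rw [hk]; ring⟩
  have cd : IsCoprime d z₀ := (hz₀.of_isCoprime_of_dvd_right hdn).symm
  have ck : IsCoprime k z₀ := (hz₀.of_isCoprime_of_dvd_right hkn).symm
  have dT : d ∣ b * (y * z' - y' * z) := by
    apply cd.dvd_of_dvd_mul_left
    have := dvd_sub (d1.mul_left z') (d2.mul_left z)
    convert this using 1; ring
  have kT : k ∣ y * z' - y' * z := by
    apply ck.dvd_of_dvd_mul_left
    have := dvd_sub (k1.mul_left z') (k2.mul_left z)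
    convert this using 1; ring
  -- the gcd of `d` and `k`
  have g1 : (Int.gcd d k : ℤ) ∣ 2 * b := by
    have gd : (Int.gcd d k : ℤ) ∣ d := Int.gcd_dvd_left _ _
    have gk : (Int.gcd d k : ℤ) ∣ k := Int.gcd_dvd_right _ _
    have gn := gd.trans hdn
    have c1 : IsCoprime (Int.gcd d k : ℤ) y := (hy.of_isCoprime_of_dvd_right gn).symm
    have c2 : IsCoprime (Int.gcd d k : ℤ) z₀ := (hz₀.of_isCoprime_of_dvd_right gn).symm
    apply (c1.mul_right c2).dvd_of_dvd_mul_left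
    have := dvd_add (gd.trans d1) ((gk.trans k1).mul_left b)
    convert this using 1; ring
  have g2 : n ∣ 2 * b * (b * (y * z' - y' * z)) := by
    have hl : (Int.lcm d k : ℤ) ∣ b * (y * z' - y' * z) :=
      Int.coe_lcm_dvd dT (kT.mul_left b)
    have := mul_dvd_mul g1 hl
    refine dvd_trans ?_ this
    have e : ((Int.gcd d k : ℤ)) * (Int.lcm d k : ℤ) = |d * k| := by
      rw [← Nat.cast_mul, Int.gcd_mul_lcm, Int.abs_eq_natAbs, Int.natAbs_mul]
    rw [e, ← hk]
    exact (dvd_abs n n).2 dvd_rfl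
  apply hz.symm.dvd_of_dvd_mul_left
  have := dvd_sub (hv.mul_left (2 * b * z')) (g2.mul_left (c * y))
  convert this using 1; ring

lemma prop_eq (x y x' y' : ℕ) (hc : Nat.Coprime x y) (hc' : Nat.Coprime x' y')
    (h : x * y' = x' * y) : x = x' ∧ y = y' := by
  have a1 : x ∣ x' := hc.dvd_of_dvd_mul_right (Dvd.intro _ h)
  have a2 : x' ∣ x := hc'.dvd_of_dvd_mul_right (Dvd.intro _ h.symm)
  have b1 : y ∣ y' := hc.symm.dvd_of_dvd_mul_left (Dvd.intro_left x' h.symm)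
  have b2 : y' ∣ y := hc'.symm.dvd_of_dvd_mul_left (Dvd.intro_left x h)
  exact ⟨Nat.dvd_antisymm a1 a2, Nat.dvd_antisymm b1 b2⟩

/-- Non-proportional isotropic vectors are not orthogonal. -/
lemma form_ne_zero (a b c : ℤ) (ha : a ≠ 0) (hb : b ≠ 0) (x y z x' y' z' : ℕ)
    (hz : 0 < z)
    (hc : Nat.Coprime x y) (hc' : Nat.Coprime x' y') (hcz : c ≠ 0)
    (h : a * (x : ℤ) ^ 2 + b * (y : ℤ) ^ 2 + c * (z : ℤ) ^ 2 = 0)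
    (h' : a * (x' : ℤ) ^ 2 + b * (y' : ℤ) ^ 2 + c * (z' : ℤ) ^ 2 = 0)
    (h0 : a * ((x : ℤ) * x') + b * ((y : ℤ) * y') + c * ((z : ℤ) * z') = 0) :
    x = x' ∧ y = y' ∧ z = z' := by
  have h1 : a * b * ((x : ℤ) * y' - x' * y) ^ 2 = 0 := by
    linear_combination (a * x' ^ 2 + b * y' ^ 2) * h - c * z ^ 2 * h' -
      (a * (x * x') + b * (y * y') - c * (z * z')) * h0
  have h2 : (x : ℤ) * y' - x' * y = 0 := by
    rcases mul_eq_zero.1 h1 with h | h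
    · exfalso; rcases mul_eq_zero.1 h with h | h <;> contradiction
    · exact pow_eq_zero_iff (by norm_num) |>.1 h
  obtain ⟨e1, e2⟩ := prop_eq x y x' y' hc hc' (by exact_mod_cast sub_eq_zero.1 h2)
  refine ⟨e1, e2, ?_⟩
  subst e1 e2
  have h3 : c * ((z : ℤ) * ((z : ℤ) - z')) = 0 := by linear_combination h - h0
  rcases mul_eq_zero.1 h3 with h | h
  · contradiction
  · rcases mul_eq_zero.1 h with h | h
    · omega
    · omega

lemma int_dvd_of_eq {n a b : ℤ} (h : n ∣ b) (e : a = b) : n ∣ a := e ▸ h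

/-- Positive solutions. -/
def PSol (f₁ f₂ f₃ : ℤ) (u₁ u₂ u₃ v₁ v₂ v₃ : ℕ) : Prop :=
  0 < u₁ ∧ 0 < u₂ ∧ 0 < u₃ ∧ 0 < v₁ ∧ 0 < v₂ ∧ 0 < v₃ ∧
  f₁ * u₁ * (v₁ : ℤ) ^ 2 + f₂ * u₂ * (v₂ : ℤ) ^ 2 + f₃ * u₃ * (v₃ : ℤ) ^ 2 = 0 ∧
  Nat.Coprime (u₁ * v₁) (u₂ * v₂) ∧ Nat.Coprime (u₁ * v₁) (u₃ * v₃) ∧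
  Nat.Coprime (u₂ * v₂) (u₃ * v₃)

lemma cop_aux {a b c d : ℕ} (h : Nat.Coprime (a * b) (c * d)) :
    Nat.Coprime a c ∧ Nat.Coprime a d ∧ Nat.Coprime b c ∧ Nat.Coprime b d :=
  ⟨h.coprime_mul_right.coprime_mul_right_right, h.coprime_mul_right.coprime_mul_left_right,
    h.coprime_mul_left.coprime_mul_right_right, h.coprime_mul_left.coprime_mul_left_right⟩

lemma fixed_u {ι : Type*} (f₁ f₂ f₃ : ℤ) (hf₁ : f₁ ≠ 0) (hf₂ : f₂ ≠ 0) (hf₃ : f₃ ≠ 0)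
    (u₁ u₂ u₃ : ℕ) (S : Finset ι) (v₁ v₂ v₃ : ι → ℕ)
    (hS : ∀ i ∈ S, PSol f₁ f₂ f₃ u₁ u₂ u₃ (v₁ i) (v₂ i) (v₃ i))
    (hinj : ∀ i ∈ S, ∀ j ∈ S, v₁ i = v₁ j → v₂ i = v₂ j → v₃ i = v₃ j → i = j)
    (V₁ V₂ V₃ : ℝ) (hV₁ : 0 < V₁) (hV₂ : 0 < V₂) (hV₃ : 0 < V₃)
    (h₁ : ∀ i ∈ S, (v₁ i : ℝ) ≤ V₁) (h₂ : ∀ i ∈ S, (v₂ i : ℝ) ≤ V₂)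
    (h₃ : ∀ i ∈ S, (v₃ i : ℝ) ≤ V₃)
    (F c w : ℝ) (hF : F = |((f₁ * f₂ * f₃ : ℤ) : ℝ)|) (hc0 : 0 < c) (hc : c ^ 3 = V₁ * V₂ * V₃)
    (hw0 : 0 < w) (hw : w ^ 3 = (u₁ : ℝ) * u₂ * u₃) :
    (S.card : ℝ) ≤ (3 + 8 * (8 * F * c / w)) *
      ((u₁.divisors.card : ℝ) * u₂.divisors.card * u₃.divisors.card) := by
  classical
  have hFne : f₁ * f₂ * f₃ ≠ 0 := mul_ne_zero (mul_ne_zero hf₁ hf₂) hf₃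
  have hF1 : 1 ≤ F := by
    rw [hF, ← Int.cast_abs]; exact_mod_cast Int.one_le_abs hFne
  have hρ : 0 < 8 * F * c / w := by positivity
  rcases S.eq_empty_or_nonempty with h | ⟨o, ho⟩
  · rw [h]; simp; positivity
  obtain ⟨pu₁, pu₂, pu₃, -, -, -, -, o12, o13, o23⟩ := hS o ho
  have cu12 := (cop_aux o12).1
  have cu13 := (cop_aux o13).1
  have cu23 := (cop_aux o23).1
  let L : ι → ℕ × ℕ × ℕ := fun i =>
    (Int.gcd (u₁ : ℤ) (f₂ * (v₂ i * v₃ o - v₂ o * v₃ i)),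
     Int.gcd (u₂ : ℤ) (f₁ * (v₁ i * v₃ o - v₁ o * v₃ i)),
     Int.gcd (u₃ : ℤ) (f₁ * (v₁ i * v₂ o - v₁ o * v₂ i)))
  have hL : ∀ i ∈ S, L i ∈ u₁.divisors ×ˢ u₂.divisors ×ˢ u₃.divisors := by
    intro i _
    simp only [L, Finset.mem_product, Nat.mem_divisors]
    exact ⟨⟨Int.natCast_dvd_natCast.1 (Int.gcd_dvd_left _ _), pu₁.ne'⟩,
      ⟨Int.natCast_dvd_natCast.1 (Int.gcd_dvd_left _ _), pu₂.ne'⟩,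
      ⟨Int.natCast_dvd_natCast.1 (Int.gcd_dvd_left _ _), pu₃.ne'⟩⟩
  have hfib : ∀ b ∈ u₁.divisors ×ˢ u₂.divisors ×ˢ u₃.divisors,
      (S.filter (fun i => L i = b)).card ≤ ⌊3 + 8 * (8 * F * c / w)⌋₊ := by
    intro lb _
    apply Nat.le_floor
    have hTS : ∀ i ∈ S.filter (fun i => L i = lb), i ∈ S := fun i hi => (Finset.mem_filter.1 hi).1
    have ru₁ : (0 : ℝ) < u₁ := by exact_mod_cast pu₁
    have ru₂ : (0 : ℝ) < u₂ := by exact_mod_cast pu₂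
    have ru₃ : (0 : ℝ) < u₃ := by exact_mod_cast pu₃
    have rf₁ : (f₁ : ℝ) ≠ 0 := by exact_mod_cast hf₁
    have rf₂ : (f₂ : ℝ) ≠ 0 := by exact_mod_cast hf₂
    have rf₃ : (f₃ : ℝ) ≠ 0 := by exact_mod_cast hf₃
    refine conic_count _ (fun i => (v₁ i : ℝ)) (fun i => (v₂ i : ℝ)) (fun i => (v₃ i : ℝ))
      (f₁ * u₁) (f₂ * u₂) (f₃ * u₃) V₁ V₂ V₃ (w ^ 3 / (2 * F)) (8 * F * c / w)
      (by positivity) (by positivity) (by positivity) hV₁ hV₂ hV₃ (by positivity) hρ ?_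
      ?_ ?_ ?_ (fun i hi => h₁ i (hTS i hi)) (fun i hi => h₂ i (hTS i hi))
      (fun i hi => h₃ i (hTS i hi)) ?_ ?_
    · have e1 : |(f₁ : ℝ) * u₁| * |(f₂ : ℝ) * u₂| * |(f₃ : ℝ) * u₃| = F * w ^ 3 := by
        rw [hF, hw, ← abs_mul, ← abs_mul]
        push_cast
        rw [← abs_of_pos (show (0 : ℝ) < (u₁ : ℝ) * u₂ * u₃ by positivity), ← abs_mul]
        congr 1; ring
      rw [e1, ← hc]
      have e2 : (8 * F * c / w) ^ 6 * (w ^ 3 / (2 * F)) ^ 3 = 32768 * (F ^ 3 * (w ^ 3 * c ^ 6)) := by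
        field_simp
        norm_num
      rw [e2]
      have e3 : F ≤ F ^ 3 := le_self_pow₀ hF1 (by norm_num)
      have e4 : 0 < w ^ 3 * c ^ 6 := by positivity
      have e5 : F * (w ^ 3 * c ^ 6) ≤ F ^ 3 * (w ^ 3 * c ^ 6) := by gcongr
      have e6 : 0 < F * (w ^ 3 * c ^ 6) := by positivity
      nlinarith
    · intro i hi; exact_mod_cast (hS i (hTS i hi)).2.2.2.1
    · intro i hi; exact_mod_cast (hS i (hTS i hi)).2.2.2.2.1
    · intro i hi; exact_mod_cast (hS i (hTS i hi)).2.2.2.2.2.1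
    · intro i hi
      exact_mod_cast (hS i (hTS i hi)).2.2.2.2.2.2.1
    · intro i hi j hj hij
      have hl : L i = L j := (Finset.mem_filter.1 hi).2.trans (Finset.mem_filter.1 hj).2.symm
      obtain ⟨-, -, -, pi1, pi2, pi3, ei, i12, i13, i23⟩ := hS i (hTS i hi)
      obtain ⟨-, -, -, pj1, pj2, pj3, ej, j12, j13, j23⟩ := hS j (hTS j hj)
      obtain ⟨-, -, -, po1, po2, po3, eo, -, -, -⟩ := hS o ho
      set B : ℤ := f₁ * u₁ * ((v₁ i : ℤ) * v₁ j) + f₂ * u₂ * ((v₂ i : ℤ) * v₂ j) +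
        f₃ * u₃ * ((v₃ i : ℤ) * v₃ j) with hB
      have hB0 : B ≠ 0 := by
        intro h0
        have := form_ne_zero (f₁ * u₁) (f₂ * u₂) (f₃ * u₃) (by positivity) (by positivity)
          (v₁ i) (v₂ i) (v₃ i) (v₁ j) (v₂ j) (v₃ j) pi3 (cop_aux i12).2.2.2 (cop_aux j12).2.2.2
          (by positivity) ei ej h0
        exact hij (hinj i (hTS i hi) j (hTS j hj) this.1 this.2.1 this.2.2)
      have l1 := congrArg Prod.fst hl
      have l2 := congrArg (fun t => t.2.1) hl
      have l3 := congrArg (fun t => t.2.2) hl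
      simp only [L] at l1 l2 l3
      have D1 : (u₁ : ℤ) ∣ 2 * f₂ * B := by
        have := class_dvd u₁ f₂ u₂ (f₃ * u₃) (v₂ i) (v₃ i) (v₂ j) (v₃ j) (v₂ o) (v₃ o)
          (Nat.isCoprime_iff_coprime.2 (cop_aux o12).1.symm)
          (Nat.isCoprime_iff_coprime.2 (cop_aux i13).2.1.symm)
          (Nat.isCoprime_iff_coprime.2 (cop_aux i12).2.1.symm)
          (Nat.isCoprime_iff_coprime.2 (cop_aux o13).2.1.symm)
          ⟨-(f₁ * v₁ i ^ 2), by linear_combination ei⟩ ⟨-(f₁ * v₁ j ^ 2), by linear_combination ej⟩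
          ⟨-(f₁ * v₁ o ^ 2), by linear_combination eo⟩ (by positivity) l1
        have h2 := dvd_add this (Dvd.intro (2 * f₂ * (f₁ * ((v₁ i : ℤ) * v₁ j))) (rfl :
          (u₁ : ℤ) * (2 * f₂ * (f₁ * ((v₁ i : ℤ) * v₁ j))) = _))
        exact int_dvd_of_eq h2 (by rw [hB]; ring)
      have D2 : (u₂ : ℤ) ∣ 2 * f₁ * B := by
        have := class_dvd u₂ f₁ u₁ (f₃ * u₃) (v₁ i) (v₃ i) (v₁ j) (v₃ j) (v₁ o) (v₃ o)
          (Nat.isCoprime_iff_coprime.2 (cop_aux o12).1)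
          (Nat.isCoprime_iff_coprime.2 (cop_aux i23).2.1.symm)
          (Nat.isCoprime_iff_coprime.2 (cop_aux i12).2.2.1)
          (Nat.isCoprime_iff_coprime.2 (cop_aux o23).2.1.symm)
          ⟨-(f₂ * v₂ i ^ 2), by linear_combination ei⟩ ⟨-(f₂ * v₂ j ^ 2), by linear_combination ej⟩
          ⟨-(f₂ * v₂ o ^ 2), by linear_combination eo⟩ (by positivity) l2
        have h2 := dvd_add this (Dvd.intro (2 * f₁ * (f₂ * ((v₂ i : ℤ) * v₂ j))) (rfl :
          (u₂ : ℤ) * (2 * f₁ * (f₂ * ((v₂ i : ℤ) * v₂ j))) = _))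
        exact int_dvd_of_eq h2 (by rw [hB]; ring)
      have D3 : (u₃ : ℤ) ∣ 2 * f₁ * B := by
        have := class_dvd u₃ f₁ u₁ (f₂ * u₂) (v₁ i) (v₂ i) (v₁ j) (v₂ j) (v₁ o) (v₂ o)
          (Nat.isCoprime_iff_coprime.2 (cop_aux o13).1)
          (Nat.isCoprime_iff_coprime.2 (cop_aux i23).2.2.1)
          (Nat.isCoprime_iff_coprime.2 (cop_aux i13).2.2.1)
          (Nat.isCoprime_iff_coprime.2 (cop_aux o23).2.2.1)
          ⟨-(f₃ * v₃ i ^ 2), by linear_combination ei⟩ ⟨-(f₃ * v₃ j ^ 2), by linear_combination ej⟩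
          ⟨-(f₃ * v₃ o ^ 2), by linear_combination eo⟩ (by positivity) l3
        have h2 := dvd_add this (Dvd.intro (2 * f₁ * (f₃ * ((v₃ i : ℤ) * v₃ j))) (rfl :
          (u₃ : ℤ) * (2 * f₁ * (f₃ * ((v₃ i : ℤ) * v₃ j))) = _))
        exact int_dvd_of_eq h2 (by rw [hB]; ring)
      set G : ℤ := 2 * (f₁ * f₂ * f₃) * B with hG
      have hG0 : G ≠ 0 := mul_ne_zero (mul_ne_zero two_ne_zero hFne) hB0
      have G1 : (u₁ : ℤ) ∣ G := D1.trans ⟨f₁ * f₃, by rw [hG]; ring⟩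
      have G2 : (u₂ : ℤ) ∣ G := D2.trans ⟨f₂ * f₃, by rw [hG]; ring⟩
      have G3 : (u₃ : ℤ) ∣ G := D3.trans ⟨f₂ * f₃, by rw [hG]; ring⟩
      have c12 : IsCoprime (u₁ : ℤ) u₂ := Nat.isCoprime_iff_coprime.2 cu12
      have c13 : IsCoprime (u₁ : ℤ) u₃ := Nat.isCoprime_iff_coprime.2 cu13
      have c23 : IsCoprime (u₂ : ℤ) u₃ := Nat.isCoprime_iff_coprime.2 cu23
      have GG : (u₁ : ℤ) * u₂ * u₃ ∣ |G| :=
        (dvd_abs _ _).2 ((c13.mul_left c23).mul_dvd (c12.mul_dvd G1 G2) G3)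
      have hle := Int.le_of_dvd (abs_pos.2 hG0) GG
      have hle' : (u₁ : ℝ) * u₂ * u₃ ≤ |(G : ℝ)| := by exact_mod_cast hle
      rw [hG] at hle'
      push_cast [abs_mul] at hle'
      rw [hw, div_le_iff₀ (by positivity), hF]
      push_cast [abs_mul]
      have e7 : (B : ℝ) = f₁ * u₁ * ((v₁ i : ℝ) * v₁ j) + f₂ * u₂ * ((v₂ i : ℝ) * v₂ j) +
        f₃ * u₃ * ((v₃ i : ℝ) * v₃ j) := by rw [hB]; push_cast; ring
      rw [← e7]
      rw [abs_of_pos (show (0 : ℝ) < 2 by norm_num)] at hle'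
      linarith
  have := Finset.card_le_mul_card_image_of_maps_to hL _ hfib
  rw [Finset.card_product, Finset.card_product] at this
  calc (S.card : ℝ) ≤ (⌊3 + 8 * (8 * F * c / w)⌋₊ : ℝ) *
        ((u₁.divisors.card : ℝ) * (u₂.divisors.card * u₃.divisors.card)) := by exact_mod_cast this
    _ ≤ (3 + 8 * (8 * F * c / w)) *
        ((u₁.divisors.card : ℝ) * (u₂.divisors.card * u₃.divisors.card)) := by
      gcongr
      exact Nat.floor_le (by positivity)
    _ = _ := by ring

lemma planar_count {ι : Type*} (S : Finset ι) (a b : ι → ℝ) (A B δ : ℝ) (hA : 0 < A) (hB : 0 < B)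
    (hδ : 0 < δ) (ha : ∀ i ∈ S, 0 < a i) (hb : ∀ i ∈ S, 0 < b i)
    (ha' : ∀ i ∈ S, a i ≤ A) (hb' : ∀ i ∈ S, b i ≤ B)
    (hsep : ∀ i ∈ S, ∀ j ∈ S, i ≠ j → δ ≤ |a i * b j - a j * b i|) :
    (S.card : ℝ) ≤ 2 + 2 * (A * B / δ) := by
  classical
  have half : ∀ (T : Finset ι) (a b : ι → ℝ) (A B : ℝ), 0 < A → 0 < B → (∀ i ∈ T, 0 < a i) →
      (∀ i ∈ T, 0 < b i) → (∀ i ∈ T, a i ≤ A) → (∀ i ∈ T, b i * A ≤ B * a i) →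
      (∀ i ∈ T, ∀ j ∈ T, i ≠ j → δ ≤ |a i * b j - a j * b i|) →
      (T.card : ℝ) ≤ 1 + A * B / δ := by
    intro T a b A B hA hB ha hb ha' hab hsep
    have := gap_count T (fun i => b i / a i) (B / A) (δ / (A * A)) (by positivity) (by positivity)
      ?_ ?_ ?_
    · convert this using 2
      field_simp
    · intro i hi
      have := ha i hi
      have := hb i hi
      positivity
    · intro i hi
      rw [div_le_div_iff₀ (ha i hi) hA]
      exact hab i hi
    · intro i hi j hj hij
      have h1 := ha i hi
      have h2 := ha j hj
      have h3 : b i / a i - b j / a j = -(a i * b j - a j * b i) / (a i * a j) := by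
        field_simp; ring
      rw [h3, abs_div, abs_neg, abs_of_pos (mul_pos h1 h2)]
      have := hsep i hi j hj hij
      have := ha' i hi
      have := ha' j hj
      gcongr
  have k1 := half (S.filter (fun i => b i * A ≤ B * a i)) a b A B hA hB
    (fun i hi => ha i (Finset.mem_filter.1 hi).1) (fun i hi => hb i (Finset.mem_filter.1 hi).1)
    (fun i hi => ha' i (Finset.mem_filter.1 hi).1) (fun i hi => (Finset.mem_filter.1 hi).2)
    (fun i hi j hj => hsep i (Finset.mem_filter.1 hi).1 j (Finset.mem_filter.1 hj).1)
  have k2 := half (S.filter (fun i => ¬ b i * A ≤ B * a i)) b a B A hB hA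
    (fun i hi => hb i (Finset.mem_filter.1 hi).1) (fun i hi => ha i (Finset.mem_filter.1 hi).1)
    (fun i hi => hb' i (Finset.mem_filter.1 hi).1)
    (fun i hi => by have := (Finset.mem_filter.1 hi).2; push Not at this; linarith)
    (fun i hi j hj hij => by
      rw [abs_sub_comm]
      convert hsep i (Finset.mem_filter.1 hi).1 j (Finset.mem_filter.1 hj).1 hij using 2
      ring)
  have hsum := Finset.card_filter_add_card_filter_not (s := S) (fun i => b i * A ≤ B * a i)
  rw [← hsum]
  push_cast
  rw [mul_comm B A] at k2
  linarith

lemma fixed_v_aux {ι : Type*} (f g : ℤ) (hf : f ≠ 0) (p w : ℕ) (hw : 0 < w) (hpw : Nat.Coprime p w)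
    (S : Finset ι) (x y : ι → ℕ) (hx : ∀ i ∈ S, 0 < x i) (hy : ∀ i ∈ S, 0 < y i)
    (hxy : ∀ i ∈ S, Nat.Coprime (x i) (y i))
    (hdvd : ∀ i ∈ S, (w : ℤ) ^ 2 ∣ f * p ^ 2 * x i + g * y i)
    (hinj : ∀ i ∈ S, ∀ j ∈ S, x i = x j → y i = y j → i = j)
    (X Y F : ℝ) (hX : 0 < X) (hY : 0 < Y) (hX' : ∀ i ∈ S, (x i : ℝ) ≤ X)
    (hY' : ∀ i ∈ S, (y i : ℝ) ≤ Y) (hF : |(f : ℝ)| ≤ F) :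
    (S.card : ℝ) ≤ 2 + 2 * F * (X * Y / (w : ℝ) ^ 2) := by
  have rf : 0 < |(f : ℝ)| := abs_pos.2 (by exact_mod_cast hf)
  have hF0 : 0 < F := rf.trans_le hF
  have rw' : (0 : ℝ) < w := by exact_mod_cast hw
  have := planar_count S (fun i => (x i : ℝ)) (fun i => (y i : ℝ)) X Y ((w : ℝ) ^ 2 / F) hX hY
    (by positivity) (fun i hi => by exact_mod_cast hx i hi) (fun i hi => by exact_mod_cast hy i hi)
    hX' hY' ?_
  · convert this using 2
    field_simp
  · intro i hi j hj hij
    set T : ℤ := (x i : ℤ) * y j - x j * y i with hT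
    have hT0 : T ≠ 0 := by
      intro h0
      have := prop_eq _ _ _ _ (hxy i hi) (hxy j hj) (by exact_mod_cast sub_eq_zero.1 h0)
      exact hij (hinj i hi j hj this.1 this.2)
    have h1 : (w : ℤ) ^ 2 ∣ (p : ℤ) ^ 2 * (f * T) := by
      have := dvd_sub ((hdvd i hi).mul_left (y j : ℤ)) ((hdvd j hj).mul_left (y i : ℤ))
      exact int_dvd_of_eq this (by rw [hT]; ring)
    have hc : IsCoprime ((w : ℤ) ^ 2) ((p : ℤ) ^ 2) :=
      (Nat.isCoprime_iff_coprime.2 hpw.symm).pow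
    have h2 := (dvd_abs _ _).2 (hc.dvd_of_dvd_mul_left h1)
    have h3 := Int.le_of_dvd (abs_pos.2 (mul_ne_zero hf hT0)) h2
    have h4 : (w : ℝ) ^ 2 ≤ |(f : ℝ)| * |(T : ℝ)| := by
      rw [abs_mul] at h3; exact_mod_cast h3
    have h5 : (T : ℝ) = (x i : ℝ) * y j - x j * y i := by rw [hT]; push_cast; ring
    rw [← h5, div_le_iff₀ hF0]
    have := abs_nonneg (T : ℝ)
    nlinarith

lemma fixed_v {ι : Type*} (f₁ f₂ f₃ : ℤ) (hf₁ : f₁ ≠ 0) (hf₂ : f₂ ≠ 0) (hf₃ : f₃ ≠ 0)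
    (v₁ v₂ v₃ : ℕ) (S : Finset ι) (u₁ u₂ u₃ : ι → ℕ)
    (hS : ∀ i ∈ S, PSol f₁ f₂ f₃ (u₁ i) (u₂ i) (u₃ i) v₁ v₂ v₃)
    (hinj : ∀ i ∈ S, ∀ j ∈ S, u₁ i = u₁ j → u₂ i = u₂ j → u₃ i = u₃ j → i = j)
    (U₁ U₂ U₃ : ℝ) (hU₁ : 0 < U₁) (hU₂ : 0 < U₂) (hU₃ : 0 < U₃)
    (h₁ : ∀ i ∈ S, (u₁ i : ℝ) ≤ U₁) (h₂ : ∀ i ∈ S, (u₂ i : ℝ) ≤ U₂)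
    (h₃ : ∀ i ∈ S, (u₃ i : ℝ) ≤ U₃)
    (F c w : ℝ) (hF : F = |((f₁ * f₂ * f₃ : ℤ) : ℝ)|) (hc0 : 0 < c) (hc : c ^ 3 = U₁ * U₂ * U₃)
    (hw0 : 0 < w) (hw : w ^ 3 = (v₁ : ℝ) * v₂ * v₃) :
    (S.card : ℝ) ≤ 2 + 2 * F * (c ^ 2 / w ^ 2) := by
  have i1 : 1 ≤ |f₁| := Int.one_le_abs hf₁
  have i2 : 1 ≤ |f₂| := Int.one_le_abs hf₂
  have i3 : 1 ≤ |f₃| := Int.one_le_abs hf₃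
  have hF1 : |(f₁ : ℝ)| ≤ F := by
    have : |f₁| ≤ |f₁ * f₂ * f₃| := by
      rw [abs_mul, abs_mul]
      have : |f₁| ≤ |f₁| * |f₂| := by nlinarith
      nlinarith
    rw [hF]; exact_mod_cast this
  have hF2 : |(f₂ : ℝ)| ≤ F := by
    have : |f₂| ≤ |f₁ * f₂ * f₃| := by
      rw [abs_mul, abs_mul]
      have : |f₂| ≤ |f₁| * |f₂| := by nlinarith
      nlinarith
    rw [hF]; exact_mod_cast this
  have hF0 : 0 ≤ F := (abs_nonneg _).trans hF1
  rcases S.eq_empty_or_nonempty with h | ⟨o, ho⟩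
  · rw [h]; simp; positivity
  obtain ⟨-, -, -, q1, q2, q3, -, o12, o13, o23⟩ := hS o ho
  have r1 : (0 : ℝ) < v₁ := by exact_mod_cast q1
  have r2 : (0 : ℝ) < v₂ := by exact_mod_cast q2
  have r3 : (0 : ℝ) < v₃ := by exact_mod_cast q3
  have b3 : (S.card : ℝ) ≤ 2 + 2 * F * (U₁ * U₂ / (v₃ : ℝ) ^ 2) := by
    refine fixed_v_aux f₁ (f₂ * v₂ ^ 2) hf₁ v₁ v₃ q3 (cop_aux o13).2.2.2 S u₁ u₂
      (fun i hi => (hS i hi).1) (fun i hi => (hS i hi).2.1)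
      (fun i hi => (cop_aux (hS i hi).2.2.2.2.2.2.2.1).1) ?_ ?_ U₁ U₂ F hU₁ hU₂ h₁ h₂ hF1
    · intro i hi
      exact ⟨-(f₃ * u₃ i), by linear_combination (hS i hi).2.2.2.2.2.2.1⟩
    · intro i hi j hj e1 e2
      refine hinj i hi j hj e1 e2 ?_
      have ei := (hS i hi).2.2.2.2.2.2.1
      have ej := (hS j hj).2.2.2.2.2.2.1
      rw [e1, e2] at ei
      have : (f₃ * v₃ ^ 2) * ((u₃ i : ℤ) - u₃ j) = 0 := by linear_combination ei - ej
      rcases mul_eq_zero.1 this with h | h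
      · exact absurd h (by positivity)
      · omega
  have b2 : (S.card : ℝ) ≤ 2 + 2 * F * (U₁ * U₃ / (v₂ : ℝ) ^ 2) := by
    refine fixed_v_aux f₁ (f₃ * v₃ ^ 2) hf₁ v₁ v₂ q2 (cop_aux o12).2.2.2 S u₁ u₃
      (fun i hi => (hS i hi).1) (fun i hi => (hS i hi).2.2.1)
      (fun i hi => (cop_aux (hS i hi).2.2.2.2.2.2.2.2.1).1) ?_ ?_ U₁ U₃ F hU₁ hU₃ h₁ h₃ hF1
    · intro i hi
      exact ⟨-(f₂ * u₂ i), by linear_combination (hS i hi).2.2.2.2.2.2.1⟩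
    · intro i hi j hj e1 e2
      refine hinj i hi j hj e1 ?_ e2
      have ei := (hS i hi).2.2.2.2.2.2.1
      have ej := (hS j hj).2.2.2.2.2.2.1
      rw [e1, e2] at ei
      have : (f₂ * v₂ ^ 2) * ((u₂ i : ℤ) - u₂ j) = 0 := by linear_combination ei - ej
      rcases mul_eq_zero.1 this with h | h
      · exact absurd h (by positivity)
      · omega
  have b1 : (S.card : ℝ) ≤ 2 + 2 * F * (U₂ * U₃ / (v₁ : ℝ) ^ 2) := by
    refine fixed_v_aux f₂ (f₃ * v₃ ^ 2) hf₂ v₂ v₁ q1 (cop_aux o12).2.2.2.symm S u₂ u₃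
      (fun i hi => (hS i hi).2.1) (fun i hi => (hS i hi).2.2.1)
      (fun i hi => (cop_aux (hS i hi).2.2.2.2.2.2.2.2.2).1) ?_ ?_ U₂ U₃ F hU₂ hU₃ h₂ h₃ hF2
    · intro i hi
      exact ⟨-(f₁ * u₁ i), by linear_combination (hS i hi).2.2.2.2.2.2.1⟩
    · intro i hi j hj e1 e2
      refine hinj i hi j hj ?_ e1 e2
      have ei := (hS i hi).2.2.2.2.2.2.1
      have ej := (hS j hj).2.2.2.2.2.2.1
      rw [e1, e2] at ei
      have : (f₁ * v₁ ^ 2) * ((u₁ i : ℤ) - u₁ j) = 0 := by linear_combination ei - ej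
      rcases mul_eq_zero.1 this with h | h
      · exact absurd h (by positivity)
      · omega
  have hprod : (c ^ 2 / w ^ 2) ^ 3 = (U₁ * U₂ / (v₃ : ℝ) ^ 2) * (U₁ * U₃ / (v₂ : ℝ) ^ 2) *
      (U₂ * U₃ / (v₁ : ℝ) ^ 2) := by
    have : (c ^ 2 / w ^ 2) ^ 3 = (c ^ 3) ^ 2 / (w ^ 3) ^ 2 := by rw [div_pow]; ring
    rw [this, hc, hw]
    field_simp
  set r := c ^ 2 / w ^ 2 with hr
  have hr0 : 0 < r := by positivity
  by_contra hcon
  push Not at hcon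
  have m : ∀ s : ℝ, (S.card : ℝ) ≤ 2 + 2 * F * s → r < s := by
    intro s hs
    by_contra h
    push Not at h
    have : 2 * F * s ≤ 2 * F * r := by gcongr
    linarith
  have m1 := m _ b1
  have m2 := m _ b2
  have m3 := m _ b3
  have : r ^ 3 < r ^ 3 := by
    conv_rhs => rw [hprod]
    calc r ^ 3 = r * r * r := by ring
      _ < _ := by gcongr
  exact lt_irrefl _ this

/-- The real cube root. -/
noncomputable def cbr (x : ℝ) : ℝ := x ^ ((1 : ℝ) / 3)

lemma cbr_pos {x : ℝ} (hx : 0 < x) : 0 < cbr x := Real.rpow_pos_of_pos hx _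

lemma cbr_nonneg {x : ℝ} (hx : 0 ≤ x) : 0 ≤ cbr x := Real.rpow_nonneg hx _

lemma cbr_cube {x : ℝ} (hx : 0 ≤ x) : cbr x ^ 3 = x := by
  unfold cbr
  rw [← Real.rpow_natCast, ← Real.rpow_mul hx]
  norm_num

lemma cbr_mono {x y : ℝ} (hx : 0 ≤ x) (h : x ≤ y) : cbr x ≤ cbr y :=
  Real.rpow_le_rpow hx h (by norm_num)

lemma cbr_mul {x y : ℝ} (hx : 0 ≤ x) (hy : 0 ≤ y) : cbr (x * y) = cbr x * cbr y :=
  Real.mul_rpow hx hy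

lemma cbr_step (n : ℕ) : 1 / cbr ((n + 1 : ℕ) : ℝ) ^ 2 ≤ 3 * (cbr ((n + 1 : ℕ) : ℝ) - cbr n) ∧
    1 / cbr ((n + 1 : ℕ) : ℝ) ≤ 3 * (cbr ((n + 1 : ℕ) : ℝ) ^ 2 - cbr n ^ 2) := by
  have ha := cbr_pos (show (0 : ℝ) < ((n + 1 : ℕ) : ℝ) by positivity)
  have hb := cbr_nonneg (show (0 : ℝ) ≤ (n : ℝ) by positivity)
  have ha3 := cbr_cube (show (0 : ℝ) ≤ ((n + 1 : ℕ) : ℝ) by positivity)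
  have hb3 := cbr_cube (show (0 : ℝ) ≤ (n : ℝ) by positivity)
  have hab := cbr_mono (show (0 : ℝ) ≤ (n : ℝ) by positivity)
    (show (n : ℝ) ≤ ((n + 1 : ℕ) : ℝ) by push_cast; linarith)
  set a := cbr ((n + 1 : ℕ) : ℝ)
  set b := cbr (n : ℝ)
  have h1 : a ^ 3 - b ^ 3 = 1 := by rw [ha3, hb3]; push_cast; ring
  have h2 : 1 ≤ 3 * (a - b) * a ^ 2 := by
    have : (a - b) * (a ^ 2 + a * b + b ^ 2) = 1 := by linear_combination h1
    have h3 : a ^ 2 + a * b + b ^ 2 ≤ 3 * a ^ 2 := by nlinarith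
    have h4 : 0 ≤ a - b := by linarith
    nlinarith
  constructor
  · rw [div_le_iff₀ (by positivity)]; exact h2
  · rw [div_le_iff₀ ha]
    have : 0 ≤ (a - b) * b * a := by have : 0 ≤ a - b := by linarith
                                     positivity
    nlinarith

lemma sum_inv_sq (N : ℕ) : ∑ n ∈ Finset.Icc 1 N, 1 / cbr (n : ℝ) ^ 2 ≤ 3 * cbr N := by
  induction N with
  | zero => simp [cbr]
  | succ n ih =>
    rw [Finset.sum_Icc_succ_top (by omega)]
    linarith [(cbr_step n).1]

lemma sum_inv (N : ℕ) : ∑ n ∈ Finset.Icc 1 N, 1 / cbr (n : ℝ) ≤ 3 * cbr N ^ 2 := by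
  induction N with
  | zero => simp [cbr]
  | succ n ih =>
    rw [Finset.sum_Icc_succ_top (by omega)]
    linarith [(cbr_step n).2]

lemma sum_tau_aux (N : ℕ) : ∑ n ∈ Finset.Icc 1 N, (n.divisors.card : ℝ) / cbr (n : ℝ) ≤
    3 * cbr N ^ 2 * ∑ d ∈ Finset.Icc 1 N, 1 / (d : ℝ) := by
  classical
  have e1 : ∀ n ∈ Finset.Icc 1 N, (n.divisors.card : ℝ) / cbr (n : ℝ) =
      ∑ d ∈ Finset.Icc 1 N, if d ∣ n then 1 / cbr (n : ℝ) else 0 := by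
    intro n hn
    rw [Finset.mem_Icc] at hn
    rw [← Finset.sum_filter, Finset.sum_const, nsmul_eq_mul]
    have : n.divisors = (Finset.Icc 1 N).filter (fun d => d ∣ n) := by
      ext d
      simp only [Nat.mem_divisors, Finset.mem_filter, Finset.mem_Icc]
      constructor
      · rintro ⟨h, h'⟩
        exact ⟨⟨Nat.pos_of_dvd_of_pos h (by omega), (Nat.le_of_dvd (by omega) h).trans hn.2⟩, h⟩
      · rintro ⟨_, h⟩
        exact ⟨h, by omega⟩
    rw [this]; ring
  rw [Finset.sum_congr rfl e1, Finset.sum_comm, Finset.mul_sum]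
  apply Finset.sum_le_sum
  intro d hd
  rw [Finset.mem_Icc] at hd
  have hd0 : (0 : ℝ) < d := by exact_mod_cast hd.1
  rw [← Finset.sum_filter]
  have e2 : ∑ n ∈ (Finset.Icc 1 N).filter (fun n => d ∣ n), 1 / cbr (n : ℝ) =
      ∑ k ∈ Finset.Icc 1 (N / d), 1 / cbr ((d * k : ℕ) : ℝ) := by
    symm
    apply Finset.sum_bij (fun k _ => d * k)
    · intro k hk
      rw [Finset.mem_Icc] at hk
      rw [Finset.mem_filter, Finset.mem_Icc]
      refine ⟨⟨Nat.mul_pos hd.1 hk.1, ?_⟩, Dvd.intro _ rfl⟩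
      rw [mul_comm]
      exact (Nat.le_div_iff_mul_le hd.1).1 hk.2
    · intro a _ b _ h
      exact Nat.eq_of_mul_eq_mul_left hd.1 h
    · intro n hn
      rw [Finset.mem_filter, Finset.mem_Icc] at hn
      obtain ⟨⟨h1, h2⟩, k, rfl⟩ := hn
      refine ⟨k, ?_, rfl⟩
      rw [Finset.mem_Icc]
      refine ⟨Nat.pos_of_mul_pos_left h1, ?_⟩
      rw [Nat.le_div_iff_mul_le hd.1, mul_comm]
      exact h2
    · intros; rfl
  rw [e2]
  have e3 : ∀ k ∈ Finset.Icc 1 (N / d), 1 / cbr ((d * k : ℕ) : ℝ) =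
      1 / cbr d * (1 / cbr (k : ℝ)) := by
    intro k _
    push_cast
    rw [cbr_mul (by positivity) (by positivity)]
    field_simp
  rw [Finset.sum_congr rfl e3, ← Finset.mul_sum]
  have hc := cbr_pos hd0
  have e4 : cbr ((N / d : ℕ) : ℝ) * cbr d ≤ cbr N := by
    rw [← cbr_mul (by positivity) (by positivity)]
    apply cbr_mono (by positivity)
    exact_mod_cast Nat.div_mul_le_self N d
  have e5 : 0 ≤ cbr ((N / d : ℕ) : ℝ) := cbr_nonneg (by positivity)
  calc 1 / cbr d * ∑ k ∈ Finset.Icc 1 (N / d), 1 / cbr (k : ℝ)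
      ≤ 1 / cbr d * (3 * cbr ((N / d : ℕ) : ℝ) ^ 2) := by
        gcongr
        exact sum_inv _
    _ = 3 * (cbr ((N / d : ℕ) : ℝ) * cbr d) ^ 2 * (1 / cbr d ^ 3) := by field_simp
    _ ≤ 3 * cbr N ^ 2 * (1 / cbr d ^ 3) := by gcongr
    _ = _ := by rw [cbr_cube hd0.le]

lemma sum_tau (ε : ℝ) (hε : 0 < ε) : ∃ C : ℝ, 0 < C ∧ ∀ U : ℝ, 1 ≤ U →
    ∑ n ∈ Finset.Icc 1 ⌊U⌋₊, (n.divisors.card : ℝ) / cbr (n : ℝ) ≤ C * (cbr U ^ 2 * U ^ ε) := by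
  have hs : Summable (fun n : ℕ => 1 / (n : ℝ) ^ (1 + ε)) :=
    Real.summable_one_div_nat_rpow.2 (by linarith)
  set T := ∑' n : ℕ, 1 / (n : ℝ) ^ (1 + ε) with hT
  have hT0 : 0 ≤ T := tsum_nonneg (fun n => by positivity)
  refine ⟨3 * (T + 1), by positivity, ?_⟩
  intro U hU
  refine (sum_tau_aux _).trans ?_
  have hfl : ((⌊U⌋₊ : ℕ) : ℝ) ≤ U := Nat.floor_le (by linarith)
  have h1 : ∑ d ∈ Finset.Icc 1 ⌊U⌋₊, 1 / (d : ℝ) ≤ U ^ ε * T := by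
    calc ∑ d ∈ Finset.Icc 1 ⌊U⌋₊, 1 / (d : ℝ)
        ≤ ∑ d ∈ Finset.Icc 1 ⌊U⌋₊, U ^ ε * (1 / (d : ℝ) ^ (1 + ε)) := by
          apply Finset.sum_le_sum
          intro d hd
          rw [Finset.mem_Icc] at hd
          have hd0 : (0 : ℝ) < d := by exact_mod_cast hd.1
          have hdU : (d : ℝ) ≤ U := le_trans (by exact_mod_cast hd.2) hfl
          have h2 : (d : ℝ) ^ ε ≤ U ^ ε := Real.rpow_le_rpow hd0.le hdU hε.le
          rw [Real.rpow_add hd0, Real.rpow_one]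
          have h3 : 0 < (d : ℝ) ^ ε := Real.rpow_pos_of_pos hd0 _
          rw [mul_one_div, div_le_div_iff₀ hd0 (by positivity)]
          nlinarith
      _ = U ^ ε * ∑ d ∈ Finset.Icc 1 ⌊U⌋₊, (1 / (d : ℝ) ^ (1 + ε)) := by rw [Finset.mul_sum]
      _ ≤ U ^ ε * T := by
          gcongr
          exact hs.sum_le_tsum _ (fun n _ => by positivity)
  have h2 : cbr ((⌊U⌋₊ : ℕ) : ℝ) ≤ cbr U := cbr_mono (by positivity) hfl
  have h3 : 0 ≤ cbr ((⌊U⌋₊ : ℕ) : ℝ) := cbr_nonneg (by positivity)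
  have h4 : 0 ≤ ∑ d ∈ Finset.Icc 1 ⌊U⌋₊, 1 / (d : ℝ) := Finset.sum_nonneg (fun n _ => by positivity)
  have h5 : 0 < U ^ ε := Real.rpow_pos_of_pos (by linarith) _
  calc 3 * cbr ((⌊U⌋₊ : ℕ) : ℝ) ^ 2 * ∑ d ∈ Finset.Icc 1 ⌊U⌋₊, 1 / (d : ℝ)
      ≤ 3 * cbr U ^ 2 * (U ^ ε * (T + 1)) := by
        have : U ^ ε * T ≤ U ^ ε * (T + 1) := by gcongr; linarith
        have := h1.trans this
        gcongr
    _ = _ := by ring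

lemma sum_prod3 (a b c : ℕ → ℝ) (A B D : Finset ℕ) (k : ℝ) :
    ∑ p ∈ A ×ˢ B ×ˢ D, k * (a p.1 * b p.2.1 * c p.2.2) =
      k * ((∑ n ∈ A, a n) * (∑ n ∈ B, b n) * (∑ n ∈ D, c n)) := by
  rw [← Finset.mul_sum, Finset.sum_product]
  congr 1
  simp_rw [Finset.sum_product]
  rw [Finset.sum_mul_sum, Finset.sum_mul]
  refine Finset.sum_congr rfl fun i _ => ?_
  rw [Finset.sum_mul]
  refine Finset.sum_congr rfl fun j _ => ?_
  rw [Finset.mul_sum]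

lemma cbr_pow_eq (U : ℝ) (hU : 1 ≤ U) (ε : ℝ) : cbr U ^ 2 * U ^ ε = U ^ (2 / 3 + ε) := by
  have h0 : 0 < U := by linarith
  rw [Real.rpow_add h0]
  congr 1
  unfold cbr
  rw [← Real.rpow_natCast, ← Real.rpow_mul h0.le]
  norm_num

lemma mul3_le {K a b c A B C : ℝ} (hK : 0 ≤ K) (ha : 0 ≤ a) (hb : 0 ≤ b) (hc : 0 ≤ c)
    (h1 : a ≤ A) (h2 : b ≤ B) (h3 : c ≤ C) : K * (a * b * c) ≤ K * (A * B * C) := by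
  have hA := ha.trans h1
  have hB := hb.trans h2
  exact mul_le_mul_of_nonneg_left (mul_le_mul (mul_le_mul h1 h2 hb hA) h3 hc
    (mul_nonneg hA hB)) hK

lemma mul_mono2 {a b x y : ℝ} (h : a ≤ b) (hx : 0 ≤ x) (hy : 0 ≤ y) : a * x * y ≤ b * x * y :=
  mul_le_mul_of_nonneg_right (mul_le_mul_of_nonneg_right h hx) hy

set_option maxHeartbeats 1000000 in
lemma pos_count (F ε : ℝ) (hF0 : 0 ≤ F) (hε : 0 < ε) : ∃ C : ℝ, 0 ≤ C ∧ ∀ f₁ f₂ f₃ : ℤ,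
    f₁ ≠ 0 → f₂ ≠ 0 → f₃ ≠ 0 → F = |((f₁ * f₂ * f₃ : ℤ) : ℝ)| →
    ∀ U₁ U₂ U₃ V₁ V₂ V₃ : ℝ,
      1 ≤ U₁ → 1 ≤ U₂ → 1 ≤ U₃ → 1 ≤ V₁ → 1 ≤ V₂ → 1 ≤ V₃ →
    ∀ P : Finset ((ℕ × ℕ × ℕ) × (ℕ × ℕ × ℕ)),
      (∀ p ∈ P, PSol f₁ f₂ f₃ p.1.1 p.1.2.1 p.1.2.2 p.2.1 p.2.2.1 p.2.2.2) →
      (∀ p ∈ P, (p.1.1 : ℝ) ≤ U₁ ∧ (p.1.2.1 : ℝ) ≤ U₂ ∧ (p.1.2.2 : ℝ) ≤ U₃) →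
      (∀ p ∈ P, (p.2.1 : ℝ) ≤ V₁ ∧ (p.2.2.1 : ℝ) ≤ V₂ ∧ (p.2.2.2 : ℝ) ≤ V₃) →
      (P.card : ℝ) ≤ C * (U₁ * U₂ * U₃) ^ (2 / 3 + ε) * (V₁ * V₂ * V₃) ^ ((1 : ℝ) / 3) := by
  classical
  obtain ⟨T, hT0, hT⟩ := sum_tau ε hε
  refine ⟨(3 + 64 * F) * T ^ 3 + (2 + 2 * F) * 27, by positivity, ?_⟩
  intro f₁ f₂ f₃ hf₁ hf₂ hf₃ hF U₁ U₂ U₃ V₁ V₂ V₃ hU₁ hU₂ hU₃ hV₁ hV₂ hV₃ P hP hPU hPV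
  have pU₁ : 0 < U₁ := by linarith
  have pU₂ : 0 < U₂ := by linarith
  have pU₃ : 0 < U₃ := by linarith
  have pV₁ : 0 < V₁ := by linarith
  have pV₂ : 0 < V₂ := by linarith
  have pV₃ : 0 < V₃ := by linarith
  have hU1 : 1 ≤ U₁ * U₂ * U₃ := one_le_mul_of_one_le_of_one_le
    (one_le_mul_of_one_le_of_one_le hU₁ hU₂) hU₃
  set U := U₁ * U₂ * U₃ with hUdef
  set V := V₁ * V₂ * V₃ with hVdef
  have pU : 0 < U := by positivity
  have pV : 0 < V := by positivity
  have cU := cbr_pos pU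
  have cV := cbr_pos pV
  have qU : 0 < U ^ (2 / 3 + ε) := Real.rpow_pos_of_pos pU _
  change (P.card : ℝ) ≤ _ * cbr V
  have cUe : cbr U = cbr U₁ * cbr U₂ * cbr U₃ := by
    rw [hUdef, cbr_mul (by positivity) (by positivity), cbr_mul (by positivity) (by positivity)]
  have cVe : cbr V = cbr V₁ * cbr V₂ * cbr V₃ := by
    rw [hVdef, cbr_mul (by positivity) (by positivity), cbr_mul (by positivity) (by positivity)]
  have wle : ∀ (a b c : ℕ) (X Y Z : ℝ), 0 < a → 0 < b → 0 < c → (a : ℝ) ≤ X → (b : ℝ) ≤ Y →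
      (c : ℝ) ≤ Z → 0 < cbr a * cbr b * cbr c ∧
      cbr a * cbr b * cbr c ≤ cbr X * cbr Y * cbr Z ∧
      (cbr a * cbr b * cbr c) ^ 3 = (a : ℝ) * b * c := by
    intro a b c X Y Z ha hb hc hX hY hZ
    have ra : (0 : ℝ) < a := by exact_mod_cast ha
    have rb : (0 : ℝ) < b := by exact_mod_cast hb
    have rc : (0 : ℝ) < c := by exact_mod_cast hc
    have := cbr_pos ra
    have := cbr_pos rb
    have := cbr_pos rc
    have := cbr_mono ra.le hX
    have := cbr_mono rb.le hY
    have := cbr_mono rc.le hZ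
    have hx0 : 0 ≤ cbr X := by linarith
    have hy0 : 0 ≤ cbr Y := by linarith
    have hxy : 0 ≤ cbr X * cbr Y := mul_nonneg hx0 hy0
    refine ⟨by positivity, by gcongr, ?_⟩
    rw [mul_pow, mul_pow, cbr_cube ra.le, cbr_cube rb.le, cbr_cube rc.le]
  rcases le_total U V with hUV | hUV
  · -- count over the `u`
    have cUV := cbr_mono pU.le hUV
    set I := Finset.Icc 1 ⌊U₁⌋₊ ×ˢ Finset.Icc 1 ⌊U₂⌋₊ ×ˢ Finset.Icc 1 ⌊U₃⌋₊ with hI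
    have hmap : ∀ p ∈ P, p.1 ∈ I := by
      intro p hp
      have h := hP p hp
      obtain ⟨h1, h2, h3⟩ := hPU p hp
      rw [hI]
      simp only [Finset.mem_product, Finset.mem_Icc]
      exact ⟨⟨h.1, Nat.le_floor h1⟩, ⟨h.2.1, Nat.le_floor h2⟩, ⟨h.2.2.1, Nat.le_floor h3⟩⟩
    have hcard : (P.card : ℝ) = ∑ u ∈ I, ((P.filter (fun p => p.1 = u)).card : ℝ) := by
      rw [Finset.card_eq_sum_card_fiberwise hmap]; push_cast; rfl
    have hfib : ∀ u ∈ I, ((P.filter (fun p => p.1 = u)).card : ℝ) ≤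
        ((3 + 64 * F) * cbr V) * ((u.1.divisors.card : ℝ) / cbr u.1 *
          ((u.2.1.divisors.card : ℝ) / cbr u.2.1) * ((u.2.2.divisors.card : ℝ) / cbr u.2.2)) := by
      rintro ⟨u₁, u₂, u₃⟩ hu
      rw [hI] at hu
      simp only [Finset.mem_product, Finset.mem_Icc] at hu
      obtain ⟨⟨a1, b1⟩, ⟨a2, b2⟩, ⟨a3, b3⟩⟩ := hu
      obtain ⟨w0, w1, w2⟩ := wle u₁ u₂ u₃ U₁ U₂ U₃ a1 a2 a3
        ((Nat.le_floor_iff pU₁.le).1 b1) ((Nat.le_floor_iff pU₂.le).1 b2)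
        ((Nat.le_floor_iff pU₃.le).1 b3)
      set w := cbr u₁ * cbr u₂ * cbr u₃ with hw
      have key := fixed_u f₁ f₂ f₃ hf₁ hf₂ hf₃ u₁ u₂ u₃
        (P.filter (fun p => p.1 = (u₁, u₂, u₃))) (fun p => p.2.1) (fun p => p.2.2.1)
        (fun p => p.2.2.2) ?_ ?_ V₁ V₂ V₃ pV₁ pV₂ pV₃
        (fun p hp => (hPV p (Finset.mem_filter.1 hp).1).1)
        (fun p hp => (hPV p (Finset.mem_filter.1 hp).1).2.1)
        (fun p hp => (hPV p (Finset.mem_filter.1 hp).1).2.2) F (cbr V) w hF cV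
        (cbr_cube pV.le) w0 w2
      · refine key.trans ?_
        have h1 : 3 + 8 * (8 * F * cbr V / w) ≤ (3 + 64 * F) * cbr V / w := by
          rw [le_div_iff₀ w0]
          have : (3 + 8 * (8 * F * cbr V / w)) * w = 3 * w + 64 * F * cbr V := by
            field_simp; ring
          rw [this]
          rw [← cUe] at w1
          linarith
        calc _ ≤ (3 + 64 * F) * cbr V / w * ((u₁.divisors.card : ℝ) * u₂.divisors.card *
              u₃.divisors.card) := by gcongr
          _ = _ := by
            rw [hw]
            simp only [div_eq_mul_inv, mul_inv]
            ring
      · intro p hp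
        rw [Finset.mem_filter] at hp
        have := hP p hp.1
        rw [hp.2] at this
        exact this
      · intro p hp q hq e1 e2 e3
        rw [Finset.mem_filter] at hp hq
        exact Prod.ext (hp.2.trans hq.2.symm) (Prod.ext e1 (Prod.ext e2 e3))
    rw [hcard]
    refine (Finset.sum_le_sum hfib).trans ?_
    rw [hI, sum_prod3 (fun n => (n.divisors.card : ℝ) / cbr n) (fun n => (n.divisors.card : ℝ) / cbr n)
      (fun n => (n.divisors.card : ℝ) / cbr n)]
    have t1 := hT U₁ hU₁
    have t2 := hT U₂ hU₂
    have t3 := hT U₃ hU₃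
    have nn : ∀ N : ℕ, 0 ≤ ∑ n ∈ Finset.Icc 1 N, (n.divisors.card : ℝ) / cbr (n : ℝ) :=
      fun N => Finset.sum_nonneg (fun n _ => div_nonneg (by positivity) (cbr_nonneg (by positivity)))
    have n1 := nn ⌊U₁⌋₊
    have n2 := nn ⌊U₂⌋₊
    have n3 := nn ⌊U₃⌋₊
    rw [cbr_pow_eq _ hU₁] at t1
    rw [cbr_pow_eq _ hU₂] at t2
    rw [cbr_pow_eq _ hU₃] at t3
    have z1 : 0 < U₁ ^ (2 / 3 + ε) := Real.rpow_pos_of_pos pU₁ _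
    have z2 : 0 < U₂ ^ (2 / 3 + ε) := Real.rpow_pos_of_pos pU₂ _
    have z3 : 0 < U₃ ^ (2 / 3 + ε) := Real.rpow_pos_of_pos pU₃ _
    have hpow : U ^ (2 / 3 + ε) = U₁ ^ (2 / 3 + ε) * U₂ ^ (2 / 3 + ε) * U₃ ^ (2 / 3 + ε) := by
      rw [hUdef, Real.mul_rpow (by positivity) (by positivity),
        Real.mul_rpow (by positivity) (by positivity)]
    have hK : 0 ≤ (3 + 64 * F) * cbr V := by positivity
    refine (mul3_le hK n1 n2 n3 t1 t2 t3).trans ?_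
    have e1 : (3 + 64 * F) * cbr V * ((T * U₁ ^ (2 / 3 + ε)) * (T * U₂ ^ (2 / 3 + ε)) *
          (T * U₃ ^ (2 / 3 + ε))) = (3 + 64 * F) * T ^ 3 * U ^ (2 / 3 + ε) * cbr V := by
      rw [hpow]; ring
    rw [e1]
    have h27 : 0 ≤ (2 + 2 * F) * 27 := by positivity
    exact mul_mono2 (le_add_of_nonneg_right h27) qU.le cV.le
  · -- count over the `v`
    have cUV := cbr_mono pV.le hUV
    set I := Finset.Icc 1 ⌊V₁⌋₊ ×ˢ Finset.Icc 1 ⌊V₂⌋₊ ×ˢ Finset.Icc 1 ⌊V₃⌋₊ with hI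
    have hmap : ∀ p ∈ P, p.2 ∈ I := by
      intro p hp
      have h := hP p hp
      obtain ⟨h1, h2, h3⟩ := hPV p hp
      rw [hI]
      simp only [Finset.mem_product, Finset.mem_Icc]
      exact ⟨⟨h.2.2.2.1, Nat.le_floor h1⟩, ⟨h.2.2.2.2.1, Nat.le_floor h2⟩,
        ⟨h.2.2.2.2.2.1, Nat.le_floor h3⟩⟩
    have hcard : (P.card : ℝ) = ∑ v ∈ I, ((P.filter (fun p => p.2 = v)).card : ℝ) := by
      rw [Finset.card_eq_sum_card_fiberwise hmap]; push_cast; rfl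
    have hfib : ∀ v ∈ I, ((P.filter (fun p => p.2 = v)).card : ℝ) ≤
        ((2 + 2 * F) * cbr U ^ 2) * (1 / cbr v.1 ^ 2 * (1 / cbr v.2.1 ^ 2) *
          (1 / cbr v.2.2 ^ 2)) := by
      rintro ⟨v₁, v₂, v₃⟩ hv
      rw [hI] at hv
      simp only [Finset.mem_product, Finset.mem_Icc] at hv
      obtain ⟨⟨a1, b1⟩, ⟨a2, b2⟩, ⟨a3, b3⟩⟩ := hv
      obtain ⟨w0, w1, w2⟩ := wle v₁ v₂ v₃ V₁ V₂ V₃ a1 a2 a3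
        ((Nat.le_floor_iff pV₁.le).1 b1) ((Nat.le_floor_iff pV₂.le).1 b2)
        ((Nat.le_floor_iff pV₃.le).1 b3)
      set w := cbr v₁ * cbr v₂ * cbr v₃ with hw
      have key := fixed_v f₁ f₂ f₃ hf₁ hf₂ hf₃ v₁ v₂ v₃
        (P.filter (fun p => p.2 = (v₁, v₂, v₃))) (fun p => p.1.1) (fun p => p.1.2.1)
        (fun p => p.1.2.2) ?_ ?_ U₁ U₂ U₃ pU₁ pU₂ pU₃
        (fun p hp => (hPU p (Finset.mem_filter.1 hp).1).1)
        (fun p hp => (hPU p (Finset.mem_filter.1 hp).1).2.1)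
        (fun p hp => (hPU p (Finset.mem_filter.1 hp).1).2.2) F (cbr U) w hF cU
        (cbr_cube pU.le) w0 w2
      · refine key.trans ?_
        have h1 : 1 ≤ cbr U ^ 2 / w ^ 2 := by
          rw [one_le_div (by positivity)]
          rw [← cVe] at w1
          have := w1.trans cUV
          gcongr
        calc _ ≤ (2 + 2 * F) * (cbr U ^ 2 / w ^ 2) := by linarith
          _ = _ := by
            rw [hw]
            simp only [div_eq_mul_inv, mul_inv, mul_pow]
            ring
      · intro p hp
        rw [Finset.mem_filter] at hp
        have := hP p hp.1
        rw [hp.2] at this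
        exact this
      · intro p hp q hq e1 e2 e3
        rw [Finset.mem_filter] at hp hq
        exact Prod.ext (Prod.ext e1 (Prod.ext e2 e3)) (hp.2.trans hq.2.symm)
    rw [hcard]
    refine (Finset.sum_le_sum hfib).trans ?_
    rw [hI, sum_prod3 (fun n => 1 / cbr n ^ 2) (fun n => 1 / cbr n ^ 2)
      (fun n => 1 / cbr n ^ 2)]
    have tt : ∀ X : ℝ, 0 < X → ∑ n ∈ Finset.Icc 1 ⌊X⌋₊, 1 / cbr (n : ℝ) ^ 2 ≤ 3 * cbr X := by
      intro X hX
      refine (sum_inv_sq _).trans ?_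
      have := cbr_mono (show (0 : ℝ) ≤ (⌊X⌋₊ : ℝ) by positivity) (Nat.floor_le hX.le)
      linarith
    have t1 := tt V₁ pV₁
    have t2 := tt V₂ pV₂
    have t3 := tt V₃ pV₃
    have nn : ∀ N : ℕ, 0 ≤ ∑ n ∈ Finset.Icc 1 N, 1 / cbr (n : ℝ) ^ 2 :=
      fun N => Finset.sum_nonneg (fun n _ => by positivity)
    have n1 := nn ⌊V₁⌋₊
    have n2 := nn ⌊V₂⌋₊
    have n3 := nn ⌊V₃⌋₊
    have c1 := cbr_pos pV₁
    have c2 := cbr_pos pV₂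
    have c3 := cbr_pos pV₃
    have hpow : cbr U ^ 2 ≤ U ^ (2 / 3 + ε) := by
      rw [← cbr_pow_eq U hU1]
      have : 1 ≤ U ^ ε := Real.one_le_rpow hU1 hε.le
      have : 0 < cbr U ^ 2 := by positivity
      nlinarith
    have hK : 0 ≤ (2 + 2 * F) * cbr U ^ 2 := by positivity
    refine (mul3_le hK n1 n2 n3 t1 t2 t3).trans ?_
    have e1 : (2 + 2 * F) * cbr U ^ 2 * ((3 * cbr V₁) * (3 * cbr V₂) * (3 * cbr V₃))
        = (2 + 2 * F) * 27 * cbr U ^ 2 * cbr V := by rw [cVe]; ring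
    rw [e1]
    have h27 : 0 ≤ (2 + 2 * F) * 27 := by positivity
    have hT3 : 0 ≤ (3 + 64 * F) * T ^ 3 := by positivity
    exact (mul_le_mul_of_nonneg_right (mul_le_mul_of_nonneg_left hpow h27) cV.le).trans
      (mul_mono2 (le_add_of_nonneg_left hT3) qU.le cV.le)

/-- The sign attached to a Boolean. -/
def bsgn (b : Bool) : ℤ := if b then 1 else -1

lemma bsgn_mul (x : ℤ) : bsgn (decide (0 < x)) * (x.natAbs : ℤ) = x := by
  unfold bsgn
  by_cases h : 0 < x
  · rw [decide_eq_true h]; simp only [if_true]; omega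
  · rw [decide_eq_false h]; simp only [Bool.false_eq_true, if_false]; omega

lemma bsgn_ne (b : Bool) : bsgn b ≠ 0 := by cases b <;> simp [bsgn]

lemma bsgn_abs (b : Bool) : |bsgn b| = 1 := by cases b <;> simp [bsgn]

/-- Geometry-of-numbers bound for `f₁ u₁ v₁² + f₂ u₂ v₂² + f₃ u₃ v₃² = 0`
(Lemma 4 of the paper). -/
theorem stmt_2 (f₁ f₂ f₃ : ℤ) (hf₁ : f₁ ≠ 0) (hf₂ : f₂ ≠ 0) (hf₃ : f₃ ≠ 0)
    (h₁₂ : Int.gcd f₁ f₂ = 1) (h₁₃ : Int.gcd f₁ f₃ = 1) (h₂₃ : Int.gcd f₂ f₃ = 1)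
    (ε : ℝ) (hε : 0 < ε) :
    ∃ C : ℝ, ∀ U₁ U₂ U₃ V₁ V₂ V₃ : ℝ,
      1 ≤ U₁ → 1 ≤ U₂ → 1 ≤ U₃ → 1 ≤ V₁ → 1 ≤ V₂ → 1 ≤ V₃ →
      (Set.ncard { p : (ℤ × ℤ × ℤ) × (ℤ × ℤ × ℤ) |
        match p with
        | ((u₁, u₂, u₃), (v₁, v₂, v₃)) =>
          u₁ ≠ 0 ∧ u₂ ≠ 0 ∧ u₃ ≠ 0 ∧ v₁ ≠ 0 ∧ v₂ ≠ 0 ∧ v₃ ≠ 0 ∧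
          |(u₁ : ℝ)| ≤ U₁ ∧ |(u₂ : ℝ)| ≤ U₂ ∧ |(u₃ : ℝ)| ≤ U₃ ∧
          |(v₁ : ℝ)| ≤ V₁ ∧ |(v₂ : ℝ)| ≤ V₂ ∧ |(v₃ : ℝ)| ≤ V₃ ∧
          f₁ * u₁ * v₁ ^ 2 + f₂ * u₂ * v₂ ^ 2 + f₃ * u₃ * v₃ ^ 2 = 0 ∧
          Int.gcd (u₁ * v₁) (u₂ * v₂) = 1 ∧
          Int.gcd (u₁ * v₁) (u₃ * v₃) = 1 ∧
          Int.gcd (u₂ * v₂) (u₃ * v₃) = 1 } : ℝ) ≤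
        C * (U₁ * U₂ * U₃) ^ (2 / 3 + ε) * (V₁ * V₂ * V₃) ^ ((1 : ℝ) / 3) := by
  classical
  obtain ⟨C, hC0, hC⟩ := pos_count (|((f₁ * f₂ * f₃ : ℤ) : ℝ)|) ε (abs_nonneg _) hε
  refine ⟨64 * C, ?_⟩
  intro U₁ U₂ U₃ V₁ V₂ V₃ hU₁ hU₂ hU₃ hV₁ hV₂ hV₃
  set R := (U₁ * U₂ * U₃) ^ (2 / 3 + ε) * (V₁ * V₂ * V₃) ^ ((1 : ℝ) / 3) with hR
  have hR0 : 0 ≤ R := by positivity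
  rw [mul_assoc, ← hR]
  set s := { p : (ℤ × ℤ × ℤ) × (ℤ × ℤ × ℤ) |
        match p with
        | ((u₁, u₂, u₃), (v₁, v₂, v₃)) =>
          u₁ ≠ 0 ∧ u₂ ≠ 0 ∧ u₃ ≠ 0 ∧ v₁ ≠ 0 ∧ v₂ ≠ 0 ∧ v₃ ≠ 0 ∧
          |(u₁ : ℝ)| ≤ U₁ ∧ |(u₂ : ℝ)| ≤ U₂ ∧ |(u₃ : ℝ)| ≤ U₃ ∧
          |(v₁ : ℝ)| ≤ V₁ ∧ |(v₂ : ℝ)| ≤ V₂ ∧ |(v₃ : ℝ)| ≤ V₃ ∧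
          f₁ * u₁ * v₁ ^ 2 + f₂ * u₂ * v₂ ^ 2 + f₃ * u₃ * v₃ ^ 2 = 0 ∧
          Int.gcd (u₁ * v₁) (u₂ * v₂) = 1 ∧
          Int.gcd (u₁ * v₁) (u₃ * v₃) = 1 ∧
          Int.gcd (u₂ * v₂) (u₃ * v₃) = 1 } with hs
  by_cases hfin : s.Finite
  swap
  · rw [Set.Infinite.ncard hfin]; simp; positivity
  rw [Set.ncard_eq_toFinset_card s hfin]
  set S := hfin.toFinset
  have hS : ∀ p ∈ S, p ∈ s := fun p hp => hfin.mem_toFinset.1 hp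
  let L : (ℤ × ℤ × ℤ) × (ℤ × ℤ × ℤ) → (Bool × Bool × Bool) × (Bool × Bool × Bool) := fun p =>
    ((decide (0 < p.1.1), decide (0 < p.1.2.1), decide (0 < p.1.2.2)),
      (decide (0 < p.2.1), decide (0 < p.2.2.1), decide (0 < p.2.2.2)))
  let M : (ℤ × ℤ × ℤ) × (ℤ × ℤ × ℤ) → (ℕ × ℕ × ℕ) × (ℕ × ℕ × ℕ) := fun p =>
    ((p.1.1.natAbs, p.1.2.1.natAbs, p.1.2.2.natAbs),
      (p.2.1.natAbs, p.2.2.1.natAbs, p.2.2.2.natAbs))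
  have hfib : ∀ b ∈ (Finset.univ : Finset ((Bool × Bool × Bool) × (Bool × Bool × Bool))),
      (S.filter (fun p => L p = b)).card ≤ ⌊C * R⌋₊ := by
    rintro ⟨⟨σ₁, σ₂, σ₃⟩, ⟨τ₁, τ₂, τ₃⟩⟩ _
    apply Nat.le_floor
    have hinj : Set.InjOn M (S.filter (fun p => L p = ((σ₁, σ₂, σ₃), (τ₁, τ₂, τ₃))) :
        Finset _) := by
      rintro ⟨⟨a₁, a₂, a₃⟩, ⟨b₁, b₂, b₃⟩⟩ hp ⟨⟨c₁, c₂, c₃⟩, ⟨d₁, d₂, d₃⟩⟩ hq hpq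
      have hp' := (Finset.mem_filter.1 (Finset.mem_coe.1 hp)).2
      have hq' := (Finset.mem_filter.1 (Finset.mem_coe.1 hq)).2
      have hl := hp'.trans hq'.symm
      simp only [L, M, Prod.mk.injEq] at hl hpq
      obtain ⟨⟨l1, l2, l3⟩, ⟨l4, l5, l6⟩⟩ := hl
      obtain ⟨⟨m1, m2, m3⟩, ⟨m4, m5, m6⟩⟩ := hpq
      rw [← bsgn_mul a₁, ← bsgn_mul a₂, ← bsgn_mul a₃, ← bsgn_mul b₁, ← bsgn_mul b₂, ← bsgn_mul b₃,
        l1, l2, l3, l4, l5, l6, m1, m2, m3, m4, m5, m6]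
      simp only [bsgn_mul]
    rw [← Finset.card_image_of_injOn hinj, hR, ← mul_assoc]
    refine hC (f₁ * bsgn σ₁) (f₂ * bsgn σ₂) (f₃ * bsgn σ₃) (mul_ne_zero hf₁ (bsgn_ne _))
      (mul_ne_zero hf₂ (bsgn_ne _)) (mul_ne_zero hf₃ (bsgn_ne _)) ?_ U₁ U₂ U₃ V₁ V₂ V₃
      hU₁ hU₂ hU₃ hV₁ hV₂ hV₃ _ ?_ ?_ ?_
    · rw [← Int.cast_abs, ← Int.cast_abs]
      congr 1
      simp only [abs_mul, bsgn_abs, mul_one]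
    · intro q hq
      obtain ⟨⟨⟨u₁, u₂, u₃⟩, ⟨v₁, v₂, v₃⟩⟩, hp, rfl⟩ := Finset.mem_image.1 hq
      obtain ⟨hp, hl⟩ := Finset.mem_filter.1 hp
      obtain ⟨n1, n2, n3, n4, n5, n6, -, -, -, -, -, -, e, g1, g2, g3⟩ := hS _ hp
      simp only [L, Prod.mk.injEq] at hl
      obtain ⟨⟨l1, l2, l3⟩, -⟩ := hl
      simp only [M]
      refine ⟨Int.natAbs_pos.2 n1, Int.natAbs_pos.2 n2, Int.natAbs_pos.2 n3, Int.natAbs_pos.2 n4,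
        Int.natAbs_pos.2 n5, Int.natAbs_pos.2 n6, ?_, ?_, ?_, ?_⟩
      · rw [Int.natAbs_sq, Int.natAbs_sq, Int.natAbs_sq, mul_assoc f₁, mul_assoc f₂, mul_assoc f₃,
          ← l1, ← l2, ← l3, bsgn_mul, bsgn_mul, bsgn_mul]
        exact e
      · rw [← Int.natAbs_mul, ← Int.natAbs_mul]; exact g1
      · rw [← Int.natAbs_mul, ← Int.natAbs_mul]; exact g2
      · rw [← Int.natAbs_mul, ← Int.natAbs_mul]; exact g3
    · intro q hq
      obtain ⟨⟨⟨u₁, u₂, u₃⟩, ⟨v₁, v₂, v₃⟩⟩, hp, rfl⟩ := Finset.mem_image.1 hq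
      obtain ⟨hp, hl⟩ := Finset.mem_filter.1 hp
      obtain ⟨-, -, -, -, -, -, n1, n2, n3, n4, n5, n6, -⟩ := hS _ hp
      simp only [M, Nat.cast_natAbs, Int.cast_abs]
      exact ⟨n1, n2, n3⟩
    · intro q hq
      obtain ⟨⟨⟨u₁, u₂, u₃⟩, ⟨v₁, v₂, v₃⟩⟩, hp, rfl⟩ := Finset.mem_image.1 hq
      obtain ⟨hp, hl⟩ := Finset.mem_filter.1 hp
      obtain ⟨-, -, -, -, -, -, n1, n2, n3, n4, n5, n6, -⟩ := hS _ hp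
      simp only [M, Nat.cast_natAbs, Int.cast_abs]
      exact ⟨n4, n5, n6⟩
  have := Finset.card_le_mul_card_image_of_maps_to (s := S) (f := L)
    (fun p _ => Finset.mem_univ _) _ hfib
  have hu : (Finset.univ : Finset ((Bool × Bool × Bool) × (Bool × Bool × Bool))).card = 64 := by
    simp
  rw [hu] at this
  have h2 : (S.card : ℝ) ≤ (⌊C * R⌋₊ : ℝ) * 64 := by exact_mod_cast this
  have h3 := Nat.floor_le (mul_nonneg hC0 hR0)
  linarith
end

section
/- Let $(A,B) \in \mathbb{Z}^2$ with $4A^3 + 27B^2 \neq 0$ and let $\alpha > 0$ be fixed. There exists a constant $C$ depending only on $A$, $B$ and $\alpha$ such that for every real $X \geq 1$, the number of tuples $(d_0, d_1, b_1, y, x_1) \in \mathbb{Z}_{\geq 1}^4 \times \mathbb{Z}$ satisfying: $d_0 d_1$ is squarefree, $\gcd(x_1, d_1 b_1) = 1$, $d_0 y^2 = x_1^3 + A x_1 d_1^2 b_1^4 + B d_1^3 b_1^6$, $d_0 d_1 \leq X$, $|x_1| \leq X^{1/4 + 2\alpha}$ and $d_1 b_1^2 \leq X^{1/4 + 2\alpha}$,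 is at most $C X^{1/2 + 4\alpha}$. -/
lemma sqf_aux (a b u v : ℤ) (hb : Squarefree b) (hu : 1 ≤ u)
    (hc : IsCoprime u v) (h : a * u ^ 2 = b * v ^ 2) : u = 1 := by
  have h1 : u * u ∣ b := by
    have h2 : u ^ 2 ∣ b * v ^ 2 := ⟨a, by rw [← h]; ring⟩
    have h3 : IsCoprime (u ^ 2) (v ^ 2) := hc.pow
    have := h3.dvd_of_dvd_mul_right h2
    rwa [sq] at this
  have h4 := hb u h1
  rcases Int.isUnit_iff.1 h4 with h | h <;> omega

lemma sqf_unique (a b y z : ℤ) (ha : Squarefree a) (hb : Squarefree b)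
    (hy : 1 ≤ y) (hz : 1 ≤ z) (h : a * y ^ 2 = b * z ^ 2) : a = b ∧ y = z := by
  have hg : 0 < Int.gcd y z := Int.gcd_pos_of_ne_zero_left _ (by omega)
  obtain ⟨u, hu⟩ := Int.gcd_dvd_left y z
  obtain ⟨v, hv⟩ := Int.gcd_dvd_right y z
  have hg' : (0 : ℤ) < (Int.gcd y z : ℤ) := by exact_mod_cast hg
  have hbez := Int.gcd_eq_gcd_ab y z
  generalize (Int.gcd y z : ℤ) = g at *
  have hu1 : 1 ≤ u := by
    have : 0 < g * u := by omega
    exact (pos_iff_pos_of_mul_pos this).1 hg'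
  have hv1 : 1 ≤ v := by
    have : 0 < g * v := by omega
    exact (pos_iff_pos_of_mul_pos this).1 hg'
  have hc : IsCoprime u v := by
    refine ⟨Int.gcdA y z, Int.gcdB y z, ?_⟩
    generalize Int.gcdA y z = s at *
    generalize Int.gcdB y z = t at *
    apply mul_left_cancel₀ hg'.ne'
    subst hu hv
    linarith
  have h' : a * u ^ 2 = b * v ^ 2 := by
    apply mul_left_cancel₀ (pow_pos hg' 2).ne'
    rw [hu, hv] at h
    linarith
  have e1 := sqf_aux a b u v hb hu1 hc h'
  have e2 := sqf_aux b a v u ha hv1 hc.symm h'.symm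
  subst e1 e2
  exact ⟨by linarith, by rw [hu, hv]⟩

/-- The bound `𝒩*_α(A,B;X) ≪ X^{1/2+4α}` (Lemma 5 of the paper). -/
theorem stmt_3 (A B : ℤ) (hAB : 4 * A ^ 3 + 27 * B ^ 2 ≠ 0)
    (α : ℝ) (hα : 0 < α) :
    ∃ C : ℝ, ∀ X : ℝ, 1 ≤ X →
      (Set.ncard { t : ℤ × ℤ × ℤ × ℤ × ℤ |
        match t with
        | (d₀, d₁, b₁, y, x₁) =>
          1 ≤ d₀ ∧ 1 ≤ d₁ ∧ 1 ≤ b₁ ∧ 1 ≤ y ∧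
          Squarefree (d₀ * d₁) ∧
          Int.gcd x₁ (d₁ * b₁) = 1 ∧
          d₀ * y ^ 2 = x₁ ^ 3 + A * x₁ * d₁ ^ 2 * b₁ ^ 4 + B * d₁ ^ 3 * b₁ ^ 6 ∧
          ((d₀ * d₁ : ℤ) : ℝ) ≤ X ∧
          |(x₁ : ℝ)| ≤ X ^ ((1 : ℝ) / 4 + 2 * α) ∧
          ((d₁ * b₁ ^ 2 : ℤ) : ℝ) ≤ X ^ ((1 : ℝ) / 4 + 2 * α) } : ℝ) ≤
        C * X ^ ((1 : ℝ) / 2 + 4 * α) := by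
  refine ⟨3 * ∑' b : ℕ, 1 / (b : ℝ) ^ 2, fun X hX => ?_⟩
  have hT2 : X ^ ((1 : ℝ) / 2 + 4 * α) =
      X ^ ((1 : ℝ) / 4 + 2 * α) * X ^ ((1 : ℝ) / 4 + 2 * α) := by
    rw [← Real.rpow_add (by linarith)]
    congr 1
    ring
  have hT : 1 ≤ X ^ ((1 : ℝ) / 4 + 2 * α) := Real.one_le_rpow hX (by positivity)
  rw [hT2]
  generalize X ^ ((1 : ℝ) / 4 + 2 * α) = T at *
  let F : Finset ((Σ _ : ℕ, ℤ) × ℤ) :=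
    ((Finset.Icc 1 ⌊T⌋₊).sigma (fun b : ℕ => Finset.Icc (1 : ℤ) ⌊T / (b : ℝ) ^ 2⌋)) ×ˢ
      Finset.Icc (-⌊T⌋) ⌊T⌋
  have hF : (F.card : ℝ) ≤ (3 * ∑' b : ℕ, 1 / (b : ℝ) ^ 2) * (T * T) := by
    have hsum : Summable (fun b : ℕ => 1 / (b : ℝ) ^ 2) :=
      Real.summable_one_div_nat_pow.2 (by norm_num)
    have c1 : ((Finset.Icc (-⌊T⌋) ⌊T⌋).card : ℝ) ≤ 3 * T := by
      rw [Int.card_Icc]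
      have h0 : 0 ≤ ⌊T⌋ := Int.floor_nonneg.2 (by linarith)
      have : (((⌊T⌋ + 1 - -⌊T⌋).toNat : ℤ) : ℝ) = ((⌊T⌋ + 1 - -⌊T⌋ : ℤ) : ℝ) := by
        rw [Int.toNat_of_nonneg (by omega)]
      rw [Int.cast_natCast] at this
      rw [this]
      push_cast
      linarith [Int.floor_le T]
    have c2 : ((((Finset.Icc 1 ⌊T⌋₊).sigma
        (fun b : ℕ => Finset.Icc (1 : ℤ) ⌊T / (b : ℝ) ^ 2⌋)).card : ℕ) : ℝ) ≤
        T * ∑' b : ℕ, 1 / (b : ℝ) ^ 2 := by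
      rw [Finset.card_sigma]
      push_cast
      calc _ ≤ ∑ b ∈ Finset.Icc 1 ⌊T⌋₊, T * (1 / (b : ℝ) ^ 2) := by
            apply Finset.sum_le_sum
            intro b _
            rw [Int.card_Icc]
            have hnn : 0 ≤ T / (b : ℝ) ^ 2 := by positivity
            have h0 : 0 ≤ ⌊T / (b : ℝ) ^ 2⌋ := Int.floor_nonneg.2 hnn
            have : (((⌊T / (b : ℝ) ^ 2⌋ + 1 - 1).toNat : ℤ) : ℝ) =
                ((⌊T / (b : ℝ) ^ 2⌋ : ℤ) : ℝ) := by
              rw [Int.toNat_of_nonneg (by omega), add_sub_cancel_right]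
            rw [Int.cast_natCast] at this
            rw [this, mul_one_div]
            exact Int.floor_le _
        _ = T * ∑ b ∈ Finset.Icc 1 ⌊T⌋₊, (1 / (b : ℝ) ^ 2) := by rw [Finset.mul_sum]
        _ ≤ _ := by
            gcongr
            exact hsum.sum_le_tsum _ (fun _ _ => by positivity)
    have hs0 : 0 ≤ ∑' b : ℕ, 1 / (b : ℝ) ^ 2 := tsum_nonneg (fun _ => by positivity)
    rw [Finset.card_product]
    push_cast
    calc _ ≤ (T * ∑' b : ℕ, 1 / (b : ℝ) ^ 2) * (3 * T) := by
          exact mul_le_mul c2 c1 (by positivity) (by positivity)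
      _ = _ := by ring
  refine le_trans ?_ hF
  rw [← Set.ncard_coe_finset F, Nat.cast_le]
  refine Set.ncard_le_ncard_of_injOn
    (fun t : ℤ × ℤ × ℤ × ℤ × ℤ => ((⟨t.2.2.1.toNat, t.2.1⟩ : Σ _ : ℕ, ℤ), t.2.2.2.2)) ?_ ?_ F.finite_toSet
  · rintro ⟨d₀, d₁, b₁, y, x₁⟩ ⟨h1, h2, h3, h4, h5, h6, h7, h8, h9, h10⟩
    lift b₁ to ℕ using (by omega) with b
    have hb : 1 ≤ b := by exact_mod_cast h3
    have hb' : (1 : ℝ) ≤ b := by exact_mod_cast hb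
    have hd' : (1 : ℝ) ≤ d₁ := by exact_mod_cast h2
    push_cast at h10
    simp only [F, Finset.coe_product, Set.mem_prod, Finset.mem_coe, Finset.mem_sigma,
      Finset.mem_Icc, Int.toNat_natCast]
    rw [abs_le] at h9
    refine ⟨⟨⟨hb, Nat.le_floor ?_⟩, h2, Int.le_floor.2 ?_⟩, ?_, Int.le_floor.2 h9.2⟩
    · nlinarith [mul_le_mul hd' (le_refl ((b : ℝ) ^ 2)) (by positivity) (by positivity)]
    · rw [le_div_iff₀ (by positivity)]
      exact h10
    · have : -x₁ ≤ ⌊T⌋ := Int.le_floor.2 (by push_cast; linarith [h9.1])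
      omega
  · rintro ⟨d₀, d₁, b₁, y, x₁⟩ ⟨h1, h2, h3, h4, h5, h6, h7, h8, h9, h10⟩
      ⟨e₀, e₁, c₁, z, w₁⟩ ⟨k1, k2, k3, k4, k5, k6, k7, k8, k9, k10⟩ heq
    simp only [Prod.mk.injEq, Sigma.mk.injEq, heq_eq_eq] at heq
    obtain ⟨⟨hb, rfl⟩, rfl⟩ := heq
    have hbc : b₁ = c₁ := by omega
    subst hbc
    obtain ⟨rfl, rfl⟩ := sqf_unique d₀ e₀ y z (h5.squarefree_of_dvd (dvd_mul_right _ _))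
      (k5.squarefree_of_dvd (dvd_mul_right _ _)) h4 k4 (h7.trans k7.symm)
    rfl
end

section
/- Let $\alpha > 0$ and $\varepsilon > 0$ be fixed. There exists a constant $C$ depending only on $\alpha$ and $\varepsilon$ such that for every real $X \geq 1$, the number of tuples $(\nu, d_1, d_2, d_3, d_4, b_1, b_2, b_3, b_4)$ with $\nu \in \{-1,1\}$ and $(d_1,d_2,d_3,d_4,b_1,b_2,b_3,b_4) \in \mathbb{Z}_{\geq 1}^8$ satisfying: $d_1 d_2 d_3 d_4$ is squarefree, $\gcd(d_1 b_1, d_2 b_2) = 1$, $d_2 b_2^2 - \nu d_1 b_1^2 = d_3 b_3^2$, $\nu d_2 b_2^2 + d_1 b_1^2 = d_4 b_4^2$, $d_1 d_2 d_3 d_4 \leq X$, $d_1 b_1^2 \leq X^{1/4+2\alpha}$ and $d_2 b_2^2 \leq X^{1/4+2\alpha}$, is at most $C X^{1/2 + \alpha + \varepsilon}$. -/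
/-- Square roots modulo `m` are separated by divisors of `m`. -/
lemma label_exists {ι : Type*} (S : Finset ι) (p q : ι → ℤ) (m a b : ℤ) (hm : Squarefree m)
    (ha : IsCoprime a m)
    (hpq : ∀ i ∈ S, IsCoprime (p i) (q i))
    (h : ∀ i ∈ S, m ∣ a * p i ^ 2 - b * q i ^ 2) :
    ∃ f : ι → ℕ, (∀ i ∈ S, f i ∈ m.natAbs.divisors) ∧
      ∀ i ∈ S, ∀ j ∈ S, f i = f j → m ∣ p i * q j - p j * q i := by
  classical
  rcases S.eq_empty_or_nonempty with rfl | ⟨o, ho⟩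
  · exact ⟨fun _ => 1, by simp, by simp⟩
  have hm0 : m ≠ 0 := hm.ne_zero
  have hq : ∀ i ∈ S, IsCoprime (q i) m := by
    intro i hi
    rw [Int.isCoprime_iff_nat_coprime]
    by_contra hc
    obtain ⟨r, hr, h1, h2⟩ := Nat.Prime.not_coprime_iff_dvd.mp hc
    have h1' : (r : ℤ) ∣ q i := Int.natCast_dvd.mpr h1
    have h2' : (r : ℤ) ∣ m := Int.natCast_dvd.mpr h2
    have hrp : Prime (r : ℤ) := Nat.prime_iff_prime_int.mp hr
    have h3 : (r : ℤ) ∣ a * p i ^ 2 := by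
      have := dvd_add (h2'.trans (h i hi)) (Dvd.dvd.mul_left (dvd_pow h1' two_ne_zero) b)
      simpa using this
    rcases hrp.dvd_or_dvd h3 with h4 | h4
    · exact hrp.not_isUnit (ha.isUnit_of_dvd' h4 h2')
    · exact hrp.not_isUnit ((hpq i hi).isUnit_of_dvd' (hrp.dvd_of_dvd_pow h4) h1')
  refine ⟨fun i => Int.gcd m (p i * q o - p o * q i), ?_, ?_⟩
  · intro i hi
    rw [Nat.mem_divisors]
    exact ⟨Int.natCast_dvd.mp (Int.gcd_dvd_left ..), by simpa using hm0⟩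
  · intro i hi j hj hij
    simp only at hij
    have key : ∀ k ∈ S, m ∣ (p k * q o - p o * q k) * (p k * q o + p o * q k) := by
      intro k hk
      have h1 := h k hk
      have h2 := h o ho
      have h3 : m ∣ a * ((p k * q o - p o * q k) * (p k * q o + p o * q k)) := by
        exact (dvd_sub (h1.mul_right (q o ^ 2)) (h2.mul_right (q k ^ 2))).trans (dvd_of_eq (by ring))
      exact (ha.symm).dvd_of_dvd_mul_left h3
    set g : ℤ := (Int.gcd m (p i * q o - p o * q i) : ℤ) with hg
    have hgj : g = (Int.gcd m (p j * q o - p o * q j) : ℤ) := by rw [hg, hij]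
    obtain ⟨t, ht⟩ : g ∣ m := Int.gcd_dvd_left ..
    have hg0 : g ≠ 0 := by rintro h0; rw [h0] at ht; simp at ht; exact hm0 ht
    have hcop : IsCoprime g t := by
      rw [ht] at hm
      exact (squarefree_mul_iff.mp hm).1.isCoprime
    have hdiv : ∀ k ∈ S, g = (Int.gcd m (p k * q o - p o * q k) : ℤ) →
        g ∣ p k * q o - p o * q k ∧ t ∣ p k * q o + p o * q k := by
      intro k hk hgk
      have h1 : g ∣ p k * q o - p o * q k := by rw [hgk]; exact Int.gcd_dvd_right ..
      refine ⟨h1, ?_⟩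
      obtain ⟨s, hs⟩ := h1
      have h2 := key k hk
      rw [hs, ht, mul_assoc] at h2
      have h3 : t ∣ s * (p k * q o + p o * q k) := (mul_dvd_mul_iff_left hg0).mp h2
      have h4 : IsCoprime t s := by
        have : (g : ℤ) = Int.gcd (g * t) (g * s) := by rw [← ht, ← hs]; exact hgk
        rw [Int.gcd_mul_left] at this
        rw [Int.isCoprime_iff_gcd_eq_one]
        have hgp : (g.natAbs : ℤ) = g := Int.natAbs_of_nonneg (by rw [hg]; positivity)
        push_cast at this
        rw [Int.abs_eq_natAbs, hgp] at this
        have h5 : g * ((Int.gcd t s : ℕ) : ℤ) = g * 1 := by linarith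
        exact_mod_cast mul_left_cancel₀ hg0 h5
      exact h4.dvd_of_dvd_mul_left h3
    obtain ⟨i1, i2⟩ := hdiv i hi hg
    obtain ⟨j1, j2⟩ := hdiv j hj hgj
    have hqo := hq o ho
    rw [ht] at hqo ⊢
    refine hcop.mul_dvd ?_ ?_
    · have : g ∣ q o * (p i * q j - p j * q i) := by
        exact (dvd_sub (i1.mul_right (q j)) (j1.mul_right (q i))).trans (dvd_of_eq (by ring))
      exact (hqo.of_mul_right_left).symm.dvd_of_dvd_mul_left this
    · have : t ∣ q o * (p i * q j - p j * q i) := by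
        exact (dvd_sub (i2.mul_right (q j)) (j2.mul_right (q i))).trans (dvd_of_eq (by ring))
      exact (hqo.of_mul_right_right).symm.dvd_of_dvd_mul_left this

lemma conic_det (s r u1 u2 u3 w1 w2 w3 : ℝ) 
    (h1 : w1 ^ 2 = s * u1 ^ 2 + r) (h2 : w2 ^ 2 = s * u2 ^ 2 + r) (h3 : w3 ^ 2 = s * u3 ^ 2 + r) :
    ((u2 - u1) * (w3 - w1) - (u3 - u1) * (w2 - w1)) * ((w1 + w2) * (w1 + w3) * (w2 + w3)) =
     s * ((u2 - u1) * (u3 - u1) * (u3 - u2)) *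
       ((w1 + w3) * (w2 + w3) - s * (u1 + u3) * (u2 + u3)) := by
  have e13 : (w3 - w1) * (w1 + w3) = s * (u3 - u1) * (u1 + u3) := by linear_combination h3 - h1
  have e12 : (w2 - w1) * (w1 + w2) = s * (u2 - u1) * (u1 + u2) := by linear_combination h2 - h1
  have e23 : (w3 - w2) * (w2 + w3) = s * (u3 - u2) * (u2 + u3) := by linear_combination h3 - h2
  linear_combination (u2 - u1) * (w1 + w2) * (w2 + w3) * e13 - (u3 - u1) * (w1+w3) * (w2 + w3) * e12
    - s * (u2 - u1) * (u3 - u1) * (u1 + u3) * e23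

/-- the determinant of three points on a conic, in a short arc -/
lemma conic_area (s r u1 u2 u3 w1 w2 w3 δ w : ℝ) (hs : 0 < s) (hr : 0 < r) (hw : 0 < w)
    (pu1 : 0 < u1) (pu2 : 0 < u2) (pu3 : 0 < u3)
    (pw1 : w ≤ w1) (pw2 : w ≤ w2) (pw3 : w ≤ w3)
    (h1 : w1 ^ 2 = s * u1 ^ 2 + r) (h2 : w2 ^ 2 = s * u2 ^ 2 + r) (h3 : w3 ^ 2 = s * u3 ^ 2 + r)
    (d12 : |u2 - u1| ≤ δ) (d13 : |u3 - u1| ≤ δ) (d23 : |u3 - u2| ≤ δ)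
    (n12 : u2 ≠ u1) (n13 : u3 ≠ u1) (n23 : u3 ≠ u2) :
    (u2 - u1) * (w3 - w1) - (u3 - u1) * (w2 - w1) ≠ 0 ∧
    |(u2 - u1) * (w3 - w1) - (u3 - u1) * (w2 - w1)| ≤ s * δ ^ 3 / (2 * w) := by
  have id := conic_det s r u1 u2 u3 w1 w2 w3 h1 h2 h3
  have q1 : 0 < w1 := by linarith
  have q2 : 0 < w2 := by linarith
  have q3 : 0 < w3 := by linarith
  set Δ := (u2 - u1) * (w3 - w1) - (u3 - u1) * (w2 - w1)
  set t := Real.sqrt s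
  have ht : t ^ 2 = s := Real.sq_sqrt hs.le
  have ht0 : 0 < t := Real.sqrt_pos.mpr hs
  have a1 : t * u1 < w1 := by
    apply lt_of_pow_lt_pow_left₀ 2 q1.le; rw [mul_pow, ht, h1]; linarith
  have a2 : t * u2 < w2 := by
    apply lt_of_pow_lt_pow_left₀ 2 q2.le; rw [mul_pow, ht, h2]; linarith
  have a3 : t * u3 < w3 := by
    apply lt_of_pow_lt_pow_left₀ 2 q3.le; rw [mul_pow, ht, h3]; linarith
  have b1 : s * (u1 + u3) * (u2 + u3) < (w1 + w3) * (w2 + w3) := by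
    have : (t * u1 + t * u3) * (t * u2 + t * u3) < (w1 + w3) * (w2 + w3) := by
      apply mul_lt_mul'' <;> first | linarith | positivity
    calc _ = (t * u1 + t * u3) * (t * u2 + t * u3) := by rw [← ht]; ring
      _ < _ := this
  have b0 : 0 < s * (u1 + u3) * (u2 + u3) := by positivity
  set G := (w1 + w3) * (w2 + w3) - s * (u1 + u3) * (u2 + u3) with hG
  have hGp : 0 < G := by linarith
  refine ⟨?_, ?_⟩
  · intro h0
    rw [h0, zero_mul] at id
    have := mul_ne_zero (mul_ne_zero hs.ne' (mul_ne_zero (mul_ne_zero (sub_ne_zero.mpr n12)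
      (sub_ne_zero.mpr n13)) (sub_ne_zero.mpr n23))) hGp.ne'
    exact this id.symm
  · have id2 := congrArg abs id
    rw [abs_mul, abs_of_pos (show 0 < (w1 + w2) * (w1 + w3) * (w2 + w3) by positivity),
      abs_mul, abs_mul s, abs_mul, abs_mul (u2 - u1), abs_of_pos hGp, abs_of_pos hs] at id2
    have hP : |u2 - u1| * |u3 - u1| * |u3 - u2| ≤ δ ^ 3 := by
      have hδ : 0 ≤ δ := (abs_nonneg _).trans d12
      calc _ ≤ δ * δ * δ := by gcongr
        _ = _ := by ring
    have h5 : |Δ| * ((w1 + w2) * (w1 + w3) * (w2 + w3)) ≤ s * δ ^ 3 * ((w1 + w3) * (w2 + w3)) := by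
      rw [id2]
      apply mul_le_mul
      · gcongr
      · linarith
      · exact hGp.le
      · have hδ : 0 ≤ δ := (abs_nonneg _).trans d12
        positivity
    have h6 : |Δ| * (w1 + w2) ≤ s * δ ^ 3 := by
      have : 0 < (w1 + w3) * (w2 + w3) := by positivity
      nlinarith
    rw [le_div_iff₀ (by positivity)]
    refine le_trans ?_ h6
    gcongr
    linarith

lemma coprime_ratio (x y x' y' : ℤ) (hx : 0 < x) (hx' : 0 < x') 
    (h : IsCoprime x y) (h' : IsCoprime x' y') (e : x * y' = x' * y) : x = x' ∧ y = y' := by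
  have h1 : x ∣ x' := h.dvd_of_dvd_mul_right ⟨y', e.symm⟩
  have h2 : x' ∣ x := h'.dvd_of_dvd_mul_right ⟨y, e⟩
  have h3 : x = x' := Int.dvd_antisymm hx.le hx'.le h1 h2
  subst h3
  exact ⟨rfl, (mul_left_cancel₀ hx.ne' e).symm⟩

lemma arc_close (a b c : ℝ) (ha : 0 ≤ a) (hb : 0 ≤ b) (hc : 0 < c) (h : ⌊a * c⌋₊ = ⌊b * c⌋₊) :
    |b - a| ≤ 1 / c := by
  have h1 := Nat.floor_le (mul_nonneg ha hc.le)
  have h2 := Nat.floor_le (mul_nonneg hb hc.le)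
  have h3 := Nat.lt_floor_add_one (a * c)
  have h4 := Nat.lt_floor_add_one (b * c)
  rw [h] at h1 h3
  have : |b - a| * c ≤ 1 := by
    have e : |b - a| * c = |(b - a) * c| := by rw [abs_mul, abs_of_pos hc]
    rw [e, abs_le]
    constructor <;> nlinarith
  rwa [le_div_iff₀ hc]

lemma conic_count_s4 {ι : Type*} (S : Finset ι) (x y z : ι → ℤ) (A B C m1 m2 m3 X0 Y0 Z0 : ℤ) (K : ℕ)
    (hA : 0 < A) (hB : 0 < B) (hC : 0 < C) (hX : 0 < X0) (hY : 0 < Y0) (hZ : 0 < Z0)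
    (s1 : Squarefree m1) (s2 : Squarefree m2) (s3 : Squarefree m3)
    (dA : m1 ∣ A) (dB : m2 ∣ B) (dC : m3 ∣ C)
    (c1 : IsCoprime C m1) (c2 : IsCoprime C m2) (c3 : IsCoprime A m3)
    (c12 : IsCoprime m1 m2) (c13 : IsCoprime m1 m3) (c23 : IsCoprime m2 m3)
    (hx : ∀ i ∈ S, X0 ≤ x i ∧ x i < 2 * X0) (hy : ∀ i ∈ S, Y0 ≤ y i ∧ y i < 2 * Y0)
    (hz : ∀ i ∈ S, Z0 ≤ z i ∧ z i < 2 * Z0)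
    (heq : ∀ i ∈ S, A * x i ^ 2 + B * y i ^ 2 = C * z i ^ 2)
    (cxy : ∀ i ∈ S, IsCoprime (x i) (y i)) (cxz : ∀ i ∈ S, IsCoprime (x i) (z i))
    (cyz : ∀ i ∈ S, IsCoprime (y i) (z i))
    (inj : ∀ i ∈ S, ∀ j ∈ S, x i = x j → y i = y j → z i = z j → i = j)
    (hK : 256 * (X0 * Y0 * Z0) < (K : ℤ) ^ 3 * (m1 * m2 * m3)) :
    S.card ≤ 2 * (m1.natAbs.divisors.card * (m2.natAbs.divisors.card *
      (m3.natAbs.divisors.card * K))) := by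
  classical
  obtain ⟨f1, f1m, f1d⟩ := label_exists S z y m1 C B s1 c1 (fun i hi => (cyz i hi).symm)
    (fun i hi => by rw [← heq i hi]; simpa using dA.mul_right _)
  obtain ⟨f2, f2m, f2d⟩ := label_exists S z x m2 C A s2 c2 (fun i hi => (cxz i hi).symm)
    (fun i hi => by rw [← heq i hi]; simpa using dB.mul_right _)
  obtain ⟨f3, f3m, f3d⟩ := label_exists S x y m3 A (-B) s3 c3 (fun i hi => cxy i hi)
    (fun i hi => by
      have : A * x i ^ 2 - -B * y i ^ 2 = C * z i ^ 2 := by rw [← heq i hi]; ring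
      rw [this]; exact dC.mul_right _)
  have hK0 : 0 < K := by
    rcases Nat.eq_zero_or_pos K with h | h
    · subst h
      have : 0 < X0 * Y0 * Z0 := by positivity
      simp at hK; linarith
    · exact h
  have rX : (0 : ℝ) < X0 := by exact_mod_cast hX
  have rY : (0 : ℝ) < Y0 := by exact_mod_cast hY
  have rZ : (0 : ℝ) < Z0 := by exact_mod_cast hZ
  have rK : (0 : ℝ) < K := by exact_mod_cast hK0
  have rA : (0 : ℝ) < A := by exact_mod_cast hA
  have rB : (0 : ℝ) < B := by exact_mod_cast hB
  have rC : (0 : ℝ) < C := by exact_mod_cast hC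
  set c : ℝ := K * Y0 / (2 * X0) with hc
  have hc0 : 0 < c := by positivity
  let arc : ι → ℕ := fun i => ⌊((x i : ℝ) / y i) * c⌋₊
  let f : ι → ℕ × ℕ × ℕ × ℕ := fun i => (f1 i, f2 i, f3 i, arc i)
  have hmaps : ∀ i ∈ S, f i ∈ m1.natAbs.divisors ×ˢ (m2.natAbs.divisors ×ˢ
      (m3.natAbs.divisors ×ˢ Finset.range K)) := by
    intro i hi
    simp only [f, Finset.mem_product]
    refine ⟨f1m i hi, f2m i hi, f3m i hi, ?_⟩
    rw [Finset.mem_range, Nat.floor_lt (by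
      have := hx i hi; have := hy i hi
      have h1 : (0 : ℝ) < x i := by exact_mod_cast (by linarith : 0 < x i)
      have h2 : (0 : ℝ) < y i := by exact_mod_cast (by linarith : 0 < y i)
      positivity)]
    have h1 : (x i : ℝ) < 2 * X0 := by exact_mod_cast (hx i hi).2
    have h2 : (Y0 : ℝ) ≤ y i := by exact_mod_cast (hy i hi).1
    have h3 : (0 : ℝ) < y i := rY.trans_le h2
    rw [hc, div_mul_div_comm, div_lt_iff₀ (by positivity)]
    have : (x i : ℝ) * (K * Y0) < (2 * X0) * (K * Y0) := by gcongr
    have : (2 * X0) * (K * Y0) ≤ (K : ℝ) * (y i * (2 * X0)) := by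
      have : (K : ℝ) * (2 * X0) * Y0 ≤ K * (2 * X0) * y i := by gcongr
      linarith
    linarith
  have hfib : ∀ b ∈ m1.natAbs.divisors ×ˢ (m2.natAbs.divisors ×ˢ
      (m3.natAbs.divisors ×ˢ Finset.range K)), (S.filter (fun i => f i = b)).card ≤ 2 := by
    intro b _
    by_contra hcon
    push Not at hcon
    obtain ⟨i, hi, j, hj, k, hk, hij, hik, hjk⟩ := Finset.two_lt_card.mp hcon
    simp only [Finset.mem_filter, f] at hi hj hk
    obtain ⟨hi, ei⟩ := hi
    obtain ⟨hj, ej⟩ := hj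
    obtain ⟨hk, ek⟩ := hk
    have eij := ei.trans ej.symm
    have eik := ei.trans ek.symm
    have ejk := ej.trans ek.symm
    simp only [Prod.mk.injEq] at eij eik ejk
    -- positivity
    have px : ∀ i ∈ S, (0 : ℝ) < x i := fun i hi => by
      have := hx i hi; exact_mod_cast (by linarith : 0 < x i)
    have py : ∀ i ∈ S, (0 : ℝ) < y i := fun i hi => by
      have := hy i hi; exact_mod_cast (by linarith : 0 < y i)
    have pz : ∀ i ∈ S, (0 : ℝ) < z i := fun i hi => by
      have := hz i hi; exact_mod_cast (by linarith : 0 < z i)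
    have hne : ∀ i ∈ S, ∀ j ∈ S, i ≠ j → (x j : ℝ) / y j ≠ x i / y i := by
      intro i hi j hj hij h
      rw [div_eq_div_iff (py j hj).ne' (py i hi).ne'] at h
      have h' : x j * y i = x i * y j := by exact_mod_cast h
      have xi := hx i hi; have xj := hx j hj; have yi := hy i hi; have yj := hy j hj
      have zi := hz i hi; have zj := hz j hj
      obtain ⟨h1, h2⟩ := coprime_ratio _ _ _ _ (by linarith) (by linarith)
        (cxy j hj) (cxy i hi) h'
      apply hij
      refine inj i hi j hj h1.symm h2.symm ?_
      have := heq i hi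
      rw [← h1, ← h2, heq j hj] at this
      have h3 := mul_left_cancel₀ hC.ne' this
      exact ((pow_left_inj₀ (by linarith) (by linarith) two_ne_zero).mp h3).symm
    have hw : ∀ i ∈ S, ((Z0 : ℝ) / (2 * Y0)) ≤ z i / y i := by
      intro i hi
      have h1 : (Z0 : ℝ) ≤ z i := by exact_mod_cast (hz i hi).1
      have h2 : (y i : ℝ) ≤ 2 * Y0 := by exact_mod_cast (hy i hi).2.le
      have := py i hi
      have := pz i hi
      gcongr
    have hcon : ∀ i ∈ S, ((z i : ℝ) / y i) ^ 2 = (A / C : ℝ) * (x i / y i) ^ 2 + B / C := by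
      intro i hi
      have := py i hi
      have h : (A : ℝ) * x i ^ 2 + B * y i ^ 2 = C * z i ^ 2 := by exact_mod_cast heq i hi
      field_simp
      linarith
    have hux : ∀ i ∈ S, (0 : ℝ) < x i / y i := fun i hi => div_pos (px i hi) (py i hi)
    obtain ⟨r1, r2⟩ := conic_area (A / C) (B / C) (x i / y i) (x j / y j) (x k / y k)
      (z i / y i) (z j / y j) (z k / y k) (1 / c) (Z0 / (2 * Y0)) (by positivity) (by positivity)
      (by positivity) (hux i hi) (hux j hj) (hux k hk) (hw i hi) (hw j hj) (hw k hk)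
      (hcon i hi) (hcon j hj) (hcon k hk)
      (arc_close _ _ _ (hux i hi).le (hux j hj).le hc0 eij.2.2.2)
      (arc_close _ _ _ (hux i hi).le (hux k hk).le hc0 eik.2.2.2)
      (arc_close _ _ _ (hux j hj).le (hux k hk).le hc0 ejk.2.2.2)
      (hne i hi j hj hij) (hne i hi k hk hik) (hne j hj k hk hjk)
    set Q : ℝ := ((x j : ℝ) / y j - x i / y i) * (z k / y k - z i / y i) -
      (x k / y k - x i / y i) * (z j / y j - z i / y i) with hQ
    set Dt : ℤ := y i * (x j * z k - x k * z j) - y j * (x i * z k - x k * z i) +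
      y k * (x i * z j - x j * z i) with hDt
    have hDQ : (Dt : ℝ) = y i * y j * y k * Q := by
      have := (py i hi).ne'; have := (py j hj).ne'; have := (py k hk).ne'
      rw [hDt, hQ]
      push_cast
      field_simp
      ring
    have hyyy : (0 : ℝ) < y i * y j * y k := by
      have := (py i hi); have := (py j hj); have := (py k hk); positivity
    have hD0 : Dt ≠ 0 := by
      intro h
      have : (y i * y j * y k * Q : ℝ) = 0 := by rw [← hDQ, h]; simp
      exact (mul_ne_zero hyyy.ne' r1) this
    have dv1 : m1 ∣ Dt := by
      have e1 := f1d i hi j hj eij.1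
      have e2 := f1d i hi k hk eik.1
      have e3 := f1d j hj k hk ejk.1
      have := dvd_add (dvd_sub (e1.mul_right (x k)) (e2.mul_right (x j))) (e3.mul_right (x i))
      refine this.trans (dvd_of_eq ?_)
      rw [hDt]; ring
    have dv2 : m2 ∣ Dt := by
      have e1 := f2d i hi j hj eij.2.1
      have e2 := f2d i hi k hk eik.2.1
      have e3 := f2d j hj k hk ejk.2.1
      have := dvd_add (dvd_sub (e1.mul_right (y k)) (e2.mul_right (y j))) (e3.mul_right (y i))
      refine (dvd_neg.mpr this).trans (dvd_of_eq ?_)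
      rw [hDt]; ring
    have dv3 : m3 ∣ Dt := by
      have e1 := f3d i hi j hj eij.2.2.1
      have e2 := f3d i hi k hk eik.2.2.1
      have e3 := f3d j hj k hk ejk.2.2.1
      have := dvd_add (dvd_sub (e1.mul_right (z k)) (e2.mul_right (z j))) (e3.mul_right (z i))
      refine (dvd_neg.mpr this).trans (dvd_of_eq ?_)
      rw [hDt]; ring
    have dv : m1 * m2 * m3 ∣ Dt :=
      (IsCoprime.mul_left c13 c23).mul_dvd (c12.mul_dvd dv1 dv2) dv3
    have hle : m1 * m2 * m3 ≤ |Dt| := Int.le_of_dvd (abs_pos.mpr hD0) ((dvd_abs _ _).mpr dv)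
    have hs : (A / C : ℝ) ≤ 4 * Z0 ^ 2 / X0 ^ 2 := by
      have h : (A : ℝ) * x i ^ 2 + B * y i ^ 2 = C * z i ^ 2 := by exact_mod_cast heq i hi
      have h1 : (X0 : ℝ) ≤ x i := by exact_mod_cast (hx i hi).1
      have h2 : (z i : ℝ) ≤ 2 * Z0 := by exact_mod_cast (hz i hi).2.le
      have h3 := pz i hi
      rw [div_le_div_iff₀ rC (by positivity)]
      calc (A : ℝ) * X0 ^ 2 ≤ (A : ℝ) * (x i : ℝ) ^ 2 := by gcongr
        _ ≤ (C : ℝ) * (z i : ℝ) ^ 2 := by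
          have : 0 ≤ (B : ℝ) * (y i : ℝ) ^ 2 := by positivity
          linarith
        _ ≤ (C : ℝ) * (2 * (Z0 : ℝ)) ^ 2 := by gcongr
        _ = _ := by ring
    have hup : |(Dt : ℝ)| ≤ 256 * (X0 * Y0 * Z0) / K ^ 3 := by
      rw [hDQ, abs_mul, abs_of_pos hyyy]
      have g1 : (y i : ℝ) ≤ 2 * Y0 := by exact_mod_cast (hy i hi).2.le
      have g2 : (y j : ℝ) ≤ 2 * Y0 := by exact_mod_cast (hy j hj).2.le
      have g3 : (y k : ℝ) ≤ 2 * Y0 := by exact_mod_cast (hy k hk).2.le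
      have := (py i hi); have := (py j hj); have := (py k hk)
      calc (y i * y j * y k : ℝ) * |Q| ≤ ((2 * Y0) * (2 * Y0) * (2 * Y0)) *
            ((4 * Z0 ^ 2 / X0 ^ 2) * (1 / c) ^ 3 / (2 * (Z0 / (2 * Y0)))) := by
            refine mul_le_mul (by gcongr) (r2.trans (by gcongr)) (abs_nonneg _) (by positivity)
        _ = _ := by rw [hc]; field_simp; ring
    have h1 : ((m1 * m2 * m3 : ℤ) : ℝ) ≤ |(Dt : ℝ)| := by exact_mod_cast hle
    have h2 : (256 * (X0 * Y0 * Z0) : ℝ) < (K : ℝ) ^ 3 * ((m1 * m2 * m3 : ℤ) : ℝ) := by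
      exact_mod_cast hK
    have h3 := h1.trans hup
    rw [le_div_iff₀ (by positivity)] at h3
    linarith
  have := Finset.card_le_mul_card_image_of_maps_to (s := S) hmaps 2 hfib
  simpa [Finset.card_product] using this

lemma linear_count {ι : Type*} (S : Finset ι) (d1 d2 d3 : ι → ℤ)
    (b1 b2 b3 e1 e2 e3 D1 D2 : ℤ) (K : ℕ) (hK0 : 0 < K)
    (hb3 : 0 < b3) (he1 : 0 < e1) (he1' : e1 ≤ 2) (he3 : 0 < e3)
    (hD1 : 0 < D1) (hD2 : 0 < D2) (hcop : IsCoprime b1 b3)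
    (h1 : ∀ i ∈ S, D1 ≤ d1 i ∧ d1 i < 2 * D1) (h2 : ∀ i ∈ S, D2 ≤ d2 i ∧ d2 i < 2 * D2)
    (heq : ∀ i ∈ S, e1 * d1 i * b1 ^ 2 + e2 * d2 i * b2 ^ 2 = e3 * d3 i * b3 ^ 2)
    (c12 : ∀ i ∈ S, IsCoprime (d1 i) (d2 i))
    (inj : ∀ i ∈ S, ∀ j ∈ S, d1 i = d1 j → d2 i = d2 j → d3 i = d3 j → i = j)
    (hK : 16 * (D1 * D2) ≤ K * b3 ^ 2) : S.card ≤ K := by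
  classical
  have rX : (0 : ℝ) < D1 := by exact_mod_cast hD1
  have rY : (0 : ℝ) < D2 := by exact_mod_cast hD2
  have rK : (0 : ℝ) < K := by exact_mod_cast hK0
  set c : ℝ := K * D2 / (2 * D1) with hc
  have hc0 : 0 < c := by positivity
  have px : ∀ i ∈ S, (0 : ℝ) < d1 i := fun i hi => by
    have := h1 i hi; exact_mod_cast (by linarith : 0 < d1 i)
  have py : ∀ i ∈ S, (0 : ℝ) < d2 i := fun i hi => by
    have := h2 i hi; exact_mod_cast (by linarith : 0 < d2 i)
  let arc : ι → ℕ := fun i => ⌊((d1 i : ℝ) / d2 i) * c⌋₊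
  have hmaps : ∀ i ∈ S, arc i ∈ Finset.range K := by
    intro i hi
    have h3 := px i hi
    have h4 := py i hi
    simp only [arc]
    rw [Finset.mem_range, Nat.floor_lt (by positivity)]
    have h1 : (d1 i : ℝ) < 2 * D1 := by exact_mod_cast (h1 i hi).2
    have h2 : (D2 : ℝ) ≤ d2 i := by exact_mod_cast (h2 i hi).1
    rw [hc, div_mul_div_comm, div_lt_iff₀ (by positivity)]
    have : (d1 i : ℝ) * (K * D2) < (2 * D1) * (K * D2) := by gcongr
    have : (2 * D1) * (K * D2) ≤ (K : ℝ) * (d2 i * (2 * D1)) := by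
      have : (K : ℝ) * (2 * D1) * D2 ≤ K * (2 * D1) * d2 i := by gcongr
      linarith
    linarith
  have hinj : Set.InjOn arc S := by
    intro i hi j hj hij
    simp only [Finset.mem_coe] at hi hj
    by_contra hne
    have hclose := arc_close _ _ _ (div_pos (px i hi) (py i hi)).le
      (div_pos (px j hj) (py j hj)).le hc0 hij
    set Q : ℤ := d1 j * d2 i - d1 i * d2 j with hQ
    have i1 := h1 i hi; have i2 := h2 i hi; have j1 := h1 j hj; have j2 := h2 j hj
    have hQ0 : Q ≠ 0 := by
      intro h
      have h' : d1 j * d2 i = d1 i * d2 j := by linarith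
      obtain ⟨g1, g2⟩ := coprime_ratio _ _ _ _ (by linarith) (by linarith) (c12 j hj) (c12 i hi) h'
      apply hne
      refine inj i hi j hj g1.symm g2.symm ?_
      have e := heq j hj
      rw [g1, g2, heq i hi] at e
      have e' := mul_right_cancel₀ (pow_ne_zero 2 hb3.ne') e
      exact mul_left_cancel₀ he3.ne' e'
    have hdv : b3 ^ 2 ∣ b1 ^ 2 * (e1 * Q) := by
      refine ⟨e3 * (d3 j * d2 i - d3 i * d2 j), ?_⟩
      rw [hQ]
      linear_combination (d2 i) * heq j hj - (d2 j) * heq i hi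
    have hdv2 : b3 ^ 2 ∣ e1 * Q := (hcop.symm.pow (m := 2) (n := 2)).dvd_of_dvd_mul_left hdv
    have hle : b3 ^ 2 ≤ |e1 * Q| := Int.le_of_dvd (abs_pos.mpr (mul_ne_zero he1.ne' hQ0))
      ((dvd_abs _ _).mpr hdv2)
    rw [abs_mul, abs_of_pos he1] at hle
    have hle2 : b3 ^ 2 ≤ 2 * |Q| := hle.trans (by gcongr)
    have hQr : |(Q : ℝ)| = d2 i * d2 j * |(d1 j : ℝ) / d2 j - d1 i / d2 i| := by
      have a1 := py i hi
      have a2 := py j hj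
      rw [← abs_of_pos (mul_pos a1 a2), ← abs_mul, hQ]
      congr 1
      push_cast
      field_simp
    have a1 := py i hi
    have a2 := py j hj
    have hup : |(Q : ℝ)| < 8 * (D1 * D2) / K := by
      rw [hQr]
      have g1 : (d2 i : ℝ) < 2 * D2 := by exact_mod_cast i2.2
      have g2 : (d2 j : ℝ) < 2 * D2 := by exact_mod_cast j2.2
      calc (d2 i * d2 j * |(d1 j : ℝ) / d2 j - d1 i / d2 i| : ℝ) ≤ d2 i * d2 j * (1 / c) := by gcongr
        _ < ((2 * D2) * (2 * D2)) * (1 / c) := by gcongr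
        _ = _ := by rw [hc]; field_simp; ring
    rw [lt_div_iff₀ rK] at hup
    have q1 : ((b3 : ℝ)) ^ 2 ≤ 2 * |(Q : ℝ)| := by exact_mod_cast hle2
    have q2 : 16 * ((D1 : ℝ) * D2) ≤ K * (b3 : ℝ) ^ 2 := by exact_mod_cast hK
    have q3 : K * (b3 : ℝ) ^ 2 ≤ K * (2 * |(Q : ℝ)|) := by gcongr
    linarith
  have := Finset.card_le_card_of_injOn arc hmaps hinj
  simpa using this

lemma odd_part (d : ℤ) (hd : 0 < d) (hs : Squarefree d) :
    ∃ m : ℤ, 0 < m ∧ m ∣ d ∧ d ≤ 2 * m ∧ IsCoprime 2 m := by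
  rcases Int.even_or_odd' d with ⟨k, hk | hk⟩
  · refine ⟨k, by linarith, ⟨2, by linarith⟩, by linarith, ?_⟩
    rw [hk] at hs
    exact (squarefree_mul_iff.mp hs).1.isCoprime
  · exact ⟨d, hd, dvd_rfl, by linarith, ⟨-k, 1, by rw [hk]; ring⟩⟩

/-- Common hypotheses for the ternary counting lemma. -/
structure Tri (e1 e2 e3 : ℤ) (D1 D2 D3 B1 B2 B3 T : ℕ) (d1 d2 d3 b1 b2 b3 : ℤ) : Prop where
  hd1 : (D1 : ℤ) ≤ d1 ∧ d1 < 2 * D1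
  hd2 : (D2 : ℤ) ≤ d2 ∧ d2 < 2 * D2
  hd3 : (D3 : ℤ) ≤ d3 ∧ d3 < 2 * D3
  hb1 : (B1 : ℤ) ≤ b1 ∧ b1 < 2 * B1
  hb2 : (B2 : ℤ) ≤ b2 ∧ b2 < 2 * B2
  hb3 : (B3 : ℤ) ≤ b3 ∧ b3 < 2 * B3
  heq : e1 * d1 * b1 ^ 2 + e2 * d2 * b2 ^ 2 = e3 * d3 * b3 ^ 2
  s1 : Squarefree d1
  s2 : Squarefree d2
  s3 : Squarefree d3
  c12 : IsCoprime d1 d2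
  c13 : IsCoprime d1 d3
  c23 : IsCoprime d2 d3
  k12 : IsCoprime b1 b2
  k13 : IsCoprime b1 b3
  k23 : IsCoprime b2 b3
  t1 : d1.natAbs.divisors.card ≤ T
  t2 : d2.natAbs.divisors.card ≤ T
  t3 : d3.natAbs.divisors.card ≤ T

lemma card_divisors_mono {m d : ℤ} (h : m ∣ d) (hd : d ≠ 0) :
    m.natAbs.divisors.card ≤ d.natAbs.divisors.card :=
  Finset.card_le_card (Nat.divisors_subset_of_dvd (by simpa using hd) (Int.natAbs_dvd_natAbs.mpr h))

lemma box_conic {ι : Type*} (S : Finset ι) (d1 d2 d3 b1 b2 b3 : ι → ℤ) (e1 e2 e3 : ℤ)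
    (D1 D2 D3 B1 B2 B3 T K : ℕ) (he1 : e1 = 1 ∨ e1 = 2) (he2 : e2 = 1 ∨ e2 = 2)
    (he3 : e3 = 1 ∨ e3 = 2) (hD1 : 0 < D1) (hD2 : 0 < D2) (hD3 : 0 < D3)
    (hB1 : 0 < B1) (hB2 : 0 < B2) (hB3 : 0 < B3)
    (hS : ∀ i ∈ S, Tri e1 e2 e3 D1 D2 D3 B1 B2 B3 T (d1 i) (d2 i) (d3 i) (b1 i) (b2 i) (b3 i))
    (inj : ∀ i ∈ S, ∀ j ∈ S, d1 i = d1 j → d2 i = d2 j → d3 i = d3 j →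
      b1 i = b1 j → b2 i = b2 j → b3 i = b3 j → i = j)
    (hK : 2048 * (B1 * B2 * B3) < K ^ 3 * (D1 * D2 * D3)) :
    S.card ≤ 2 * (T * (T * (T * K))) * (D1 * D2 * D3) := by
  classical
  let f : ι → ℤ × ℤ × ℤ := fun i => (d1 i, d2 i, d3 i)
  have hmaps : ∀ i ∈ S, f i ∈ Finset.Ico (D1 : ℤ) (2 * D1) ×ˢ (Finset.Ico (D2 : ℤ) (2 * D2) ×ˢ
      Finset.Ico (D3 : ℤ) (2 * D3)) := by
    intro i hi
    have := hS i hi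
    simp only [f, Finset.mem_product, Finset.mem_Ico]
    exact ⟨this.hd1, this.hd2, this.hd3⟩
  have hfib : ∀ b ∈ Finset.Ico (D1 : ℤ) (2 * D1) ×ˢ (Finset.Ico (D2 : ℤ) (2 * D2) ×ˢ
      Finset.Ico (D3 : ℤ) (2 * D3)), (S.filter (fun i => f i = b)).card ≤
        2 * (T * (T * (T * K))) := by
    rintro ⟨δ1, δ2, δ3⟩ _
    rcases (S.filter (fun i => f i = (δ1, δ2, δ3))).eq_empty_or_nonempty with h0 | ⟨o, ho⟩
    · rw [h0]; simp
    have hf : ∀ i ∈ S.filter (fun i => f i = (δ1, δ2, δ3)), i ∈ S ∧ d1 i = δ1 ∧ d2 i = δ2 ∧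
        d3 i = δ3 := by
      intro i hi
      simpa [f] using hi
    obtain ⟨o1, o2, o3, o4⟩ := hf o ho
    have W := hS o o1
    rw [o2, o3, o4] at W
    have hD1' : (0 : ℤ) < D1 := by exact_mod_cast hD1
    have hD2' : (0 : ℤ) < D2 := by exact_mod_cast hD2
    have hD3' : (0 : ℤ) < D3 := by exact_mod_cast hD3
    have q1 : 0 < δ1 := by linarith [W.hd1.1]
    have q2 : 0 < δ2 := by linarith [W.hd2.1]
    have q3 : 0 < δ3 := by linarith [W.hd3.1]
    obtain ⟨m1, m1p, m1d, m1l, m1o⟩ := odd_part δ1 q1 W.s1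
    obtain ⟨m2, m2p, m2d, m2l, m2o⟩ := odd_part δ2 q2 W.s2
    obtain ⟨m3, m3p, m3d, m3l, m3o⟩ := odd_part δ3 q3 W.s3
    have ecop : ∀ e m : ℤ, e = 1 ∨ e = 2 → IsCoprime 2 m → IsCoprime e m := by
      rintro e m (rfl | rfl) h
      · exact isCoprime_one_left
      · exact h
    have epos : ∀ e : ℤ, e = 1 ∨ e = 2 → 0 < e := by rintro e (rfl | rfl) <;> norm_num
    have main := conic_count_s4 (S.filter (fun i => f i = (δ1, δ2, δ3))) b1 b2 b3
      (e1 * δ1) (e2 * δ2) (e3 * δ3) m1 m2 m3 B1 B2 B3 K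
      (mul_pos (epos _ he1) q1) (mul_pos (epos _ he2) q2) (mul_pos (epos _ he3) q3)
      (by exact_mod_cast hB1) (by exact_mod_cast hB2) (by exact_mod_cast hB3)
      (W.s1.squarefree_of_dvd m1d) (W.s2.squarefree_of_dvd m2d) (W.s3.squarefree_of_dvd m3d)
      (m1d.mul_left _) (m2d.mul_left _) (m3d.mul_left _)
      (IsCoprime.mul_left (ecop _ _ he3 m1o) (W.c13.symm.of_isCoprime_of_dvd_right m1d))
      (IsCoprime.mul_left (ecop _ _ he3 m2o) (W.c23.symm.of_isCoprime_of_dvd_right m2d))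
      (IsCoprime.mul_left (ecop _ _ he1 m3o) (W.c13.of_isCoprime_of_dvd_right m3d))
      ((W.c12.of_isCoprime_of_dvd_right m2d).of_isCoprime_of_dvd_left m1d)
      ((W.c13.of_isCoprime_of_dvd_right m3d).of_isCoprime_of_dvd_left m1d)
      ((W.c23.of_isCoprime_of_dvd_right m3d).of_isCoprime_of_dvd_left m2d)
      (fun i hi => (hS i (hf i hi).1).hb1) (fun i hi => (hS i (hf i hi).1).hb2)
      (fun i hi => (hS i (hf i hi).1).hb3)
      (fun i hi => by
        have := (hS i (hf i hi).1).heq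
        rwa [(hf i hi).2.1, (hf i hi).2.2.1, (hf i hi).2.2.2] at this)
      (fun i hi => (hS i (hf i hi).1).k12) (fun i hi => (hS i (hf i hi).1).k13)
      (fun i hi => (hS i (hf i hi).1).k23)
      (fun i hi j hj u v w => by
        obtain ⟨i1, i2, i3, i4⟩ := hf i hi
        obtain ⟨j1, j2, j3, j4⟩ := hf j hj
        exact inj i i1 j j1 (i2.trans j2.symm) (i3.trans j3.symm) (i4.trans j4.symm) u v w)
      (by
        have h1 : (2048 * (B1 * B2 * B3) : ℤ) < K ^ 3 * (D1 * D2 * D3) := by exact_mod_cast hK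
        have h2 : (D1 * D2 * D3 : ℤ) ≤ (2 * m1) * (2 * m2) * (2 * m3) := by
          have := W.hd1.1.trans m1l; have := W.hd2.1.trans m2l; have := W.hd3.1.trans m3l
          gcongr
        have h3 : (K ^ 3 * (D1 * D2 * D3) : ℤ) ≤ K ^ 3 * ((2 * m1) * (2 * m2) * (2 * m3)) := by
          gcongr
        linarith)
    refine main.trans ?_
    have t1 := (card_divisors_mono m1d q1.ne').trans W.t1
    have t2 := (card_divisors_mono m2d q2.ne').trans W.t2
    have t3 := (card_divisors_mono m3d q3.ne').trans W.t3
    gcongr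
  have := Finset.card_le_mul_card_image_of_maps_to (s := S) hmaps _ hfib
  refine this.trans (le_of_eq ?_)
  simp only [Finset.card_product, Int.card_Ico]
  have : ∀ D : ℕ, (2 * (D : ℤ) - D).toNat = D := by intro D; omega
  rw [this, this, this, mul_assoc D1]

lemma box_linear {ι : Type*} (S : Finset ι) (d1 d2 d3 b1 b2 b3 : ι → ℤ) (e1 e2 e3 : ℤ)
    (D1 D2 D3 B1 B2 B3 T K : ℕ) (he1 : e1 = 1 ∨ e1 = 2)
    (he3 : e3 = 1 ∨ e3 = 2) (hD1 : 0 < D1) (hD2 : 0 < D2)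
    (hB3 : 0 < B3) (hK0 : 0 < K)
    (hS : ∀ i ∈ S, Tri e1 e2 e3 D1 D2 D3 B1 B2 B3 T (d1 i) (d2 i) (d3 i) (b1 i) (b2 i) (b3 i))
    (inj : ∀ i ∈ S, ∀ j ∈ S, d1 i = d1 j → d2 i = d2 j → d3 i = d3 j →
      b1 i = b1 j → b2 i = b2 j → b3 i = b3 j → i = j)
    (hK : 16 * (D1 * D2) ≤ K * B3 ^ 2) :
    S.card ≤ K * (B1 * B2 * B3) := by
  classical
  let f : ι → ℤ × ℤ × ℤ := fun i => (b1 i, b2 i, b3 i)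
  have hmaps : ∀ i ∈ S, f i ∈ Finset.Ico (B1 : ℤ) (2 * B1) ×ˢ (Finset.Ico (B2 : ℤ) (2 * B2) ×ˢ
      Finset.Ico (B3 : ℤ) (2 * B3)) := by
    intro i hi
    have := hS i hi
    simp only [f, Finset.mem_product, Finset.mem_Ico]
    exact ⟨this.hb1, this.hb2, this.hb3⟩
  have hfib : ∀ b ∈ Finset.Ico (B1 : ℤ) (2 * B1) ×ˢ (Finset.Ico (B2 : ℤ) (2 * B2) ×ˢ
      Finset.Ico (B3 : ℤ) (2 * B3)), (S.filter (fun i => f i = b)).card ≤ K := by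
    rintro ⟨δ1, δ2, δ3⟩ _
    rcases (S.filter (fun i => f i = (δ1, δ2, δ3))).eq_empty_or_nonempty with h0 | ⟨o, ho⟩
    · rw [h0]; simp
    have hf : ∀ i ∈ S.filter (fun i => f i = (δ1, δ2, δ3)), i ∈ S ∧ b1 i = δ1 ∧ b2 i = δ2 ∧
        b3 i = δ3 := by
      intro i hi
      simpa [f] using hi
    obtain ⟨o1, o2, o3, o4⟩ := hf o ho
    have W := hS o o1
    rw [o2, o3, o4] at W
    have hB3' : (0 : ℤ) < B3 := by exact_mod_cast hB3
    have q3 : 0 < δ3 := by linarith [W.hb3.1]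
    exact linear_count (S.filter (fun i => f i = (δ1, δ2, δ3))) d1 d2 d3 δ1 δ2 δ3 e1 e2 e3 D1 D2 K
      hK0 q3 (by rcases he1 with rfl | rfl <;> norm_num) (by rcases he1 with rfl | rfl <;> norm_num)
      (by rcases he3 with rfl | rfl <;> norm_num) (by exact_mod_cast hD1) (by exact_mod_cast hD2)
      W.k13
      (fun i hi => (hS i (hf i hi).1).hd1) (fun i hi => (hS i (hf i hi).1).hd2)
      (fun i hi => by
        have := (hS i (hf i hi).1).heq
        rwa [(hf i hi).2.1, (hf i hi).2.2.1, (hf i hi).2.2.2] at this)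
      (fun i hi => (hS i (hf i hi).1).c12)
      (fun i hi j hj u v w => by
        obtain ⟨i1, i2, i3, i4⟩ := hf i hi
        obtain ⟨j1, j2, j3, j4⟩ := hf j hj
        exact inj i i1 j j1 u v w (i2.trans j2.symm) (i3.trans j3.symm) (i4.trans j4.symm))
      (by
        have h1 : (16 * (D1 * D2) : ℤ) ≤ K * B3 ^ 2 := by exact_mod_cast hK
        have h2 := W.hb3.1
        refine h1.trans ?_
        gcongr)
  have := Finset.card_le_mul_card_image_of_maps_to (s := S) hmaps _ hfib
  refine this.trans (le_of_eq ?_)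
  simp only [Finset.card_product, Int.card_Ico]
  have : ∀ D : ℕ, (2 * (D : ℤ) - D).toNat = D := by intro D; omega
  rw [this, this, this, mul_assoc B1]

lemma cube_add_one (a : ℝ) (ha : 0 ≤ a) : (a + 1) ^ 3 ≤ 4 * (a ^ 3 + 1) := by
  have h := mul_nonneg (show 0 ≤ a + 1 by positivity) (sq_nonneg (a - 1))
  have e : 4 * (a ^ 3 + 1) - (a + 1) ^ 3 = 3 * ((a + 1) * (a - 1) ^ 2) := by ring
  linarith

lemma box_count {ι : Type*} (S : Finset ι) (d1 d2 d3 b1 b2 b3 : ι → ℤ) (e1 e2 e3 : ℤ)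
    (D1 D2 D3 B1 B2 B3 T : ℕ) (he1 : e1 = 1 ∨ e1 = 2) (he2 : e2 = 1 ∨ e2 = 2)
    (he3 : e3 = 1 ∨ e3 = 2) (hD1 : 0 < D1) (hD2 : 0 < D2) (hD3 : 0 < D3)
    (hB1 : 0 < B1) (hB2 : 0 < B2) (hB3 : 0 < B3) (hT : 0 < T)
    (hS : ∀ i ∈ S, Tri e1 e2 e3 D1 D2 D3 B1 B2 B3 T (d1 i) (d2 i) (d3 i) (b1 i) (b2 i) (b3 i))
    (inj : ∀ i ∈ S, ∀ j ∈ S, d1 i = d1 j → d2 i = d2 j → d3 i = d3 j →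
      b1 i = b1 j → b2 i = b2 j → b3 i = b3 j → i = j) :
    (S.card : ℝ) ^ 3 ≤ 2 ^ 23 * (T : ℝ) ^ 9 * ((D1 * D2 * D3 : ℝ) ^ 2 * (B1 * B2 * B3)) := by
  rcases S.eq_empty_or_nonempty with h0 | ⟨o, ho⟩
  · rw [h0]; simp; positivity
  have W := hS o ho
  have rD1 : (0 : ℝ) < D1 := by exact_mod_cast hD1
  have rD2 : (0 : ℝ) < D2 := by exact_mod_cast hD2
  have rD3 : (0 : ℝ) < D3 := by exact_mod_cast hD3
  have rB1 : (0 : ℝ) < B1 := by exact_mod_cast hB1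
  have rB2 : (0 : ℝ) < B2 := by exact_mod_cast hB2
  have rB3 : (0 : ℝ) < B3 := by exact_mod_cast hB3
  have rT : (1 : ℝ) ≤ T := by exact_mod_cast hT
  set D : ℝ := D1 * D2 * D3 with hD
  set B : ℝ := B1 * B2 * B3 with hB
  have pD : 0 < D := by positivity
  have pB : 0 < B := by positivity
  rcases le_total D B with hDB | hDB
  · set r : ℝ := (2048 * (B / D)) ^ ((1 : ℝ) / 3) with hr
    have r3 : r ^ 3 = 2048 * (B / D) := by
      rw [hr, ← Real.rpow_natCast, ← Real.rpow_mul (by positivity)]; norm_num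
    have hBD : 1 ≤ B / D := by rwa [le_div_iff₀ pD, one_mul]
    have r1 : 1 ≤ r := Real.one_le_rpow (by linarith) (by norm_num)
    set K : ℕ := ⌊r⌋₊ + 1 with hK
    have Kl : r < K := by rw [hK]; push_cast; exact Nat.lt_floor_add_one r
    have Ku : (K : ℝ) ≤ 2 * r := by
      rw [hK]; push_cast; linarith [Nat.floor_le (zero_le_one.trans r1)]
    have hKK : 2048 * (B1 * B2 * B3) < K ^ 3 * (D1 * D2 * D3) := by
      have h1 : r ^ 3 < (K : ℝ) ^ 3 := by gcongr
      rw [r3] at h1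
      have h2 : 2048 * B < (K : ℝ) ^ 3 * D := by
        have := mul_lt_mul_of_pos_right h1 pD
        rwa [mul_assoc, div_mul_cancel₀ _ pD.ne'] at this
      rw [hB, hD] at h2
      exact_mod_cast h2
    have main := box_conic S d1 d2 d3 b1 b2 b3 e1 e2 e3 D1 D2 D3 B1 B2 B3 T K he1 he2 he3 hD1 hD2
      hD3 hB1 hB2 hB3 hS inj hKK
    have main' : (S.card : ℝ) ≤ 2 * (T * (T * (T * K))) * D := by
      rw [hD]; exact_mod_cast main
    calc (S.card : ℝ) ^ 3 ≤ (2 * (T * (T * (T * K))) * D) ^ 3 := by gcongr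
      _ = 8 * T ^ 9 * D ^ 3 * (K : ℝ) ^ 3 := by ring
      _ ≤ 8 * T ^ 9 * D ^ 3 * (2 * r) ^ 3 := by gcongr
      _ = 2 ^ 17 * (T : ℝ) ^ 9 * (D ^ 2 * B) := by
        rw [mul_pow 2 r, r3]; field_simp; norm_num
      _ ≤ _ := by gcongr <;> norm_num
  · set r : ℝ := D1 * D2 / B3 ^ 2 with hr
    have r0 : 0 < r := by positivity
    set K : ℕ := ⌊16 * r⌋₊ + 1 with hK
    have Kl : 16 * r < K := by rw [hK]; push_cast; exact Nat.lt_floor_add_one _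
    have Ku : (K : ℝ) ≤ 16 * r + 1 := by
      rw [hK]; push_cast; linarith [Nat.floor_le (show 0 ≤ 16 * r by positivity)]
    have hKK : 16 * (D1 * D2) ≤ K * B3 ^ 2 := by
      have := mul_lt_mul_of_pos_right Kl (show (0 : ℝ) < B3 ^ 2 by positivity)
      rw [hr, mul_assoc, div_mul_cancel₀ _ (by positivity)] at this
      exact_mod_cast this.le
    have main := box_linear S d1 d2 d3 b1 b2 b3 e1 e2 e3 D1 D2 D3 B1 B2 B3 T K he1 he3 hD1 hD2
      hB3 (by omega) hS inj hKK
    have main' : (S.card : ℝ) ≤ K * B := by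
      rw [hB]; exact_mod_cast main
    -- size comparison
    have hd1 : (D1 : ℝ) ≤ d1 o := by exact_mod_cast W.hd1.1
    have hd2 : (D2 : ℝ) ≤ d2 o := by exact_mod_cast W.hd2.1
    have hd3 : (D3 : ℝ) ≤ d3 o := by exact_mod_cast W.hd3.1
    have hd3' : (d3 o : ℝ) ≤ 2 * D3 := by exact_mod_cast W.hd3.2.le
    have hb1 : (B1 : ℝ) ≤ b1 o := by exact_mod_cast W.hb1.1
    have hb2 : (B2 : ℝ) ≤ b2 o := by exact_mod_cast W.hb2.1
    have hb3 : (B3 : ℝ) ≤ b3 o := by exact_mod_cast W.hb3.1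
    have hb3' : (b3 o : ℝ) ≤ 2 * B3 := by exact_mod_cast W.hb3.2.le
    have heq : (e1 : ℝ) * d1 o * b1 o ^ 2 + e2 * d2 o * b2 o ^ 2 = e3 * d3 o * b3 o ^ 2 := by
      exact_mod_cast W.heq
    have f1 : (1 : ℝ) ≤ e1 := by rcases he1 with h | h <;> rw [h] <;> norm_num
    have f2 : (1 : ℝ) ≤ e2 := by rcases he2 with h | h <;> rw [h] <;> norm_num
    have f3 : (e3 : ℝ) ≤ 2 := by rcases he3 with h | h <;> rw [h] <;> norm_num
    have f3' : (0 : ℝ) ≤ e3 := by rcases he3 with h | h <;> rw [h] <;> norm_num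
    have pd1 := rD1.trans_le hd1
    have pd2 := rD2.trans_le hd2
    have pd3 := rD3.trans_le hd3
    have pb1 := rB1.trans_le hb1
    have pb2 := rB2.trans_le hb2
    have pb3 := rB3.trans_le hb3
    have g1 : 1 * (D1 : ℝ) * B1 ^ 2 ≤ e1 * d1 o * b1 o ^ 2 := by gcongr
    have g2 : 1 * (D2 : ℝ) * B2 ^ 2 ≤ e2 * d2 o * b2 o ^ 2 := by gcongr
    have g3 : (e3 : ℝ) * d3 o * b3 o ^ 2 ≤ 2 * (2 * D3) * (2 * B3) ^ 2 := by gcongr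
    have g1' : 0 < 1 * (D1 : ℝ) * B1 ^ 2 := by positivity
    have g2' : 0 < 1 * (D2 : ℝ) * B2 ^ 2 := by positivity
    set M : ℝ := D3 * B3 ^ 2 with hM
    have pM : 0 < M := by positivity
    have l1 : (D1 : ℝ) * B1 ^ 2 ≤ 16 * M := by rw [hM]; linarith
    have l2 : (D2 : ℝ) * B2 ^ 2 ≤ 16 * M := by rw [hM]; linarith
    have l3 : D * B ^ 2 ≤ 256 * M ^ 3 := by
      calc D * B ^ 2 = ((D1 : ℝ) * B1 ^ 2) * ((D2 : ℝ) * B2 ^ 2) * M := by rw [hD, hB, hM]; ring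
        _ ≤ (16 * M) * (16 * M) * M := by gcongr
        _ = _ := by ring
    have l4 : r * M = D := by rw [hr, hM, hD]; field_simp
    have l5 : r ^ 3 * B ^ 2 ≤ 256 * D ^ 2 := by
      have h1 : r ^ 3 * M ^ 3 = D ^ 3 := by rw [← mul_pow, l4]
      have h2 : r ^ 3 * (D * B ^ 2) ≤ r ^ 3 * (256 * M ^ 3) := by gcongr
      have h3 : (r ^ 3 * B ^ 2) * D ≤ (256 * D ^ 2) * D := by
        calc _ = r ^ 3 * (D * B ^ 2) := by ring
          _ ≤ _ := h2
          _ = 256 * (r ^ 3 * M ^ 3) := by ring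
          _ = _ := by rw [h1]; ring
      exact le_of_mul_le_mul_right h3 pD
    have l6 : (16 * r + 1) ^ 3 ≤ 4 * ((16 * r) ^ 3 + 1) := cube_add_one _ (by positivity)
    have l7 : B ^ 2 ≤ D ^ 2 := by gcongr
    calc (S.card : ℝ) ^ 3 ≤ (K * B) ^ 3 := by gcongr
      _ ≤ ((16 * r + 1) * B) ^ 3 := by gcongr
      _ = (16 * r + 1) ^ 3 * B ^ 3 := by ring
      _ ≤ (4 * ((16 * r) ^ 3 + 1)) * B ^ 3 := by gcongr
      _ = (16384 * (r ^ 3 * B ^ 2) + 4 * B ^ 2) * B := by ring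
      _ ≤ (16384 * (256 * D ^ 2) + 4 * D ^ 2) * B := by gcongr
      _ ≤ 2 ^ 23 * 1 * (D ^ 2 * B) := by
        have : 0 < D ^ 2 * B := by positivity
        linarith
      _ ≤ _ := by
        gcongr
        exact one_le_pow₀ rT

lemma divisor_bound (δ : ℝ) (hδ : 0 < δ) :
    ∃ C : ℝ, 1 ≤ C ∧ ∀ n : ℕ, Squarefree n → (n.divisors.card : ℝ) ≤ C * (n : ℝ) ^ δ := by
  obtain ⟨P, hP⟩ := exists_nat_ge ((2 : ℝ) ^ (1 / δ))
  refine ⟨2 ^ P, one_le_pow₀ (by norm_num), ?_⟩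
  intro n hn
  have hn0 : n ≠ 0 := hn.ne_zero
  have h1 : n.divisors.card ≤ ∏ p ∈ n.primeFactors, 2 := by
    rw [Nat.card_divisors hn0]
    refine Finset.prod_le_prod' ?_
    intro p hp
    have := hn.natFactorization_le_one p
    omega
  have h2 : (n : ℝ) ^ δ = ∏ p ∈ n.primeFactors, (p : ℝ) ^ δ := by
    conv_lhs => rw [← Nat.prod_primeFactors_of_squarefree hn]
    push_cast
    rw [Real.finsetProd_rpow]
    intro i _
    positivity
  have h3 : (∏ p ∈ n.primeFactors, (2 : ℝ)) ≤
      ∏ p ∈ n.primeFactors, ((if p < P then (2 : ℝ) else 1) * (p : ℝ) ^ δ) := by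
    refine Finset.prod_le_prod (fun _ _ => by norm_num) ?_
    intro p hp
    have hp1 : (1 : ℝ) ≤ p := by exact_mod_cast (Nat.prime_of_mem_primeFactors hp).one_lt.le
    split_ifs with h
    · have := Real.one_le_rpow hp1 hδ.le
      linarith
    · push Not at h
      have h4 : (2 : ℝ) ^ (1 / δ) ≤ p := hP.trans (by exact_mod_cast h)
      have h5 : ((2 : ℝ) ^ (1 / δ)) ^ δ ≤ (p : ℝ) ^ δ := by gcongr
      rw [← Real.rpow_mul (by norm_num), one_div_mul_cancel hδ.ne', Real.rpow_one] at h5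
      linarith
  rw [Finset.prod_mul_distrib, ← h2] at h3
  have h4 : (∏ p ∈ n.primeFactors, (if p < P then (2 : ℝ) else 1)) ≤ 2 ^ P := by
    rw [Finset.prod_ite, Finset.prod_const, Finset.prod_const_one, mul_one]
    refine pow_le_pow_right₀ (by norm_num) ?_
    calc _ ≤ (Finset.range P).card := Finset.card_le_card (by
          intro p hp
          simp only [Finset.mem_filter] at hp
          simpa using hp.2)
      _ = P := by simp
  calc (n.divisors.card : ℝ) ≤ ∏ p ∈ n.primeFactors, (2 : ℝ) := by exact_mod_cast h1
    _ ≤ _ := h3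
    _ ≤ _ := by gcongr

lemma sf_inj (d b d' b' : ℤ) (hd : 0 < d) (hb : 0 < b) (hd' : 0 < d') (hb' : 0 < b')
    (s : Squarefree d) (s' : Squarefree d') (h : d * b ^ 2 = d' * b' ^ 2) : d = d' ∧ b = b' := by
  have hg : 0 < Int.gcd b b' := Int.gcd_pos_of_ne_zero_left _ hb.ne'
  obtain ⟨g, u, v, g0, huv, rfl, rfl⟩ := Int.exists_gcd_one' hg
  have g0' : (0 : ℤ) < g := by exact_mod_cast g0
  have hu : 0 < u := by by_contra hc; nlinarith
  have hv : 0 < v := by by_contra hc; nlinarith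
  have e : d * u ^ 2 = d' * v ^ 2 := by
    have : (g : ℤ) ^ 2 * (d * u ^ 2) = g ^ 2 * (d' * v ^ 2) := by linear_combination h
    exact mul_left_cancel₀ (pow_ne_zero 2 g0'.ne') this
  have huv' : IsCoprime u v := Int.isCoprime_iff_gcd_eq_one.mpr huv
  have h1 : u ^ 2 ∣ d' := (huv'.pow (m := 2) (n := 2)).dvd_of_dvd_mul_right ⟨d, by linarith⟩
  have h2 : v ^ 2 ∣ d := (huv'.symm.pow (m := 2) (n := 2)).dvd_of_dvd_mul_right ⟨d', by linarith⟩
  have u1 : u = 1 := by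
    have := s' u (by rwa [sq] at h1)
    rcases Int.isUnit_iff.mp this with h | h <;> linarith
  have v1 : v = 1 := by
    have := s v (by rwa [sq] at h2)
    rcases Int.isUnit_iff.mp this with h | h <;> linarith
  subst u1 v1
  exact ⟨by linarith, rfl⟩

/-- The system for `ν = 1`, in a dyadic box. -/
structure Quad (D1 D2 D3 D4 B1 B2 B3 B4 T : ℕ) (d1 d2 d3 d4 b1 b2 b3 b4 : ℤ) : Prop where
  hd1 : (D1 : ℤ) ≤ d1 ∧ d1 < 2 * D1
  hd2 : (D2 : ℤ) ≤ d2 ∧ d2 < 2 * D2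
  hd3 : (D3 : ℤ) ≤ d3 ∧ d3 < 2 * D3
  hd4 : (D4 : ℤ) ≤ d4 ∧ d4 < 2 * D4
  hb1 : (B1 : ℤ) ≤ b1 ∧ b1 < 2 * B1
  hb2 : (B2 : ℤ) ≤ b2 ∧ b2 < 2 * B2
  hb3 : (B3 : ℤ) ≤ b3 ∧ b3 < 2 * B3
  hb4 : (B4 : ℤ) ≤ b4 ∧ b4 < 2 * B4
  E3 : d1 * b1 ^ 2 + d3 * b3 ^ 2 = d2 * b2 ^ 2
  E4 : d1 * b1 ^ 2 + d2 * b2 ^ 2 = d4 * b4 ^ 2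
  sf : Squarefree (d1 * d2 * d3 * d4)
  cop : IsCoprime (d1 * b1) (d2 * b2)
  t1 : d1.natAbs.divisors.card ≤ T
  t2 : d2.natAbs.divisors.card ≤ T
  t3 : d3.natAbs.divisors.card ≤ T
  t4 : d4.natAbs.divisors.card ≤ T

lemma coprime_of_terms {x y u v p q : ℤ} (h : IsCoprime x y) (hx : x = p * u ^ 2)
    (hy : y = q * v ^ 2) : IsCoprime u v := by
  subst hx hy
  exact (IsCoprime.pow_iff two_pos two_pos).mp h.of_mul_left_right.of_mul_right_right

/-- Coprimality facts for the `b`s. -/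
lemma Quad.copb {D1 D2 D3 D4 B1 B2 B3 B4 T : ℕ} {d1 d2 d3 d4 b1 b2 b3 b4 : ℤ}
    (h : Quad D1 D2 D3 D4 B1 B2 B3 B4 T d1 d2 d3 d4 b1 b2 b3 b4) :
    IsCoprime b1 b2 ∧ IsCoprime b1 b3 ∧ IsCoprime b1 b4 ∧ IsCoprime b2 b3 ∧ IsCoprime b2 b4 ∧
      IsCoprime b3 b4 := by
  have hc : IsCoprime (d1 * b1 ^ 2) (d2 * b2 ^ 2) := by
    have := h.cop
    have a := this.of_mul_left_left
    have b := this.of_mul_left_right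
    exact IsCoprime.mul_left (IsCoprime.mul_right a.of_mul_right_left a.of_mul_right_right.pow_right)
      (IsCoprime.mul_right b.of_mul_right_left b.of_mul_right_right.pow_right).pow_left
  obtain ⟨r, s, hrs⟩ := hc
  have E3 := h.E3
  have E4 := h.E4
  have i12 : IsCoprime (d1 * b1 ^ 2) (d2 * b2 ^ 2) := ⟨r, s, hrs⟩
  have i13 : IsCoprime (d1 * b1 ^ 2) (d3 * b3 ^ 2) :=
    ⟨r + s, s, by linear_combination hrs + s * E3⟩
  have i14 : IsCoprime (d1 * b1 ^ 2) (d4 * b4 ^ 2) :=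
    ⟨r - s, s, by linear_combination hrs - s * E4⟩
  have i23 : IsCoprime (d2 * b2 ^ 2) (d3 * b3 ^ 2) :=
    ⟨r + s, -r, by linear_combination hrs - r * E3⟩
  have i24 : IsCoprime (d2 * b2 ^ 2) (d4 * b4 ^ 2) :=
    ⟨s - r, r, by linear_combination hrs - r * E4⟩
  refine ⟨coprime_of_terms i12 rfl rfl, coprime_of_terms i13 rfl rfl, coprime_of_terms i14 rfl rfl,
    coprime_of_terms i23 rfl rfl, coprime_of_terms i24 rfl rfl, ?_⟩
  rw [Int.isCoprime_iff_nat_coprime]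
  by_contra hcon
  obtain ⟨p, hp, h1, h2⟩ := Nat.Prime.not_coprime_iff_dvd.mp hcon
  obtain ⟨u, hu⟩ : (p : ℤ) ∣ b3 := Int.natCast_dvd.mpr h1
  obtain ⟨v, hv⟩ : (p : ℤ) ∣ b4 := Int.natCast_dvd.mpr h2
  have h3 : ((p : ℤ) ^ 2) ∣ 2 := by
    refine ⟨r * (d4 * v ^ 2 - d3 * u ^ 2) + s * (d4 * v ^ 2 + d3 * u ^ 2), ?_⟩
    rw [hu] at E3
    rw [hv] at E4
    linear_combination (-2) * hrs + (r + s) * E4 + (r - s) * E3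
  have h4 := Int.le_of_dvd (by norm_num) h3
  have h5 : (2 : ℤ) ≤ p := by exact_mod_cast hp.two_le
  nlinarith

lemma quad_box {ι : Type*} (S : Finset ι) (d1 d2 d3 d4 b1 b2 b3 b4 : ι → ℤ)
    (D1 D2 D3 D4 B1 B2 B3 B4 T : ℕ) (hD1 : 0 < D1) (hD2 : 0 < D2) (hD3 : 0 < D3) (hD4 : 0 < D4)
    (hB1 : 0 < B1) (hB2 : 0 < B2) (hB3 : 0 < B3) (hB4 : 0 < B4) (hT : 0 < T)
    (hS : ∀ i ∈ S, Quad D1 D2 D3 D4 B1 B2 B3 B4 T (d1 i) (d2 i) (d3 i) (d4 i)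
      (b1 i) (b2 i) (b3 i) (b4 i))
    (inj : ∀ i ∈ S, ∀ j ∈ S, d1 i = d1 j → d2 i = d2 j → d3 i = d3 j → d4 i = d4 j →
      b1 i = b1 j → b2 i = b2 j → b3 i = b3 j → b4 i = b4 j → i = j) :
    (S.card : ℝ) ^ 12 ≤ (2 ^ 23 * (T : ℝ) ^ 9) ^ 4 *
      ((D1 * D2 * D3 * D4 : ℝ) ^ 6 * (B1 * B2 * B3 * B4) ^ 3) := by
  have sq : ∀ i ∈ S, Squarefree (d1 i) ∧ Squarefree (d2 i) ∧ Squarefree (d3 i) ∧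
      Squarefree (d4 i) ∧ IsCoprime (d1 i) (d2 i) ∧ IsCoprime (d1 i) (d3 i) ∧
      IsCoprime (d1 i) (d4 i) ∧ IsCoprime (d2 i) (d3 i) ∧ IsCoprime (d2 i) (d4 i) ∧
      IsCoprime (d3 i) (d4 i) := by
    intro i hi
    obtain ⟨r1, s1, s4⟩ := squarefree_mul_iff.mp (hS i hi).sf
    obtain ⟨r2, s2, s3⟩ := squarefree_mul_iff.mp s1
    obtain ⟨r3, s1, s2⟩ := squarefree_mul_iff.mp s2
    have r1 := r1.isCoprime
    have r2 := r2.isCoprime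
    have r3 := r3.isCoprime
    exact ⟨s1, s2, s3, s4, r3, r2.of_mul_left_left, r1.of_mul_left_left.of_mul_left_left,
      r2.of_mul_left_right, r1.of_mul_left_left.of_mul_left_right, r1.of_mul_left_right⟩
  have pos : ∀ i ∈ S, 0 < d1 i ∧ 0 < d2 i ∧ 0 < d3 i ∧ 0 < d4 i ∧ 0 < b1 i ∧ 0 < b2 i ∧
      0 < b3 i ∧ 0 < b4 i := by
    intro i hi
    have h := hS i hi
    have := h.hd1; have := h.hd2; have := h.hd3; have := h.hd4
    have := h.hb1; have := h.hb2; have := h.hb3; have := h.hb4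
    refine ⟨?_, ?_, ?_, ?_, ?_, ?_, ?_, ?_⟩ <;> omega
  -- the triple (1,3;2)
  have A := box_count S d1 d3 d2 b1 b3 b2 1 1 1 D1 D3 D2 B1 B3 B2 T (Or.inl rfl) (Or.inl rfl)
    (Or.inl rfl) hD1 hD3 hD2 hB1 hB3 hB2 hT
    (fun i hi => by
      have h := hS i hi
      obtain ⟨k12, k13, k14, k23, k24, k34⟩ := h.copb
      obtain ⟨s1, s2, s3, s4, c12, c13, c14, c23, c24, c34⟩ := sq i hi
      exact ⟨h.hd1, h.hd3, h.hd2, h.hb1, h.hb3, h.hb2, by linear_combination h.E3, s1, s3, s2,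
        c13, c12, c23.symm, k13, k12, k23.symm, h.t1, h.t3, h.t2⟩)
    (fun i hi j hj e1 e3 e2 f1 f3 f2 => by
      have h := hS i hi
      have h' := hS j hj
      have p := pos i hi
      have p' := pos j hj
      have E := h.E4
      rw [e1, e2, f1, f2, h'.E4] at E
      obtain ⟨e4, f4⟩ := sf_inj _ _ _ _ p'.2.2.2.1 p'.2.2.2.2.2.2.2 p.2.2.2.1 p.2.2.2.2.2.2.2
        (sq j hj).2.2.2.1 (sq i hi).2.2.2.1 E
      exact inj i hi j hj e1 e2 e3 e4.symm f1 f2 f3 f4.symm)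
  -- the triple (1,2;4)
  have B := box_count S d1 d2 d4 b1 b2 b4 1 1 1 D1 D2 D4 B1 B2 B4 T (Or.inl rfl) (Or.inl rfl)
    (Or.inl rfl) hD1 hD2 hD4 hB1 hB2 hB4 hT
    (fun i hi => by
      have h := hS i hi
      obtain ⟨k12, k13, k14, k23, k24, k34⟩ := h.copb
      obtain ⟨s1, s2, s3, s4, c12, c13, c14, c23, c24, c34⟩ := sq i hi
      exact ⟨h.hd1, h.hd2, h.hd4, h.hb1, h.hb2, h.hb4, by linear_combination h.E4, s1, s2, s4,
        c12, c14, c24, k12, k14, k24, h.t1, h.t2, h.t4⟩)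
    (fun i hi j hj e1 e2 e4 f1 f2 f4 => by
      have h := hS i hi
      have h' := hS j hj
      have p := pos i hi
      have p' := pos j hj
      have E := h.E3
      have E' := h'.E3
      rw [e1, e2, f1, f2] at E
      obtain ⟨e3, f3⟩ := sf_inj _ _ _ _ p.2.2.1 p.2.2.2.2.2.2.1 p'.2.2.1 p'.2.2.2.2.2.2.1
        (sq i hi).2.2.1 (sq j hj).2.2.1 (by linarith)
      exact inj i hi j hj e1 e2 e3 e4 f1 f2 f3 f4)
  -- the triple (1,3;4)
  have C := box_count S d1 d3 d4 b1 b3 b4 2 1 1 D1 D3 D4 B1 B3 B4 T (Or.inr rfl) (Or.inl rfl)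
    (Or.inl rfl) hD1 hD3 hD4 hB1 hB3 hB4 hT
    (fun i hi => by
      have h := hS i hi
      obtain ⟨k12, k13, k14, k23, k24, k34⟩ := h.copb
      obtain ⟨s1, s2, s3, s4, c12, c13, c14, c23, c24, c34⟩ := sq i hi
      exact ⟨h.hd1, h.hd3, h.hd4, h.hb1, h.hb3, h.hb4, by linear_combination h.E4 + h.E3, s1, s3, s4,
        c13, c14, c34, k13, k14, k34, h.t1, h.t3, h.t4⟩)
    (fun i hi j hj e1 e3 e4 f1 f3 f4 => by
      have h := hS i hi
      have h' := hS j hj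
      have p := pos i hi
      have p' := pos j hj
      have E := h.E3
      have E' := h'.E3
      rw [e1, e3, f1, f3] at E
      obtain ⟨e2, f2⟩ := sf_inj _ _ _ _ p.2.1 p.2.2.2.2.2.1 p'.2.1 p'.2.2.2.2.2.1
        (sq i hi).2.1 (sq j hj).2.1 (by linarith)
      exact inj i hi j hj e1 e2 e3 e4 f1 f2 f3 f4)
  -- the triple (3,4;2)
  have F := box_count S d3 d4 d2 b3 b4 b2 1 1 2 D3 D4 D2 B3 B4 B2 T (Or.inl rfl) (Or.inl rfl)
    (Or.inr rfl) hD3 hD4 hD2 hB3 hB4 hB2 hT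
    (fun i hi => by
      have h := hS i hi
      obtain ⟨k12, k13, k14, k23, k24, k34⟩ := h.copb
      obtain ⟨s1, s2, s3, s4, c12, c13, c14, c23, c24, c34⟩ := sq i hi
      exact ⟨h.hd3, h.hd4, h.hd2, h.hb3, h.hb4, h.hb2, by linear_combination h.E3 - h.E4, s3, s4, s2,
        c34, c23.symm, c24.symm, k34, k23.symm, k24.symm, h.t3, h.t4, h.t2⟩)
    (fun i hi j hj e3 e4 e2 f3 f4 f2 => by
      have h := hS i hi
      have h' := hS j hj
      have p := pos i hi
      have p' := pos j hj
      have E := h.E3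
      have E' := h'.E3
      rw [e2, e3, f2, f3] at E
      obtain ⟨e1, f1⟩ := sf_inj _ _ _ _ p.1 p.2.2.2.2.1 p'.1 p'.2.2.2.2.1
        (sq i hi).1 (sq j hj).1 (by linarith)
      exact inj i hi j hj e1 e2 e3 e4 f1 f2 f3 f4)
  calc (S.card : ℝ) ^ 12 = (S.card : ℝ) ^ 3 * (S.card : ℝ) ^ 3 * (S.card : ℝ) ^ 3 *
        (S.card : ℝ) ^ 3 := by ring
    _ ≤ _ := mul_le_mul (mul_le_mul (mul_le_mul A B (by positivity) (by positivity)) C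
        (by positivity) (by positivity)) F (by positivity) (by positivity)
    _ = _ := by ring

lemma quad_final {ι : Type*} (S : Finset ι) (d1 d2 d3 d4 b1 b2 b3 b4 : ι → ℤ)
    (D1 D2 D3 D4 B1 B2 B3 B4 T : ℕ) (hD1 : 0 < D1) (hD2 : 0 < D2) (hD3 : 0 < D3) (hD4 : 0 < D4)
    (hB1 : 0 < B1) (hB2 : 0 < B2) (hB3 : 0 < B3) (hB4 : 0 < B4) (hT : 0 < T)
    (hS : ∀ i ∈ S, Quad D1 D2 D3 D4 B1 B2 B3 B4 T (d1 i) (d2 i) (d3 i) (d4 i)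
      (b1 i) (b2 i) (b3 i) (b4 i))
    (inj : ∀ i ∈ S, ∀ j ∈ S, d1 i = d1 j → d2 i = d2 j → d3 i = d3 j → d4 i = d4 j →
      b1 i = b1 j → b2 i = b2 j → b3 i = b3 j → b4 i = b4 j → i = j)
    (X α : ℝ) (hX : 1 ≤ X)
    (hP : ∀ i ∈ S, ((d1 i * d2 i * d3 i * d4 i : ℤ) : ℝ) ≤ X)
    (h1 : ∀ i ∈ S, ((d1 i * b1 i ^ 2 : ℤ) : ℝ) ≤ X ^ ((1 : ℝ) / 4 + 2 * α))
    (h2 : ∀ i ∈ S, ((d2 i * b2 i ^ 2 : ℤ) : ℝ) ≤ X ^ ((1 : ℝ) / 4 + 2 * α)) :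
    (S.card : ℝ) ≤ 2 ^ 8 * (T : ℝ) ^ 3 * X ^ ((1 : ℝ) / 2 + α) := by
  have X0 : 0 < X := by linarith
  rcases S.eq_empty_or_nonempty with h0 | ⟨o, ho⟩
  · rw [h0]; simp; positivity
  have main := quad_box S d1 d2 d3 d4 b1 b2 b3 b4 D1 D2 D3 D4 B1 B2 B3 B4 T hD1 hD2 hD3 hD4
    hB1 hB2 hB3 hB4 hT hS inj
  have W := hS o ho
  have rD1 : (0 : ℝ) < D1 := by exact_mod_cast hD1
  have rD2 : (0 : ℝ) < D2 := by exact_mod_cast hD2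
  have rD3 : (0 : ℝ) < D3 := by exact_mod_cast hD3
  have rD4 : (0 : ℝ) < D4 := by exact_mod_cast hD4
  have rB1 : (0 : ℝ) < B1 := by exact_mod_cast hB1
  have rB2 : (0 : ℝ) < B2 := by exact_mod_cast hB2
  have rB3 : (0 : ℝ) < B3 := by exact_mod_cast hB3
  have rB4 : (0 : ℝ) < B4 := by exact_mod_cast hB4
  have kd1 : (D1 : ℝ) ≤ d1 o := by exact_mod_cast W.hd1.1
  have kd2 : (D2 : ℝ) ≤ d2 o := by exact_mod_cast W.hd2.1
  have kd3 : (D3 : ℝ) ≤ d3 o := by exact_mod_cast W.hd3.1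
  have kd4 : (D4 : ℝ) ≤ d4 o := by exact_mod_cast W.hd4.1
  have kb1 : (B1 : ℝ) ≤ b1 o := by exact_mod_cast W.hb1.1
  have kb2 : (B2 : ℝ) ≤ b2 o := by exact_mod_cast W.hb2.1
  have kb3 : (B3 : ℝ) ≤ b3 o := by exact_mod_cast W.hb3.1
  have kb4 : (B4 : ℝ) ≤ b4 o := by exact_mod_cast W.hb4.1
  have qd1 := rD1.trans_le kd1
  have qd2 := rD2.trans_le kd2
  have qd3 := rD3.trans_le kd3
  have qd4 := rD4.trans_le kd4
  have qb1 := rB1.trans_le kb1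
  have qb2 := rB2.trans_le kb2
  have qb3 := rB3.trans_le kb3
  have qb4 := rB4.trans_le kb4
  set Y : ℝ := X ^ ((1 : ℝ) / 4 + 2 * α) with hY
  have Y0 : 0 < Y := by positivity
  have n1 : (d1 o : ℝ) * b1 o ^ 2 ≤ Y := by exact_mod_cast h1 o ho
  have n2 : (d2 o : ℝ) * b2 o ^ 2 ≤ Y := by exact_mod_cast h2 o ho
  have E3 : (d1 o : ℝ) * b1 o ^ 2 + d3 o * b3 o ^ 2 = d2 o * b2 o ^ 2 := by exact_mod_cast W.E3
  have E4 : (d1 o : ℝ) * b1 o ^ 2 + d2 o * b2 o ^ 2 = d4 o * b4 o ^ 2 := by exact_mod_cast W.E4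
  have n1' : 0 < (d1 o : ℝ) * b1 o ^ 2 := by positivity
  have n3 : (d3 o : ℝ) * b3 o ^ 2 ≤ Y := by linarith
  have n4 : (d4 o : ℝ) * b4 o ^ 2 ≤ 2 * Y := by linarith
  set D : ℝ := D1 * D2 * D3 * D4 with hD
  set B : ℝ := B1 * B2 * B3 * B4 with hB
  have D0 : 0 < D := by positivity
  have B0 : 0 < B := by positivity
  have DX : D ≤ X := by
    refine le_trans ?_ (hP o ho)
    rw [hD]; push_cast
    gcongr
  have DB : D * B ^ 2 ≤ 2 * Y ^ 4 := by
    calc D * B ^ 2 = (D1 * B1 ^ 2) * (D2 * B2 ^ 2) * (D3 * B3 ^ 2) * (D4 * B4 ^ 2) := by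
          rw [hD, hB]; ring
      _ ≤ ((d1 o : ℝ) * b1 o ^ 2) * (d2 o * b2 o ^ 2) * (d3 o * b3 o ^ 2) * (d4 o * b4 o ^ 2) := by
          gcongr
      _ ≤ Y * Y * Y * (2 * Y) := by gcongr
      _ = _ := by ring
  set Z : ℝ := X ^ ((1 : ℝ) / 2 + α) with hZ
  have Z0 : 0 < Z := by positivity
  have hYZ : X ^ 9 * (Y ^ 4) ^ 3 = Z ^ 24 := by
    rw [hY, hZ, ← pow_mul, ← Real.rpow_natCast, ← Real.rpow_natCast, ← Real.rpow_natCast,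
      ← Real.rpow_mul X0.le, ← Real.rpow_mul X0.le, ← Real.rpow_add X0]
    congr 1
    push_cast
    ring
  have hT0 : (0 : ℝ) < T := by exact_mod_cast hT
  refine le_of_pow_le_pow_left₀ (n := 24) (by norm_num) (by positivity) ?_
  calc (S.card : ℝ) ^ 24 = ((S.card : ℝ) ^ 12) ^ 2 := by ring
    _ ≤ ((2 ^ 23 * (T : ℝ) ^ 9) ^ 4 * (D ^ 6 * B ^ 3)) ^ 2 := by gcongr
    _ = 2 ^ 184 * (T : ℝ) ^ 72 * (D ^ 9 * (D * B ^ 2) ^ 3) := by ring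
    _ ≤ 2 ^ 184 * (T : ℝ) ^ 72 * (X ^ 9 * (2 * Y ^ 4) ^ 3) := by gcongr
    _ = 2 ^ 187 * (T : ℝ) ^ 72 * (X ^ 9 * (Y ^ 4) ^ 3) := by ring
    _ = 2 ^ 187 * (T : ℝ) ^ 72 * Z ^ 24 := by rw [hYZ]
    _ ≤ 2 ^ 192 * (T : ℝ) ^ 72 * Z ^ 24 := by gcongr <;> norm_num
    _ = _ := by ring

/-- Dyadic exponent of an integer. -/
def lg (n : ℤ) : ℕ := Nat.log 2 n.natAbs

lemma lg_spec (n : ℤ) (hn : 1 ≤ n) (a : ℕ) (ha : lg n = a) :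
    (((2 ^ a : ℕ) : ℤ) ≤ n ∧ n < 2 * ((2 ^ a : ℕ) : ℤ)) := by
  subst ha
  have h1 : 2 ^ lg n ≤ n.natAbs := Nat.pow_log_le_self 2 (by omega)
  have h2 : n.natAbs < 2 ^ (lg n + 1) := Nat.lt_pow_succ_log_self (by norm_num) _
  rw [pow_succ] at h2
  generalize 2 ^ lg n = p at *
  constructor <;> omega

lemma lg_bound (α δ X : ℝ) (hα : 0 < α) (hδ : 0 < δ) (hX : 1 ≤ X) (n : ℤ) (hn : 1 ≤ n)
    (h : (n : ℝ) ≤ 2 * X ^ (1 + 2 * α)) :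
    (lg n : ℝ) ≤ (1 + 2 * (1 + 2 * α) / δ) * X ^ δ := by
  have X0 : 0 < X := by linarith
  have h1 := (lg_spec n hn _ rfl).1
  have h2 : (2 : ℝ) ^ lg n ≤ n := by exact_mod_cast h1
  have h3 := Real.log_le_log (by positivity) (h2.trans h)
  rw [Real.log_pow, Real.log_mul (by norm_num) (by positivity), Real.log_rpow X0] at h3
  have l2 : (1 : ℝ) / 2 < Real.log 2 := by have := Real.log_two_gt_d9; linarith
  have h4 := Real.log_le_rpow_div X0.le hδ
  have lX : 0 ≤ Real.log X := Real.log_nonneg hX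
  have h5 : (1 : ℝ) ≤ X ^ δ := Real.one_le_rpow hX hδ.le
  have h6 : (1 + 2 * α) * Real.log X ≤ 2 * ((1 + 2 * α) * Real.log X) * Real.log 2 := by
    have : 0 ≤ (1 + 2 * α) * Real.log X := by positivity
    nlinarith
  have h7 : (lg n : ℝ) ≤ 1 + 2 * ((1 + 2 * α) * Real.log X) := by
    by_contra hc
    push Not at hc
    have : (1 + 2 * ((1 + 2 * α) * Real.log X)) * Real.log 2 < lg n * Real.log 2 :=
      mul_lt_mul_of_pos_right hc (by linarith)
    linarith
  calc (lg n : ℝ) ≤ 1 + 2 * ((1 + 2 * α) * Real.log X) := h7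
    _ ≤ X ^ δ + 2 * ((1 + 2 * α) * (X ^ δ / δ)) := by gcongr
    _ = _ := by ring

/-- The counted tuples. -/
structure Sol (α X : ℝ) (v d1 d2 d3 d4 b1 b2 b3 b4 : ℤ) : Prop where
  hv : v = 1 ∨ v = -1
  pd1 : 1 ≤ d1
  pd2 : 1 ≤ d2
  pd3 : 1 ≤ d3
  pd4 : 1 ≤ d4
  pb1 : 1 ≤ b1
  pb2 : 1 ≤ b2
  pb3 : 1 ≤ b3
  pb4 : 1 ≤ b4
  sf : Squarefree (d1 * d2 * d3 * d4)
  cop : Int.gcd (d1 * b1) (d2 * b2) = 1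
  e3 : d2 * b2 ^ 2 - v * d1 * b1 ^ 2 = d3 * b3 ^ 2
  e4 : v * d2 * b2 ^ 2 + d1 * b1 ^ 2 = d4 * b4 ^ 2
  hP : ((d1 * d2 * d3 * d4 : ℤ) : ℝ) ≤ X
  h1 : ((d1 * b1 ^ 2 : ℤ) : ℝ) ≤ X ^ ((1 : ℝ) / 4 + 2 * α)
  h2 : ((d2 * b2 ^ 2 : ℤ) : ℝ) ≤ X ^ ((1 : ℝ) / 4 + 2 * α)

lemma b_le (d b : ℤ) (hd : 1 ≤ d) (hb : 1 ≤ b) : b ≤ d * b ^ 2 := by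
  have : b ≤ b ^ 2 := by nlinarith
  nlinarith

lemma d_le (P d e : ℤ) (hP : 1 ≤ P) (hd : 1 ≤ d) (h : P = d * e) : d ≤ P :=
  Int.le_of_dvd (by omega) ⟨e, h⟩

lemma Sol.large {α X : ℝ} {v d1 d2 d3 d4 b1 b2 b3 b4 : ℤ} (hα : 0 < α) (hX : 1 ≤ X)
    (h : Sol α X v d1 d2 d3 d4 b1 b2 b3 b4) :
    ((d1 : ℝ) ≤ X ∧ (d2 : ℝ) ≤ X ∧ (d3 : ℝ) ≤ X ∧ (d4 : ℝ) ≤ X) ∧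
    ((b1 : ℝ) ≤ 2 * X ^ (1 + 2 * α) ∧ (b2 : ℝ) ≤ 2 * X ^ (1 + 2 * α) ∧
     (b3 : ℝ) ≤ 2 * X ^ (1 + 2 * α) ∧ (b4 : ℝ) ≤ 2 * X ^ (1 + 2 * α)) := by
  have hY : X ^ ((1 : ℝ) / 4 + 2 * α) ≤ X ^ (1 + 2 * α) :=
    Real.rpow_le_rpow_of_exponent_le hX (by linarith)
  have p1 := h.pd1
  have p2 := h.pd2
  have p3 := h.pd3
  have p4 := h.pd4
  have hP1 : 1 ≤ d1 * d2 * d3 * d4 := by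
    have : 0 < d1 * d2 * d3 * d4 := by positivity
    omega
  have hP := h.hP
  have f : ∀ d e : ℤ, 1 ≤ d → d1 * d2 * d3 * d4 = d * e → (d : ℝ) ≤ X := by
    intro d e hd he
    have : (d : ℝ) ≤ ((d1 * d2 * d3 * d4 : ℤ) : ℝ) := by
      exact_mod_cast d_le _ d e hP1 hd he
    linarith
  have g : ∀ d b : ℤ, 1 ≤ d → 1 ≤ b →
      ((d * b ^ 2 : ℤ) : ℝ) ≤ 2 * X ^ ((1 : ℝ) / 4 + 2 * α) →
      (b : ℝ) ≤ 2 * X ^ (1 + 2 * α) := by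
    intro d b hd hb hh
    have : (b : ℝ) ≤ ((d * b ^ 2 : ℤ) : ℝ) := by exact_mod_cast b_le d b hd hb
    linarith
  have h1 := h.h1
  have h2 := h.h2
  have Y0 : 0 ≤ X ^ ((1 : ℝ) / 4 + 2 * α) := by positivity
  have z1 : 0 ≤ d1 * b1 ^ 2 := by positivity
  have z2 : 0 ≤ d2 * b2 ^ 2 := by positivity
  have e3 : d3 * b3 ^ 2 ≤ d1 * b1 ^ 2 + d2 * b2 ^ 2 := by
    have := h.e3
    rcases h.hv with hv | hv <;> subst hv <;> linarith
  have e4 : d4 * b4 ^ 2 ≤ d1 * b1 ^ 2 + d2 * b2 ^ 2 := by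
    have := h.e4
    rcases h.hv with hv | hv <;> subst hv <;> linarith
  have e3' : ((d3 * b3 ^ 2 : ℤ) : ℝ) ≤ ((d1 * b1 ^ 2 : ℤ) : ℝ) + ((d2 * b2 ^ 2 : ℤ) : ℝ) := by
    exact_mod_cast e3
  have e4' : ((d4 * b4 ^ 2 : ℤ) : ℝ) ≤ ((d1 * b1 ^ 2 : ℤ) : ℝ) + ((d2 * b2 ^ 2 : ℤ) : ℝ) := by
    exact_mod_cast e4
  refine ⟨⟨f d1 (d2 * d3 * d4) p1 (by ring), f d2 (d1 * d3 * d4) p2 (by ring),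
    f d3 (d1 * d2 * d4) p3 (by ring), f d4 (d1 * d2 * d3) p4 (by ring)⟩,
    g d1 b1 p1 h.pb1 (by linarith), g d2 b2 p2 h.pb2 (by linarith),
    g d3 b3 p3 h.pb3 (by linarith), g d4 b4 p4 h.pb4 (by linarith)⟩

abbrev Tup := ℤ × ℤ × ℤ × ℤ × ℤ × ℤ × ℤ × ℤ × ℤ

abbrev Key := ℤ × ℕ × ℕ × ℕ × ℕ × ℕ × ℕ × ℕ × ℕ

def solP (α X : ℝ) : Tup → Prop
  | (v, d1, d2, d3, d4, b1, b2, b3, b4) => Sol α X v d1 d2 d3 d4 b1 b2 b3 b4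

def keyOf : Tup → Key
  | (v, d1, d2, d3, d4, b1, b2, b3, b4) =>
    (v, lg d1, lg d2, lg d3, lg d4, lg b1, lg b2, lg b3, lg b4)

lemma fiber_bound (α X : ℝ) (hα : 0 < α) (hX : 1 ≤ X) (T : ℕ) (hT : 0 < T)
    (hdiv : ∀ d : ℤ, 1 ≤ d → (d : ℝ) ≤ X → Squarefree d → d.natAbs.divisors.card ≤ T)
    (S : Finset Tup) (hS : ∀ t ∈ S, solP α X t) (k : Key) (hk : ∀ t ∈ S, keyOf t = k) :
    (S.card : ℝ) ≤ 2 ^ 8 * (T : ℝ) ^ 3 * X ^ ((1 : ℝ) / 2 + α) := by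
  obtain ⟨v, a1, a2, a3, a4, c1, c2, c3, c4⟩ := k
  have hd : ∀ v d1 d2 d3 d4 b1 b2 b3 b4 : ℤ, Sol α X v d1 d2 d3 d4 b1 b2 b3 b4 →
      d1.natAbs.divisors.card ≤ T ∧ d2.natAbs.divisors.card ≤ T ∧
      d3.natAbs.divisors.card ≤ T ∧ d4.natAbs.divisors.card ≤ T := by
    intro v d1 d2 d3 d4 b1 b2 b3 b4 h
    obtain ⟨⟨l1, l2, l3, l4⟩, -⟩ := h.large hα hX
    exact ⟨hdiv _ h.pd1 l1 (h.sf.squarefree_of_dvd ⟨d2 * d3 * d4, by ring⟩),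
      hdiv _ h.pd2 l2 (h.sf.squarefree_of_dvd ⟨d1 * d3 * d4, by ring⟩),
      hdiv _ h.pd3 l3 (h.sf.squarefree_of_dvd ⟨d1 * d2 * d4, by ring⟩),
      hdiv _ h.pd4 l4 (h.sf.squarefree_of_dvd ⟨d1 * d2 * d3, by ring⟩)⟩
  by_cases hv : v = 1
  · subst hv
    refine quad_final S (fun t => t.2.1) (fun t => t.2.2.1) (fun t => t.2.2.2.1)
      (fun t => t.2.2.2.2.1) (fun t => t.2.2.2.2.2.1) (fun t => t.2.2.2.2.2.2.1)
      (fun t => t.2.2.2.2.2.2.2.1) (fun t => t.2.2.2.2.2.2.2.2)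
      (2 ^ a1) (2 ^ a2) (2 ^ a3) (2 ^ a4) (2 ^ c1) (2 ^ c2) (2 ^ c3) (2 ^ c4) T
      (by positivity) (by positivity) (by positivity) (by positivity)
      (by positivity) (by positivity) (by positivity) (by positivity) hT
      ?_ ?_ X α hX ?_ ?_ ?_
    · rintro ⟨w, d1, d2, d3, d4, b1, b2, b3, b4⟩ ht
      have h : Sol α X w d1 d2 d3 d4 b1 b2 b3 b4 := hS _ ht
      have hk := hk _ ht
      simp only [keyOf, Prod.mk.injEq] at hk
      obtain ⟨kv, k1, k2, k3, k4, m1, m2, m3, m4⟩ := hk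
      obtain ⟨t1, t2, t3, t4⟩ := hd _ _ _ _ _ _ _ _ _ h
      subst kv
      have e3 := h.e3
      have e4 := h.e4
      exact ⟨lg_spec _ h.pd1 _ k1, lg_spec _ h.pd2 _ k2, lg_spec _ h.pd3 _ k3, lg_spec _ h.pd4 _ k4,
        lg_spec _ h.pb1 _ m1, lg_spec _ h.pb2 _ m2, lg_spec _ h.pb3 _ m3, lg_spec _ h.pb4 _ m4,
        by linarith, by linarith, h.sf, Int.isCoprime_iff_gcd_eq_one.mpr h.cop, t1, t2, t3, t4⟩
    · rintro ⟨w, d1, d2, d3, d4, b1, b2, b3, b4⟩ ht ⟨w', d1', d2', d3', d4', b1', b2', b3', b4'⟩ ht'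
      have hk1 := hk _ ht
      have hk2 := hk _ ht'
      simp only [keyOf, Prod.mk.injEq] at hk1 hk2
      intro h1 h2 h3 h4 h5 h6 h7 h8
      simp only at h1 h2 h3 h4 h5 h6 h7 h8
      simp only [Prod.mk.injEq]
      exact ⟨hk1.1.trans hk2.1.symm, h1, h2, h3, h4, h5, h6, h7, h8⟩
    · rintro ⟨w, d1, d2, d3, d4, b1, b2, b3, b4⟩ ht
      exact (show Sol α X w d1 d2 d3 d4 b1 b2 b3 b4 from hS _ ht).hP
    · rintro ⟨w, d1, d2, d3, d4, b1, b2, b3, b4⟩ ht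
      exact (show Sol α X w d1 d2 d3 d4 b1 b2 b3 b4 from hS _ ht).h1
    · rintro ⟨w, d1, d2, d3, d4, b1, b2, b3, b4⟩ ht
      exact (show Sol α X w d1 d2 d3 d4 b1 b2 b3 b4 from hS _ ht).h2
  · refine quad_final S (fun t => t.2.2.1) (fun t => t.2.1) (fun t => t.2.2.2.2.1)
      (fun t => t.2.2.2.1) (fun t => t.2.2.2.2.2.2.1) (fun t => t.2.2.2.2.2.1)
      (fun t => t.2.2.2.2.2.2.2.2) (fun t => t.2.2.2.2.2.2.2.1)
      (2 ^ a2) (2 ^ a1) (2 ^ a4) (2 ^ a3) (2 ^ c2) (2 ^ c1) (2 ^ c4) (2 ^ c3) T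
      (by positivity) (by positivity) (by positivity) (by positivity)
      (by positivity) (by positivity) (by positivity) (by positivity) hT
      ?_ ?_ X α hX ?_ ?_ ?_
    · rintro ⟨w, d1, d2, d3, d4, b1, b2, b3, b4⟩ ht
      have h : Sol α X w d1 d2 d3 d4 b1 b2 b3 b4 := hS _ ht
      have hk := hk _ ht
      simp only [keyOf, Prod.mk.injEq] at hk
      obtain ⟨kv, k1, k2, k3, k4, m1, m2, m3, m4⟩ := hk
      obtain ⟨t1, t2, t3, t4⟩ := hd _ _ _ _ _ _ _ _ _ h
      have hw : w = -1 := by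
        rcases h.hv with hw | hw
        · exact absurd (kv.symm.trans hw) hv
        · exact hw
      subst hw
      have e3 := h.e3
      have e4 := h.e4
      have sf : Squarefree (d2 * d1 * d4 * d3) := by
        have := h.sf
        rwa [show d1 * d2 * d3 * d4 = d2 * d1 * d4 * d3 by ring] at this
      exact ⟨lg_spec _ h.pd2 _ k2, lg_spec _ h.pd1 _ k1, lg_spec _ h.pd4 _ k4, lg_spec _ h.pd3 _ k3,
        lg_spec _ h.pb2 _ m2, lg_spec _ h.pb1 _ m1, lg_spec _ h.pb4 _ m4, lg_spec _ h.pb3 _ m3,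
        by linarith, by linarith, sf, (Int.isCoprime_iff_gcd_eq_one.mpr h.cop).symm,
        t2, t1, t4, t3⟩
    · rintro ⟨w, d1, d2, d3, d4, b1, b2, b3, b4⟩ ht ⟨w', d1', d2', d3', d4', b1', b2', b3', b4'⟩ ht'
      have hk1 := hk _ ht
      have hk2 := hk _ ht'
      simp only [keyOf, Prod.mk.injEq] at hk1 hk2
      intro h1 h2 h3 h4 h5 h6 h7 h8
      simp only at h1 h2 h3 h4 h5 h6 h7 h8
      simp only [Prod.mk.injEq]
      exact ⟨hk1.1.trans hk2.1.symm, h2, h1, h4, h3, h6, h5, h8, h7⟩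
    · rintro ⟨w, d1, d2, d3, d4, b1, b2, b3, b4⟩ ht
      have := (show Sol α X w d1 d2 d3 d4 b1 b2 b3 b4 from hS _ ht).hP
      rwa [show d1 * d2 * d3 * d4 = d2 * d1 * d4 * d3 by ring] at this
    · rintro ⟨w, d1, d2, d3, d4, b1, b2, b3, b4⟩ ht
      exact (show Sol α X w d1 d2 d3 d4 b1 b2 b3 b4 from hS _ ht).h2
    · rintro ⟨w, d1, d2, d3, d4, b1, b2, b3, b4⟩ ht
      exact (show Sol α X w d1 d2 d3 d4 b1 b2 b3 b4 from hS _ ht).h1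

/-- Box of possible keys. -/
def keyBox (L : ℕ) : Finset Key :=
  ({1, -1} : Finset ℤ) ×ˢ (Finset.range L) ×ˢ (Finset.range L) ×ˢ (Finset.range L) ×ˢ
    (Finset.range L) ×ˢ (Finset.range L) ×ˢ (Finset.range L) ×ˢ (Finset.range L) ×ˢ
    (Finset.range L)

lemma keyBox_card (L : ℕ) : (keyBox L).card = 2 * L ^ 8 := by
  have : ({1, -1} : Finset ℤ).card = 2 := by decide
  simp only [keyBox, Finset.card_product, Finset.card_range, this]
  ring

lemma finite_bound (α X C0 C2 ε : ℝ) (hα : 0 < α) (hε : 0 < ε) (hX : 1 ≤ X)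
    (hC0 : C0 = 1 + 2 * (1 + 2 * α) / (ε / 16)) (hC2 : 1 ≤ C2)
    (hdiv : ∀ n : ℕ, Squarefree n → (n.divisors.card : ℝ) ≤ C2 * (n : ℝ) ^ (ε / 6))
    (S : Finset Tup) (hS : ∀ t ∈ S, solP α X t) :
    (S.card : ℝ) ≤ (2 * (C0 + 1) ^ 8 * (2 ^ 8 * C2 ^ 3)) * X ^ ((1 : ℝ) / 2 + α + ε) := by
  classical
  have X0 : 0 < X := by linarith
  have C00 : 0 < C0 := by rw [hC0]; positivity
  set T : ℕ := ⌊C2 * X ^ (ε / 6)⌋₊ with hTdef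
  have x6 : 1 ≤ X ^ (ε / 6) := Real.one_le_rpow hX (by positivity)
  have x16 : 1 ≤ X ^ (ε / 16) := Real.one_le_rpow hX (by positivity)
  have hT : 0 < T := Nat.floor_pos.mpr (by nlinarith)
  have hTle : (T : ℝ) ≤ C2 * X ^ (ε / 6) := Nat.floor_le (by positivity)
  have hdiv' : ∀ d : ℤ, 1 ≤ d → (d : ℝ) ≤ X → Squarefree d → d.natAbs.divisors.card ≤ T := by
    intro d hd hdX hsf
    apply Nat.le_floor
    refine (hdiv _ (Int.squarefree_natAbs.mpr hsf)).trans ?_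
    have : ((d.natAbs : ℕ) : ℝ) = d := by
      rw [Nat.cast_natAbs, abs_of_nonneg (by omega)]
    rw [this]
    have d0 : (0 : ℝ) ≤ d := by exact_mod_cast (by omega : 0 ≤ d)
    gcongr
  set L : ℕ := ⌊C0 * X ^ (ε / 16)⌋₊ + 1 with hL
  have hLle : (L : ℝ) ≤ (C0 + 1) * X ^ (ε / 16) := by
    have : (⌊C0 * X ^ (ε / 16)⌋₊ : ℝ) ≤ C0 * X ^ (ε / 16) := Nat.floor_le (by positivity)
    rw [hL]; push_cast; linarith
  have hlt : ∀ n : ℤ, 1 ≤ n → (n : ℝ) ≤ 2 * X ^ (1 + 2 * α) → lg n < L := by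
    intro n hn h
    have := lg_bound α (ε / 16) X hα (by positivity) hX n hn h
    rw [← hC0] at this
    have := Nat.le_floor this
    omega
  have hXX : X ≤ 2 * X ^ (1 + 2 * α) := by
    have : X ^ (1 : ℝ) ≤ X ^ (1 + 2 * α) := Real.rpow_le_rpow_of_exponent_le hX (by linarith)
    rw [Real.rpow_one] at this
    linarith
  set F : ℝ := 2 ^ 8 * (T : ℝ) ^ 3 * X ^ ((1 : ℝ) / 2 + α) with hF
  have F0 : 0 ≤ F := by positivity
  have maps : ∀ t ∈ S, keyOf t ∈ keyBox L := by
    rintro ⟨v, d1, d2, d3, d4, b1, b2, b3, b4⟩ ht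
    have h : Sol α X v d1 d2 d3 d4 b1 b2 b3 b4 := hS _ ht
    obtain ⟨⟨l1, l2, l3, l4⟩, m1, m2, m3, m4⟩ := h.large hα hX
    simp only [keyBox, keyOf, Finset.mem_product, Finset.mem_range, Finset.mem_insert,
      Finset.mem_singleton]
    exact ⟨h.hv, hlt _ h.pd1 (l1.trans hXX), hlt _ h.pd2 (l2.trans hXX), hlt _ h.pd3 (l3.trans hXX),
      hlt _ h.pd4 (l4.trans hXX), hlt _ h.pb1 m1, hlt _ h.pb2 m2, hlt _ h.pb3 m3, hlt _ h.pb4 m4⟩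
  have cnt : S.card ≤ ⌊F⌋₊ * (keyBox L).card := by
    refine Finset.card_le_mul_card_image_of_maps_to maps _ ?_
    intro k _
    apply Nat.le_floor
    refine fiber_bound α X hα hX T hT hdiv' _ ?_ k ?_
    · intro t ht
      exact hS t (Finset.mem_filter.mp ht).1
    · intro t ht
      exact (Finset.mem_filter.mp ht).2
  rw [keyBox_card] at cnt
  have cnt' : (S.card : ℝ) ≤ ⌊F⌋₊ * (2 * (L : ℝ) ^ 8) := by exact_mod_cast cnt
  have e16 : (X ^ (ε / 16)) ^ 8 = X ^ (ε / 2) := by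
    rw [← Real.rpow_natCast, ← Real.rpow_mul X0.le]; congr 1; push_cast; ring
  have e6 : (X ^ (ε / 6)) ^ 3 = X ^ (ε / 2) := by
    rw [← Real.rpow_natCast, ← Real.rpow_mul X0.le]; congr 1; push_cast; ring
  have e : X ^ ((1 : ℝ) / 2 + α + ε) = X ^ ((1 : ℝ) / 2 + α) * (X ^ (ε / 2) * X ^ (ε / 2)) := by
    rw [← Real.rpow_add X0, ← Real.rpow_add X0]; congr 1; ring
  calc (S.card : ℝ) ≤ ⌊F⌋₊ * (2 * (L : ℝ) ^ 8) := cnt'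
    _ ≤ F * (2 * (L : ℝ) ^ 8) := by gcongr; exact Nat.floor_le F0
    _ ≤ (2 ^ 8 * (C2 * X ^ (ε / 6)) ^ 3 * X ^ ((1 : ℝ) / 2 + α)) *
        (2 * ((C0 + 1) * X ^ (ε / 16)) ^ 8) := by
      rw [hF]; gcongr
    _ = _ := by rw [mul_pow, mul_pow, e16, e6, e]; ring


/-- The bound `𝒩*_α(-1,0;X) ≪ X^{1/2+α+ε}` (Lemma 6 of the paper). -/
theorem stmt_4 (α ε : ℝ) (hα : 0 < α) (hε : 0 < ε) :
    ∃ C : ℝ, ∀ X : ℝ, 1 ≤ X →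
      (Set.ncard { t : ℤ × ℤ × ℤ × ℤ × ℤ × ℤ × ℤ × ℤ × ℤ |
        match t with
        | (ν, d₁, d₂, d₃, d₄, b₁, b₂, b₃, b₄) =>
          (ν = 1 ∨ ν = -1) ∧
          1 ≤ d₁ ∧ 1 ≤ d₂ ∧ 1 ≤ d₃ ∧ 1 ≤ d₄ ∧
          1 ≤ b₁ ∧ 1 ≤ b₂ ∧ 1 ≤ b₃ ∧ 1 ≤ b₄ ∧
          Squarefree (d₁ * d₂ * d₃ * d₄) ∧
          Int.gcd (d₁ * b₁) (d₂ * b₂) = 1 ∧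
          d₂ * b₂ ^ 2 - ν * d₁ * b₁ ^ 2 = d₃ * b₃ ^ 2 ∧
          ν * d₂ * b₂ ^ 2 + d₁ * b₁ ^ 2 = d₄ * b₄ ^ 2 ∧
          ((d₁ * d₂ * d₃ * d₄ : ℤ) : ℝ) ≤ X ∧
          ((d₁ * b₁ ^ 2 : ℤ) : ℝ) ≤ X ^ ((1 : ℝ) / 4 + 2 * α) ∧
          ((d₂ * b₂ ^ 2 : ℤ) : ℝ) ≤ X ^ ((1 : ℝ) / 4 + 2 * α) } : ℝ) ≤
        C * X ^ ((1 : ℝ) / 2 + α + ε) := by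

  obtain ⟨C2, hC2, hdiv⟩ := divisor_bound (ε / 6) (by positivity)
  refine ⟨2 * ((1 + 2 * (1 + 2 * α) / (ε / 16)) + 1) ^ 8 * (2 ^ 8 * C2 ^ 3), ?_⟩
  intro X hX
  generalize hA : { t : ℤ × ℤ × ℤ × ℤ × ℤ × ℤ × ℤ × ℤ × ℤ | _ } = A
  have hA' : ∀ t ∈ A, solP α X t := by
    subst hA
    rintro ⟨v, d1, d2, d3, d4, b1, b2, b3, b4⟩ h
    obtain ⟨q1, q2, q3, q4, q5, q6, q7, q8, q9, q10, q11, q12, q13, q14, q15, q16⟩ := h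
    exact ⟨q1, q2, q3, q4, q5, q6, q7, q8, q9, q10, q11, q12, q13, q14, q15, q16⟩
  clear hA
  have X0 : 0 < X := by linarith
  by_cases hfin : A.Finite
  · rw [Set.ncard_eq_toFinset_card A hfin]
    exact finite_bound α X _ C2 ε hα hε hX rfl hC2 hdiv hfin.toFinset
      (fun t ht => hA' t (hfin.mem_toFinset.mp ht))
  · rw [Set.Infinite.ncard hfin]
    have : 0 < C2 := by linarith
    simp only [Nat.cast_zero]
    positivity
end
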